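/- arXiv:2402.03850 — 9 statements merged into one kernel-verified Lean document; each statement's English description precedes it below -/
import Mathlib

section
/- Let q ≥ 5 be either an odd prime or a power of two, and let K_q = ℚ(ζ_q + ζ_q^{-1}) with ring of integers O_q. If every element of 2O_q^+ is a sum of squares of elements of O_q, then q = 5, 7, or 8. -/
open NumberField

/-- The maximal totally real subfield `K_q = ℚ(ζ_q + ζ_q⁻¹)` of the `q`-th cyclotomic field,
realized inside `ℝ` as `ℚ(2 cos(2π/q))`. -/
noncomputable def Kq (q : ℕ) : IntermediateField ℚ ℝ :=
  IntermediateField.adjoin ℚ {2 * Real.cos (2 * Real.pi / q)}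

/-- An element `α` of the ring of integers of `K` is totally positive if `σ α > 0`
for every real embedding `σ : K →+* ℝ`. -/
def TotallyPositive (K : Type*) [Field K] (α : 𝓞 K) : Prop :=
  ∀ σ : K →+* ℝ, 0 < σ (α : K)

/-- `α` is a sum of squares in a commutative ring. -/
def IsSumOfSquares {R : Type*} [CommRing R] (a : R) : Prop :=
  ∃ (k : ℕ) (x : Fin k → R), a = ∑ i, (x i) ^ 2

namespace CyclotomicSquares

open ZMod ComplexConjugate

/-- The ring `ℤ[ζ_q]`, as a subring of `ℂ`. -/
noncomputable abbrev CycRing (q : ℕ) [NeZero q] : Subalgebra ℤ ℂ :=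
  Algebra.adjoin ℤ {(stdAddChar (1 : ZMod q) : ℂ)}

/-- The root of unity `ζ_q ^ j` as an element of `ℤ[ζ_q]`. -/
noncomputable def root {q : ℕ} [NeZero q] (j : ZMod q) : CycRing q :=
  ⟨stdAddChar (1 : ZMod q), Algebra.subset_adjoin rfl⟩ ^ j.val

section General

variable {q : ℕ} [NeZero q]

lemma coe_root (j : ZMod q) : (root j : ℂ) = stdAddChar j := by
  simp [root, ← AddChar.map_nsmul_eq_pow]

lemma root_add (i j : ZMod q) : root (i + j) = root i * root j := by
  ext; simp [coe_root, AddChar.map_add_eq_mul]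

lemma root_zero : root (0 : ZMod q) = 1 := by
  ext; simp [coe_root]

lemma root_injective : Function.Injective (root : ZMod q → CycRing q) := fun i j h => by
  apply injective_stdAddChar
  rw [← coe_root, ← coe_root, h]

lemma conj_stdAddChar (j : ZMod q) : conj (stdAddChar j : ℂ) = stdAddChar (-j) :=
  (AddChar.map_neg_eq_conj _ _).symm

lemma isPrimitiveRoot_stdAddChar_one :
    IsPrimitiveRoot (stdAddChar (1 : ZMod q) : ℂ) q := by
  have := Complex.isPrimitiveRoot_exp q (NeZero.ne q)
  convert this using 1
  have h := stdAddChar_coe (N := q) 1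
  simpa using h

lemma exists_coeff (x : CycRing q) : ∃ a : ZMod q → ℤ, x = ∑ j, (a j : CycRing q) * root j := by
  obtain ⟨x, hx⟩ := x
  have hx' := hx
  rw [CycRing, Algebra.adjoin_singleton_eq_range_aeval] at hx'
  obtain ⟨p, rfl⟩ := hx'
  suffices h : ∃ a : ZMod q → ℤ, Polynomial.aeval (stdAddChar (1 : ZMod q) : ℂ) p =
      ∑ j, (a j : ℂ) * stdAddChar j by
    obtain ⟨a, ha⟩ := h
    refine ⟨a, Subtype.ext ?_⟩
    push_cast
    simpa [coe_root] using ha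
  clear hx
  induction p using Polynomial.induction_on' with
  | add p r hp hr =>
    obtain ⟨a, ha⟩ := hp
    obtain ⟨b, hb⟩ := hr
    exact ⟨a + b, by simp [ha, hb, add_mul, Finset.sum_add_distrib]⟩
  | monomial n c =>
    refine ⟨Pi.single (n : ZMod q) c, ?_⟩
    rw [Finset.sum_eq_single (n : ZMod q)]
    · simp [Polynomial.aeval_monomial, ← AddChar.map_nsmul_eq_pow]
    · intro b _ hb
      simp [hb]
    · simp

lemma exists_galois (u : (ZMod q)ˣ) :
    ∃ σ : CycRing q →ₐ[ℤ] CycRing q, ∀ j, σ (root j) = root ((u : ZMod q) * j) := by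
  have hi : IsIntegral ℤ (stdAddChar (1 : ZMod q) : ℂ) :=
    isPrimitiveRoot_stdAddChar_one.isIntegral (NeZero.pos q)
  have hval : stdAddChar (1 : ZMod q) ^ (u : ZMod q).val = (root (u : ZMod q) : ℂ) := by
    simp [coe_root, ← AddChar.map_nsmul_eq_pow]
  have hmin := isPrimitiveRoot_stdAddChar_one.minpoly_eq_pow_coprime (ZMod.val_coe_unit_coprime u)
  let B := Algebra.adjoin.powerBasis' hi
  have hgen : B.gen = ⟨stdAddChar (1 : ZMod q), Algebra.subset_adjoin rfl⟩ :=
    Algebra.adjoin.powerBasis'_gen hi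
  have h0 : Polynomial.aeval (root (u : ZMod q)) (minpoly ℤ B.gen) = 0 := by
    have h1 : minpoly ℤ B.gen = minpoly ℤ (stdAddChar (1 : ZMod q) : ℂ) := by
      rw [hgen, ← minpoly.algebraMap_eq (B' := ℂ) Subtype.val_injective]; rfl
    have h2 := minpoly.aeval ℤ (root (u : ZMod q) : ℂ)
    rw [← hval, ← hmin, ← h1, hval] at h2
    apply Subtype.ext
    rw [Subalgebra.aeval_coe] at h2
    exact h2
  refine ⟨B.lift _ h0, fun j => ?_⟩
  have h1 : B.lift _ h0 B.gen = root (u : ZMod q) := B.lift_gen _ h0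
  have hj : root j = B.gen ^ j.val := by rw [hgen, root]
  rw [hj, map_pow, h1]
  ext
  rw [SubmonoidClass.coe_pow, coe_root, coe_root, ← AddChar.map_nsmul_eq_pow]
  simp [mul_comm]

/-- The automorphism `ζ ↦ ζ ^ u` of `ℤ[ζ_q]`. -/
noncomputable def galois (u : (ZMod q)ˣ) : CycRing q →ₐ[ℤ] CycRing q :=
  (exists_galois u).choose

lemma galois_root (u : (ZMod q)ˣ) (j : ZMod q) : galois u (root j) = root ((u : ZMod q) * j) :=
  (exists_galois u).choose_spec j

/-- The discrete Fourier sum `∑ a_j ζ ^ (j k)`. -/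
noncomputable def fourier (a : ZMod q → ℤ) (k : ZMod q) : ℂ :=
  ∑ j, (a j : ℂ) * stdAddChar (k * j)

lemma coe_galois {x : CycRing q} {a : ZMod q → ℤ} (hx : (x : ℂ) = fourier a 1) (u : (ZMod q)ˣ) :
    (galois u x : ℂ) = fourier a u := by
  have : x = ∑ j, (a j : CycRing q) * root j := by
    apply Subtype.ext
    push_cast
    simp [hx, fourier, coe_root]
  rw [this]
  simp only [map_sum, map_mul, map_intCast, galois_root]
  push_cast
  simp [fourier, coe_root]

lemma exists_fourier (x : CycRing q) : ∃ a : ZMod q → ℤ, (x : ℂ) = fourier a 1 := by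
  obtain ⟨a, ha⟩ := exists_coeff x
  refine ⟨a, ?_⟩
  rw [ha]
  push_cast
  simp [fourier, coe_root]

lemma conj_fourier (a : ZMod q → ℤ) (k : ZMod q) : conj (fourier a k) = fourier a (-k) := by
  simp [fourier, conj_stdAddChar]

lemma parseval (a : ZMod q → ℤ) : ∑ k, ‖fourier a k‖ ^ 2 = q * ∑ j, (a j : ℝ) ^ 2 := by
  have h : ∀ k, ((‖fourier a k‖ ^ 2 : ℝ) : ℂ) =
      ∑ i, ∑ j, (a i : ℂ) * a j * stdAddChar (k * (i - j)) := by
    intro k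
    rw [Complex.ofReal_pow, ← Complex.mul_conj', conj_fourier, fourier, fourier,
      Finset.sum_mul_sum]
    refine Finset.sum_congr rfl fun i _ => Finset.sum_congr rfl fun j _ => ?_
    rw [show k * (i - j) = k * i + -k * j by ring, AddChar.map_add_eq_mul]
    ring
  apply Complex.ofReal_injective
  push_cast at h ⊢
  simp_rw [h]
  rw [Finset.sum_comm, Finset.mul_sum]
  refine Finset.sum_congr rfl fun i _ => ?_
  rw [Finset.sum_comm]
  simp_rw [← Finset.mul_sum, AddChar.sum_mulShift _ (isPrimitive_stdAddChar q), sub_eq_zero]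
  simp [ZMod.card]
  ring

lemma fourier_sub (a b : ZMod q → ℤ) (k : ZMod q) :
    fourier (fun j => a j - b j) k = fourier a k - fourier b k := by
  simp [fourier, sub_mul]

lemma fourier_injective {a b : ZMod q → ℤ} (h : ∀ k, fourier a k = fourier b k) : a = b := by
  have h1 := parseval (fun j => a j - b j)
  simp only [fourier_sub, h, sub_self, norm_zero] at h1
  have h2 : ∑ j, ((a j - b j : ℤ) : ℝ) ^ 2 = 0 := by
    have : (q : ℝ) ≠ 0 := NeZero.ne _
    simpa [this] using h1.symm
  rw [Finset.sum_eq_zero_iff_of_nonneg (fun _ _ => sq_nonneg _)] at h2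
  funext j
  have := h2 j (Finset.mem_univ j)
  rw [sq_eq_zero_iff, Int.cast_eq_zero] at this
  lia

lemma fourier_neg (a : ZMod q → ℤ) (k : ZMod q) :
    fourier (fun j => a (-j)) k = fourier a (-k) := by
  rw [fourier, fourier, ← Equiv.sum_comp (Equiv.neg _)]
  simp

lemma fourier_neg_of_real {x : CycRing q} (hr : conj (x : ℂ) = x) {a : ZMod q → ℤ}
    (hx : (x : ℂ) = fourier a 1) (u : (ZMod q)ˣ) : fourier a (-u) = fourier a u := by
  have h : (x : ℂ) = fourier (fun j => a (-j)) 1 := by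
    rw [fourier_neg, ← conj_fourier, ← hx, hr]
  rw [← coe_galois hx u, coe_galois h u, fourier_neg]

lemma galois_sq_of_real {x : CycRing q} (hr : conj (x : ℂ) = x) (u : (ZMod q)ˣ) :
    (galois u x : ℂ) ^ 2 = ((‖(galois u x : ℂ)‖ ^ 2 : ℝ) : ℂ) := by
  obtain ⟨a, ha⟩ := exists_fourier x
  rw [Complex.ofReal_pow, ← Complex.mul_conj', coe_galois ha, conj_fourier,
    fourier_neg_of_real hr ha, sq]

lemma coe_two : ((2 : CycRing q) : ℂ) = 2 := rfl

/-- The sum of the squared absolute values of the conjugates. -/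
noncomputable def energy (x : CycRing q) : ℝ := ∑ u : (ZMod q)ˣ, ‖(galois u x : ℂ)‖ ^ 2

lemma energy_nonneg (x : CycRing q) : 0 ≤ energy x := Finset.sum_nonneg fun _ _ => sq_nonneg _

lemma energy_two_mul (x : CycRing q) : energy (2 * x) = 4 * energy x := by
  simp only [energy, Finset.mul_sum]
  refine Finset.sum_congr rfl fun u _ => ?_
  rw [map_mul, map_ofNat]
  rw [MulMemClass.coe_mul, coe_two, norm_mul, mul_pow]
  norm_num

/-- The element `2 - ζ - ζ⁻¹` of `ℤ[ζ_q]`. -/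
noncomputable def gap (q : ℕ) [NeZero q] : CycRing q := 2 - root 1 - root (-1)

lemma galois_gap (u : (ZMod q)ˣ) :
    (galois u (gap q) : ℂ) = ((‖(galois u (1 - root 1) : ℂ)‖ ^ 2 : ℝ) : ℂ) := by
  rw [Complex.ofReal_pow, ← Complex.mul_conj', gap]
  simp only [map_sub, map_one, galois_root, map_ofNat]
  push_cast
  simp only [coe_two, coe_root, map_sub, map_one, conj_stdAddChar]
  have : (stdAddChar ((u : ZMod q) * 1) : ℂ) * stdAddChar (-((u : ZMod q) * 1)) = 1 := by
    rw [← AddChar.map_add_eq_mul]; simp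
  rw [mul_neg]
  linear_combination -this

lemma sum_energy_eq {ι : Type*} (s : Finset ι) (x : ι → CycRing q)
    (hr : ∀ i ∈ s, conj (x i : ℂ) = x i) (n : ℕ) (h : ∑ i ∈ s, x i ^ 2 = n * gap q) :
    ∑ i ∈ s, energy (x i) = n * energy (1 - root (1 : ZMod q)) := by
  simp only [energy, Finset.mul_sum]
  rw [Finset.sum_comm]
  refine Finset.sum_congr rfl fun u _ => ?_
  have h1 := congrArg (fun y => (galois u y : ℂ)) h
  simp only [map_sum, map_pow, map_mul, map_natCast] at h1
  push_cast at h1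
  rw [galois_gap, Finset.sum_congr rfl fun i hi => galois_sq_of_real (hr i hi) u] at h1
  exact_mod_cast h1

/-- A real element of `ℤ[ζ_q]` lying strictly between `-1` and `1`. -/
def IsSmallReal (x : CycRing q) : Prop := conj (x : ℂ) = x ∧ ‖(x : ℂ)‖ < 1

lemma IsSmallReal.eq_zero {x : CycRing q} (hx : IsSmallReal x) {n : ℤ} (h : (x : ℂ) = n) :
    x = 0 := by
  have h1 := hx.2
  rw [h, Complex.norm_intCast] at h1
  have h2 : n = 0 := by
    rw [← Int.abs_lt_one_iff]
    exact_mod_cast h1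
  apply Subtype.ext
  simp [h, h2]

lemma isSmallReal_zero : IsSmallReal (0 : CycRing q) := by simp [IsSmallReal]

lemma gap_eq : (gap q : ℂ) = ((2 - 2 * Real.cos (2 * Real.pi / q) : ℝ) : ℂ) := by
  have h1 : (stdAddChar (1 : ZMod q) : ℂ) = Complex.exp ((2 * Real.pi / q : ℝ) * Complex.I) := by
    have h := stdAddChar_coe (N := q) 1
    rw [Int.cast_one] at h
    rw [h]
    congr 1
    push_cast
    ring
  have h2 : (stdAddChar (-1 : ZMod q) : ℂ) = Complex.exp (-(2 * Real.pi / q : ℝ) * Complex.I) := by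
    rw [← conj_stdAddChar, h1, ← Complex.exp_conj]
    simp [map_ofNat]
  rw [gap]
  push_cast
  rw [coe_two, coe_root, coe_root, h1, h2, Complex.cos]
  push_cast
  ring

lemma two_mul_two_sub_two_cos_lt_one {q : ℕ} (hq : 11 ≤ q) :
    2 * (2 - 2 * Real.cos (2 * Real.pi / q)) < 1 := by
  have h1 := Real.one_sub_sq_div_two_le_cos (x := 2 * Real.pi / q)
  have h2 : 2 * Real.pi / q ≤ 0.6 := by
    have : (11 : ℝ) ≤ q := by exact_mod_cast hq
    rw [div_le_iff₀ (by linarith)]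
    have := Real.pi_lt_d2
    linarith
  have h3 : 0 ≤ 2 * Real.pi / q := by positivity
  nlinarith

lemma isSmallReal_of_sum (hq : 11 ≤ q) {ι : Type*} (s : Finset ι) (x : ι → CycRing q)
    (hr : ∀ i ∈ s, conj (x i : ℂ) = x i) (h : ∑ i ∈ s, x i ^ 2 = 2 * gap q) :
    ∀ i ∈ s, IsSmallReal (x i) := by
  intro i hi
  refine ⟨hr i hi, ?_⟩
  have hsq : ∀ j ∈ s, (x j : ℂ) ^ 2 = ((‖(x j : ℂ)‖ ^ 2 : ℝ) : ℂ) := fun j hj => by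
    rw [Complex.ofReal_pow, ← Complex.mul_conj', hr j hj, sq]
  have h1 := congrArg (Subtype.val : CycRing q → ℂ) h
  push_cast at h1
  rw [coe_two, gap_eq, Finset.sum_congr rfl hsq] at h1
  have h2 : ∑ j ∈ s, ‖(x j : ℂ)‖ ^ 2 = 2 * (2 - 2 * Real.cos (2 * Real.pi / q)) := by
    exact_mod_cast h1
  have h3 := Finset.single_le_sum (f := fun j => ‖(x j : ℂ)‖ ^ 2) (fun _ _ => sq_nonneg _) hi
  have h4 := two_mul_two_sub_two_cos_lt_one hq
  rw [← sq_lt_one_iff₀ (norm_nonneg _)]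
  linarith

lemma exists_two_squares (hq : 11 ≤ q) {ι : Type*} (s : Finset ι) (x : ι → CycRing q)
    (hr : ∀ i ∈ s, conj (x i : ℂ) = x i) (h : ∑ i ∈ s, x i ^ 2 = 2 * gap q)
    (hmin : ∀ y : CycRing q, IsSmallReal y → y ≠ 0 →
      2 * energy (1 - root (1 : ZMod q)) < 3 * energy y) :
    ∃ y z : CycRing q, IsSmallReal y ∧ IsSmallReal z ∧ y ^ 2 + z ^ 2 = 2 * gap q := by
  classical
  have hsmall := isSmallReal_of_sum hq s x hr h
  have hE := sum_energy_eq s x hr 2 h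
  set t := s.filter fun i => x i ≠ 0 with ht
  have hts : t ⊆ s := Finset.filter_subset _ _
  have hsum : ∑ i ∈ t, x i ^ 2 = 2 * gap q := by
    rw [← h, ht]
    refine Finset.sum_filter_of_ne fun i _ hi h0 => hi ?_
    simp [h0]
  have hEt : ∑ i ∈ t, energy (x i) ≤ 2 * energy (1 - root (1 : ZMod q)) := by
    have := Finset.sum_le_sum_of_subset_of_nonneg hts (f := fun i => energy (x i))
      fun i _ _ => energy_nonneg _
    push_cast at hE
    linarith
  have hcard : t.card ≤ 2 := by
    by_contra! hc
    have hne : t.Nonempty := Finset.card_pos.mp (by omega)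
    have h1 : ∑ i ∈ t, 2 * energy (1 - root (1 : ZMod q)) < ∑ i ∈ t, 3 * energy (x i) :=
      Finset.sum_lt_sum_of_nonempty hne fun i hi =>
        hmin _ (hsmall i (hts hi)) (Finset.mem_filter.mp hi).2
    rw [Finset.sum_const, ← Finset.mul_sum, nsmul_eq_mul] at h1
    have h2 : (3 : ℝ) ≤ t.card := by exact_mod_cast hc
    nlinarith [energy_nonneg (1 - root (1 : ZMod q))]
  have h012 : t.card = 0 ∨ t.card = 1 ∨ t.card = 2 := by omega
  rcases h012 with h0 | h1 | h2
  · rw [Finset.card_eq_zero] at h0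
    refine ⟨0, 0, isSmallReal_zero, isSmallReal_zero, ?_⟩
    rw [← hsum, h0]
    simp
  · obtain ⟨i, hi⟩ := Finset.card_eq_one.mp h1
    refine ⟨x i, 0, hsmall i (hts (by simp [hi])), isSmallReal_zero, ?_⟩
    rw [← hsum, hi]
    simp
  · obtain ⟨i, j, hij, hi⟩ := Finset.card_eq_two.mp h2
    refine ⟨x i, x j, hsmall i (hts (by simp [hi])), hsmall j (hts (by simp [hi])), ?_⟩
    rw [← hsum, hi, Finset.sum_pair hij]

lemma energy_add_energy {x y : CycRing q} (hx : IsSmallReal x) (hy : IsSmallReal y) (n : ℕ)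
    (h : x ^ 2 + y ^ 2 = n * gap q) :
    energy x + energy y = n * energy (1 - root (1 : ZMod q)) := by
  have := sum_energy_eq Finset.univ ![x, y]
    (by simp [Fin.forall_fin_two, hx.1, hy.1]) n (by simpa [Fin.sum_univ_two] using h)
  simpa [Fin.sum_univ_two] using this

lemma coeff_symm {x : CycRing q} (hr : conj (x : ℂ) = x) {a : ZMod q → ℤ}
    (hx : (x : ℂ) = fourier a 1) (ha : ∀ k, ¬ IsUnit k → fourier a (-k) = fourier a k)
    (j : ZMod q) : a (-j) = a j := by
  have h : (fun j => a (-j)) = a := fourier_injective fun k => by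
    rw [fourier_neg]
    by_cases hk : IsUnit k
    · obtain ⟨u, rfl⟩ := hk
      exact fourier_neg_of_real hr hx u
    · exact ha k hk
  exact congrFun h j

lemma sum_units (g : ZMod q → ℝ) :
    ∑ u : (ZMod q)ˣ, g u = ∑ k with IsUnit k, g k := by
  classical
  have : (Finset.univ.filter fun k : ZMod q => IsUnit k) =
      Finset.univ.image (fun u : (ZMod q)ˣ => (u : ZMod q)) := by
    ext k
    simp only [Finset.mem_filter, Finset.mem_univ, true_and, Finset.mem_image]
    rfl
  rw [this, Finset.sum_image fun _ _ _ _ h => Units.ext h]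

lemma one_sub_root_one : ((1 - root (1 : ZMod q) : CycRing q) : ℂ) =
    fourier (Pi.single 0 1 - Pi.single 1 1 : ZMod q → ℤ) 1 := by
  push_cast
  rw [coe_root]
  simp [fourier, sub_mul, Pi.single_apply]

lemma two_dvd_of_sq {x y : CycRing q} (hq : Odd q) (h : x ^ 2 = 2 * y) : ∃ z, x = 2 * z := by
  have hfrob : ∀ x : CycRing q, (2 : CycRing q) ∣
      x ^ 2 - galois (ZMod.unitOfCoprime 2 (Nat.coprime_two_left.mpr hq)) x := by
    intro x
    obtain ⟨a, rfl⟩ := exists_coeff x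
    refine Finset.sum_induction _ (fun x => (2 : CycRing q) ∣
      x ^ 2 - galois (ZMod.unitOfCoprime 2 (Nat.coprime_two_left.mpr hq)) x) ?_ ?_ ?_
    · rintro a b ⟨c, hc⟩ ⟨d, hd⟩
      refine ⟨c + d + a * b, ?_⟩
      rw [map_add]
      linear_combination hc + hd
    · simp
    · intro j _
      obtain ⟨c, hc⟩ : (2 : ℤ) ∣ a j ^ 2 - a j := by
        rw [show a j ^ 2 - a j = (a j - 1) * (a j - 1 + 1) by ring]
        exact (Int.even_mul_succ_self _).two_dvd
      refine ⟨c * root (j + j), ?_⟩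
      have hc' : (a j : CycRing q) ^ 2 - a j = 2 * c := by exact_mod_cast congrArg Int.cast hc
      rw [map_mul, map_intCast, galois_root, ZMod.coe_unitOfCoprime]
      push_cast
      rw [two_mul, mul_pow, sq (root j), ← root_add]
      linear_combination root (j + j) * hc'
  obtain ⟨c, hc⟩ := hfrob x
  set u := ZMod.unitOfCoprime 2 (Nat.coprime_two_left.mpr hq)
  have h1 : galois u x = 2 * (y - c) := by linear_combination h - hc
  have h2 : ∀ x, galois u⁻¹ (galois u x) = x := by
    intro x
    obtain ⟨a, rfl⟩ := exists_coeff x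
    simp [galois_root]
  exact ⟨galois u⁻¹ (y - c), by rw [← h2 x, h1, map_mul, map_ofNat]⟩

lemma le_sum_sq_sub {ι : Type*} [Fintype ι] (a : ι → ℤ) {i i' j j' : ι} (hi : a i' = a i)
    (hj : a j' = a j) (hij : a i ≠ a j) (hi' : i' ≠ i) (hj' : j' ≠ j) :
    4 * (Fintype.card ι : ℤ) - 8 ≤ ∑ l, ∑ m, (a l - a m) ^ 2 := by
  classical
  set D : Finset ι := {i, i', j, j'} with hD
  have h1 : i ≠ j := fun h => hij (by rw [h])
  have h2 : i ≠ j' := fun h => hij (by rw [h, hj])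
  have h3 : i' ≠ j := fun h => hij (by rw [← hi, h])
  have h4 : i' ≠ j' := fun h => hij (by rw [← hi, h, hj])
  have hcard : D.card = 4 := by
    simp [hD, Finset.card_insert_of_notMem, h1, h2, h3, h4, hi'.symm, hj'.symm]
  have hsum : ∀ f : ι → ℤ, ∑ m ∈ D, f m = f i + f i' + f j + f j' := fun f => by
    rw [hD, Finset.sum_insert (by simp [h1, h2, hi'.symm]), Finset.sum_insert (by simp [h3, h4]),
      Finset.sum_pair hj'.symm]
    ring
  have hG : ∀ l, 2 ≤ ∑ m ∈ D, (a l - a m) ^ 2 := fun l => by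
    rw [hsum, hi, hj]
    by_cases hl : a l = a i
    · have : 1 ≤ (a l - a j) ^ 2 := by
        rw [hl]
        have := sq_pos_of_ne_zero (sub_ne_zero.mpr hij)
        omega
      nlinarith [sq_nonneg (a l - a i)]
    · have := sq_pos_of_ne_zero (sub_ne_zero.mpr hl)
      nlinarith [sq_nonneg (a l - a j)]
  rw [← Finset.sum_add_sum_compl D]
  have hA : 2 * (Fintype.card ι : ℤ) ≤ ∑ l ∈ D, ∑ m, (a l - a m) ^ 2 := by
    rw [Finset.sum_comm]
    have := Finset.card_nsmul_le_sum Finset.univ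
      (fun l => ∑ m ∈ D, (a m - a l) ^ 2) 2 fun l _ => by simpa only [sub_sq_comm] using hG l
    simpa [mul_comm] using this
  have hB : 2 * (Fintype.card ι - 4 : ℤ) ≤ ∑ l ∈ Dᶜ, ∑ m, (a l - a m) ^ 2 := by
    have := Finset.card_nsmul_le_sum Dᶜ (fun l => ∑ m, (a l - a m) ^ 2) 2 fun l _ =>
      (hG l).trans (Finset.sum_le_sum_of_subset_of_nonneg (Finset.subset_univ D)
        fun _ _ _ => sq_nonneg _)
    have h5 := Finset.card_add_card_compl D
    rw [nsmul_eq_mul] at this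
    have h6 : ((D.card : ℤ) + (Dᶜ.card : ℤ)) = Fintype.card ι := by exact_mod_cast h5
    rw [hcard] at h6
    push_cast at h6
    linarith
  linarith

end General

section Prime

variable {p : ℕ} [hp : Fact p.Prime]

lemma energy_eq_of_prime {x : CycRing p} {a : ZMod p → ℤ} (hx : (x : ℂ) = fourier a 1) :
    energy x = ((p * ∑ j, a j ^ 2 - (∑ j, a j) ^ 2 : ℤ) : ℝ) := by
  classical
  have h1 := parseval a
  simp only [energy, coe_galois hx]
  rw [sum_units fun k => ‖fourier a k‖ ^ 2]
  rw [← Finset.sum_filter_add_sum_filter_not _ (fun k : ZMod p => IsUnit k)] at h1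
  have h2 : ∑ k : ZMod p with ¬ IsUnit k, ‖fourier a k‖ ^ 2 = (∑ j, (a j : ℝ)) ^ 2 := by
    have : (Finset.univ.filter fun k : ZMod p => ¬ IsUnit k) = {0} := by
      ext k
      simp
    rw [this, Finset.sum_singleton]
    have h3 : fourier a 0 = ((∑ j, (a j : ℝ) : ℝ) : ℂ) := by simp [fourier]
    rw [h3, Complex.norm_real, Real.norm_eq_abs, sq_abs]
  rw [h2] at h1
  push_cast
  linarith

lemma energy_one_sub_root_of_prime : energy (1 - root (1 : ZMod p)) = 2 * p := by
  rw [energy_eq_of_prime one_sub_root_one]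
  have h1 : ∑ j, (Pi.single 0 1 - Pi.single 1 1 : ZMod p → ℤ) j = 0 := by
    simp
  have h2 : ∑ j, (Pi.single 0 1 - Pi.single 1 1 : ZMod p → ℤ) j ^ 2 = 2 := by
    simp [sub_sq, Finset.sum_add_distrib, Finset.sum_sub_distrib, Pi.single_apply]
  rw [h1, h2]
  push_cast
  ring

lemma le_energy_of_prime (hp2 : p ≠ 2) {x : CycRing p} (hx : IsSmallReal x) (h0 : x ≠ 0) :
    2 * (p - 2 : ℝ) ≤ energy x := by
  obtain ⟨a, ha⟩ := exists_fourier x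
  have hsymm : ∀ j, a (-j) = a j := coeff_symm hx.1 ha fun k hk => by
    have : k = 0 := by simpa using hk
    simp [this]
  have hneg : ∀ j : ZMod p, j ≠ 0 → -j ≠ j := fun j hj h => hj <| by
    have h2 : (2 : ZMod p) * j = 0 := by linear_combination -h
    rcases mul_eq_zero.mp h2 with h3 | h3
    · exact absurd ((ZMod.natCast_eq_zero_iff 2 p).mp (by exact_mod_cast h3))
        fun h4 => hp2 ((Nat.prime_dvd_prime_iff_eq hp.out Nat.prime_two).mp h4)
    · exact h3
  obtain ⟨j, hj0, hj⟩ : ∃ j, j ≠ 0 ∧ a 1 ≠ a j := by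
    by_contra! hc
    refine h0 (hx.eq_zero (n := a 0 - a 1) ?_)
    have h1 : fourier a 1 = ∑ j, ((a 1 : ℂ) * stdAddChar j +
        (Pi.single 0 (a 0 - a 1 : ℂ) : ZMod p → ℂ) j) := by
      simp only [fourier, one_mul]
      refine Finset.sum_congr rfl fun j _ => ?_
      by_cases hj : j = 0
      · simp [hj]
      · simp [hj, hc j hj]
    rw [ha, h1, Finset.sum_add_distrib, ← Finset.mul_sum, AddChar.sum_eq_zero_of_ne_one]
    · simp
    · intro h
      have h2 := DFunLike.congr_fun h (1 : ZMod p)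
      rw [AddChar.one_apply, ← AddChar.map_zero_eq_one (stdAddChar : AddChar (ZMod p) ℂ)] at h2
      exact one_ne_zero (injective_stdAddChar h2)
  have h1 := le_sum_sq_sub a (hsymm 1) (hsymm j) hj (hneg 1 one_ne_zero) (hneg j hj0)
  have h2 : ∑ l, ∑ m, (a l - a m) ^ 2 = 2 * (p * ∑ j, a j ^ 2 - (∑ j, a j) ^ 2) := by
    simp only [sub_sq, Finset.sum_add_distrib, Finset.sum_sub_distrib, ← Finset.mul_sum,
      ← Finset.sum_mul, Finset.sum_const, Finset.card_univ, ZMod.card]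
    simp only [nsmul_eq_mul, ← Finset.mul_sum]
    ring
  rw [h2, ZMod.card] at h1
  have h3 : 2 * ((p : ℤ) - 2) ≤ p * ∑ j, a j ^ 2 - (∑ j, a j) ^ 2 := by linarith
  rw [energy_eq_of_prime ha]
  exact_mod_cast h3

lemma IsSmallReal.half_add {x y w : CycRing p} (hx : IsSmallReal x) (hy : IsSmallReal y)
    (h : x + y = 2 * w) : IsSmallReal w := by
  have h1 : (w : ℂ) = ((x : ℂ) + y) / 2 := by
    have := congrArg (Subtype.val : CycRing p → ℂ) h
    push_cast at this
    rw [coe_two] at this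
    rw [this]
    ring
  refine ⟨by rw [h1, map_div₀, map_add, hx.1, hy.1, map_ofNat], ?_⟩
  rw [h1, norm_div, Complex.norm_ofNat]
  have := norm_add_le (x : ℂ) y
  linarith [hx.2, hy.2]

lemma IsSmallReal.neg {x : CycRing p} (hx : IsSmallReal x) : IsSmallReal (-x) := by
  refine ⟨?_, ?_⟩
  · push_cast
    rw [map_neg, hx.1]
  · push_cast
    rw [norm_neg]
    exact hx.2

lemma sq_ne_gap_of_prime (hp2 : p ≠ 2) (t : CycRing p) : t ^ 2 ≠ gap p := by
  intro ht
  have hodd : Odd p := hp.out.odd_of_ne_two hp2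
  have h2 : IsUnit (2 : ZMod p) := (ZMod.unitOfCoprime 2 (Nat.coprime_two_left.mpr hodd)).isUnit
  obtain ⟨m, hm⟩ : ∃ m : ZMod p, m + m = -1 := by
    obtain ⟨u, hu⟩ := h2
    refine ⟨-(u⁻¹ : (ZMod p)ˣ), ?_⟩
    have : (2 : ZMod p) * (u⁻¹ : (ZMod p)ˣ) = 1 := hu ▸ u.mul_inv
    linear_combination -this
  have hr : root m * root m = (root (-1) : CycRing p) := by rw [← root_add, hm]
  have hr' : root (-1) * root 1 = (1 : CycRing p) := by
    rw [← root_add, neg_add_cancel, root_zero]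
  set z := root m * (1 - root 1) with hz
  have hz2 : t ^ 2 + z ^ 2 = 0 := by
    rw [ht, gap, hz]
    linear_combination (1 - root 1) ^ 2 * hr + (root 1 - 2) * hr'
  obtain ⟨w, hw⟩ := two_dvd_of_sq hodd (x := t + z) (y := t * z) (by linear_combination hz2)
  have hzw : z ^ 2 = 2 * (w * z - w ^ 2) := by
    apply mul_left_cancel₀ (two_ne_zero (α := CycRing p))
    linear_combination hz2 - (t - z + 2 * w) * hw
  obtain ⟨y, hy⟩ := two_dvd_of_sq hodd hzw
  have h1 : 1 - root 1 = 2 * (root (-m) * y) := by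
    have : root (-m) * root m = (1 : CycRing p) := by
      rw [← root_add, neg_add_cancel, root_zero]
    linear_combination root (-m) * hy - (1 - root 1) * this
  have h3 := energy_two_mul (root (-m) * y)
  obtain ⟨a, ha⟩ := exists_fourier (root (-m) * y)
  rw [← h1, energy_one_sub_root_of_prime, energy_eq_of_prime ha] at h3
  obtain ⟨k, hk⟩ := hodd
  have h4 : (2 * p : ℤ) = 4 * (p * ∑ j, a j ^ 2 - (∑ j, a j) ^ 2) := by exact_mod_cast h3
  omega

theorem sum_sq_ne_of_prime (hp11 : 11 ≤ p) {ι : Type*} (s : Finset ι) (x : ι → CycRing p)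
    (hr : ∀ i ∈ s, conj (x i : ℂ) = x i) : ∑ i ∈ s, x i ^ 2 ≠ 2 * gap p := by
  intro h
  have hp2 : p ≠ 2 := by omega
  have hpr : (11 : ℝ) ≤ p := by exact_mod_cast hp11
  obtain ⟨x, y, hx, hy, hxy⟩ := exists_two_squares hp11 s x hr h fun y hy h0 => by
    have := le_energy_of_prime hp2 hy h0
    rw [energy_one_sub_root_of_prime]
    linarith
  obtain ⟨w, hw⟩ := two_dvd_of_sq (hp.out.odd_of_ne_two hp2) (x := x + y) (y := gap p + x * y)
    (by linear_combination hxy)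
  have hws := hx.half_add hy hw
  have hvs : IsSmallReal (w - y) :=
    hx.half_add hy.neg (by linear_combination hw)
  have hwv : w ^ 2 + (w - y) ^ 2 = gap p := by
    apply mul_left_cancel₀ (two_ne_zero (α := CycRing p))
    linear_combination hxy - (x - y + 2 * w) * hw
  have hE := energy_add_energy hws hvs 1 (by rw [hwv]; simp)
  rw [energy_one_sub_root_of_prime] at hE
  by_cases hw0 : w = 0
  · exact sq_ne_gap_of_prime hp2 (w - y) (by rw [← hwv, hw0]; ring)
  by_cases hv0 : w - y = 0
  · exact sq_ne_gap_of_prime hp2 w (by rw [← hwv, hv0]; ring)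
  have h1 := le_energy_of_prime hp2 hws hw0
  have h2 := le_energy_of_prime hp2 hvs hv0
  push_cast at hE
  linarith

end Prime

section PowTwo

variable {m : ℕ}

/-- The residue `q / 2` modulo `q = 2 ^ (m + 4)`. -/
def half (m : ℕ) : ZMod (2 ^ (m + 4)) := 2 ^ (m + 3)

/-- The residue `q / 4` modulo `q = 2 ^ (m + 4)`. -/
def quarter (m : ℕ) : ZMod (2 ^ (m + 4)) := 2 ^ (m + 2)

lemma two_pow_eq_zero {k : ℕ} (hk : m + 4 ≤ k) : (2 : ZMod (2 ^ (m + 4))) ^ k = 0 := by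
  have : ((2 ^ k : ℕ) : ZMod (2 ^ (m + 4))) = 0 :=
    (ZMod.natCast_eq_zero_iff _ _).mpr (pow_dvd_pow 2 hk)
  exact_mod_cast this

lemma two_pow_ne_zero {k : ℕ} (hk : k < m + 4) : (2 : ZMod (2 ^ (m + 4))) ^ k ≠ 0 := by
  intro h
  have h1 : ((2 ^ k : ℕ) : ZMod (2 ^ (m + 4))) = 0 := by exact_mod_cast h
  rw [ZMod.natCast_eq_zero_iff, Nat.pow_dvd_pow_iff_le_right (by norm_num)] at h1
  omega

lemma half_add_half : half m + half m = 0 := by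
  rw [half, ← two_mul, ← pow_succ']
  exact two_pow_eq_zero le_rfl

lemma neg_half : -half m = half m := neg_eq_of_add_eq_zero_left half_add_half

lemma quarter_add_quarter : quarter m + quarter m = half m := by
  rw [half, quarter, ← two_mul, ← pow_succ']

lemma half_mul_half : half m * half m = 0 := by
  rw [half, ← pow_add]
  exact two_pow_eq_zero (by omega)

lemma half_mul_quarter : half m * quarter m = 0 := by
  rw [half, quarter, ← pow_add]
  exact two_pow_eq_zero (by omega)

lemma half_ne_zero : half m ≠ 0 := two_pow_ne_zero (by omega)

lemma eq_zero_or_half {j : ZMod (2 ^ (m + 4))} (hj : j + j = 0) : j = 0 ∨ j = half m := by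
  have h1 : ((2 * j.val : ℕ) : ZMod (2 ^ (m + 4))) = 0 := by
    push_cast
    rw [ZMod.natCast_zmod_val]
    linear_combination hj
  obtain ⟨t, ht⟩ : 2 ^ (m + 3) ∣ j.val := by
    refine Nat.dvd_of_mul_dvd_mul_left two_pos ?_
    rw [← pow_succ']
    exact (ZMod.natCast_eq_zero_iff _ _).mp h1
  have h2 := ZMod.val_lt j
  have h3 : t < 2 := by
    by_contra! hc
    have := Nat.mul_le_mul_left (2 ^ (m + 3)) hc
    rw [← ht, ← pow_succ] at this
    exact absurd h2 (not_lt.mpr this)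
  rw [← ZMod.natCast_zmod_val j, ht]
  interval_cases t
  · simp
  · right
    simp [half]

lemma half_mul_of_isUnit {k : ZMod (2 ^ (m + 4))} (hk : IsUnit k) : k * half m = half m := by
  rw [← ZMod.natCast_zmod_val k, ZMod.isUnit_iff_coprime, Nat.coprime_pow_right_iff (by omega),
    Nat.coprime_two_right] at hk
  obtain ⟨t, ht⟩ := hk
  rw [← ZMod.natCast_zmod_val k, ht]
  push_cast
  linear_combination (t : ZMod (2 ^ (m + 4))) * half_add_half

lemma half_mul_of_not_isUnit {k : ZMod (2 ^ (m + 4))} (hk : ¬ IsUnit k) : k * half m = 0 := by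
  rw [← ZMod.natCast_zmod_val k, ZMod.isUnit_iff_coprime, Nat.coprime_pow_right_iff (by omega),
    Nat.coprime_two_right, Nat.not_odd_iff_even] at hk
  obtain ⟨t, ht⟩ := hk
  rw [← ZMod.natCast_zmod_val k, ht]
  push_cast
  linear_combination (t : ZMod (2 ^ (m + 4))) * half_add_half

lemma stdAddChar_half : (stdAddChar (half m) : ℂ) = -1 := by
  have h1 : (stdAddChar (half m) : ℂ) * stdAddChar (half m) = 1 := by
    rw [← AddChar.map_add_eq_mul, half_add_half, AddChar.map_zero_eq_one]
  refine (mul_self_eq_one_iff.mp h1).resolve_left fun h => half_ne_zero (m := m) ?_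
  apply injective_stdAddChar
  rw [h, AddChar.map_zero_eq_one]

lemma root_add_half (j : ZMod (2 ^ (m + 4))) : root (j + half m) = -root j := by
  ext
  push_cast
  rw [coe_root, coe_root, AddChar.map_add_eq_mul, stdAddChar_half]
  ring

/-- The unit `1 + q / 2` modulo `q = 2 ^ (m + 4)`; it sends `ζ` to `-ζ`. -/
def flip (m : ℕ) : (ZMod (2 ^ (m + 4)))ˣ where
  val := 1 + half m
  inv := 1 + half m
  val_inv := by linear_combination half_add_half (m := m) + half_mul_half (m := m)
  inv_val := by linear_combination half_add_half (m := m) + half_mul_half (m := m)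

lemma coe_flip : (flip m : ZMod (2 ^ (m + 4))) = 1 + half m := rfl

lemma galois_flip_root (j : ZMod (2 ^ (m + 4))) :
    galois (flip m) (root j) = root (j + half m * j) := by
  rw [galois_root, coe_flip, add_mul, one_mul]

lemma galois_flip_root_one : galois (flip m) (root 1) = -root 1 := by
  rw [galois_flip_root, mul_one, root_add_half]

lemma galois_flip_root_neg_one : galois (flip m) (root (-1)) = -root (-1) := by
  rw [galois_flip_root, mul_neg_one, neg_half, root_add_half]

lemma galois_flip_galois_flip (x : CycRing (2 ^ (m + 4))) :
    galois (flip m) (galois (flip m) x) = x := by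
  have h : ((flip m : (ZMod (2 ^ (m + 4)))ˣ) : ZMod (2 ^ (m + 4))) * flip m = 1 :=
    (flip m).val_inv
  obtain ⟨a, rfl⟩ := exists_coeff x
  simp only [map_sum, map_mul, map_intCast, galois_root, ← mul_assoc, h, one_mul]

lemma exists_antiperiodic (x : CycRing (2 ^ (m + 4))) :
    ∃ c : ZMod (2 ^ (m + 4)) → ℤ, (∀ j, c (j + half m) = -c j) ∧
      (∀ u : (ZMod (2 ^ (m + 4)))ˣ, fourier c u = 2 * galois u x) ∧
      ∀ k, ¬ IsUnit k → fourier c k = 0 := by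
  obtain ⟨a, ha⟩ := exists_fourier x
  have key : ∀ k, fourier (fun j => a j - a (j + half m)) k =
      fourier a k * (1 - stdAddChar (k * half m)) := by
    intro k
    have h1 : fourier (fun j => a (j + half m)) k = fourier a k * stdAddChar (k * half m) := by
      rw [fourier, ← Equiv.sum_comp (Equiv.addRight (half m)), fourier, Finset.sum_mul]
      refine Finset.sum_congr rfl fun j _ => ?_
      simp only [Equiv.coe_addRight]
      rw [add_assoc, half_add_half, add_zero, mul_add, AddChar.map_add_eq_mul]
      ring
    rw [fourier_sub, h1]
    ring
  refine ⟨fun j => a j - a (j + half m), fun j => ?_, fun u => ?_, fun k hk => ?_⟩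
  · simp only
    rw [add_assoc, half_add_half, add_zero]
    ring
  · rw [key, half_mul_of_isUnit u.isUnit, stdAddChar_half, coe_galois ha]
    ring
  · rw [key, half_mul_of_not_isUnit hk, AddChar.map_zero_eq_one]
    ring

lemma energy_of_antiperiodic {x : CycRing (2 ^ (m + 4))} {c : ZMod (2 ^ (m + 4)) → ℤ}
    (hu : ∀ u : (ZMod (2 ^ (m + 4)))ˣ, fourier c u = 2 * galois u x)
    (hn : ∀ k, ¬ IsUnit k → fourier c k = 0) :
    4 * energy x = 2 ^ (m + 4) * ∑ j, (c j : ℝ) ^ 2 := by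
  classical
  have h1 := parseval c
  rw [← Finset.sum_filter_add_sum_filter_not _ (fun k : ZMod (2 ^ (m + 4)) => IsUnit k),
    ← sum_units fun k => ‖fourier c k‖ ^ 2, Finset.sum_eq_zero (s := Finset.univ.filter _)
      fun k hk => by simp [hn k (Finset.mem_filter.mp hk).2]] at h1
  push_cast at h1
  rw [← h1, energy, Finset.mul_sum, add_zero]
  refine Finset.sum_congr rfl fun u _ => ?_
  rw [hu, norm_mul, mul_pow]
  norm_num

lemma exists_coeff_ne_zero {x : CycRing (2 ^ (m + 4))} (hx : IsSmallReal x) (h0 : x ≠ 0)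
    {c : ZMod (2 ^ (m + 4)) → ℤ} (hc : ∀ j, c (j + half m) = -c j) (hsymm : ∀ j, c (-j) = c j)
    (hxc : fourier c 1 = 2 * x) : ∃ j, c j ≠ 0 ∧ j ≠ -j ∧ j ≠ -j + half m := by
  by_contra! hcon
  refine h0 (hx.eq_zero (n := c 0) ?_)
  have h1 : ∀ j, j ≠ 0 ∧ j ≠ half m → (c j : ℂ) * stdAddChar (1 * j) = 0 := by
    rintro j ⟨hj0, hjh⟩
    suffices c j = 0 by simp [this]
    by_contra hcj
    have hj : j ≠ -j := fun h => by
      rcases eq_zero_or_half (j := j) (by linear_combination h) with h | h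
      · exact hj0 h
      · exact hjh h
    have h2 : c j = -c j := by
      conv_lhs => rw [hcon j hcj hj, hc, hsymm]
    omega
  rw [fourier, Fintype.sum_eq_add 0 (half m) half_ne_zero.symm h1] at hxc
  have h2 := hc 0
  rw [zero_add] at h2
  rw [h2, one_mul, one_mul, stdAddChar_half, AddChar.map_zero_eq_one] at hxc
  push_cast at hxc
  linear_combination -hxc / 2

lemma le_energy_of_pow_two {x : CycRing (2 ^ (m + 4))} (hx : IsSmallReal x) (h0 : x ≠ 0) :
    2 ^ (m + 4) ≤ energy x ∧ (energy x = 2 ^ (m + 4) → galois (flip m) x ^ 2 = x ^ 2) := by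
  classical
  obtain ⟨c, hc, hu, hn⟩ := exists_antiperiodic x
  have hE := energy_of_antiperiodic hu hn
  have hone : ∀ y : CycRing (2 ^ (m + 4)), galois 1 y = y := by
    intro y
    obtain ⟨a, rfl⟩ := exists_coeff y
    simp [galois_root]
  have hxc : fourier c 1 = 2 * x := by
    have := hu 1
    rwa [hone, Units.val_one] at this
  have hsymm : ∀ j, c (-j) = c j := by
    refine coeff_symm (x := 2 * x) ?_ (by rw [hxc]; rfl) fun k hk => ?_
    · rw [MulMemClass.coe_mul, coe_two, map_mul, map_ofNat, hx.1]
    · rw [hn k hk, hn (-k) (by simpa using hk)]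
  obtain ⟨j, hcj, hj1, hj2⟩ := exists_coeff_ne_zero hx h0 hc hsymm hxc
  have hh : ∀ i : ZMod (2 ^ (m + 4)), i ≠ i + half m := fun i h =>
    half_ne_zero (m := m) (by linear_combination -h)
  have hj3 : -j ≠ j + half m := fun h => hj2 (by linear_combination -h - half_add_half (m := m))
  have hj4 : j + half m ≠ -j + half m := fun h => hj1 (by linear_combination h)
  set D : Finset (ZMod (2 ^ (m + 4))) := {j, -j, j + half m, -j + half m} with hD
  have hsum : ∑ i ∈ D, (c i : ℝ) ^ 2 = 4 * (c j : ℝ) ^ 2 := by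
    rw [hD, Finset.sum_insert (by simp [hj1, hj2, half_ne_zero]),
      Finset.sum_insert (by simp [hj3, half_ne_zero]), Finset.sum_pair hj4, hc, hc, hsymm]
    push_cast
    ring
  have hcj1 : (1 : ℝ) ≤ (c j : ℝ) ^ 2 := by
    have := sq_pos_of_ne_zero hcj
    have h1 : 1 ≤ c j ^ 2 := by omega
    exact_mod_cast h1
  have hsplit := Finset.sum_add_sum_compl D fun i => (c i : ℝ) ^ 2
  have hcompl : 0 ≤ ∑ i ∈ Dᶜ, (c i : ℝ) ^ 2 := Finset.sum_nonneg fun _ _ => sq_nonneg _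
  have hqpos : (0 : ℝ) < 2 ^ (m + 4) := by positivity
  refine ⟨by nlinarith, fun hEq => ?_⟩
  have hzero : ∀ i, i ∉ D → c i = 0 := by
    have h4 : ∑ j, (c j : ℝ) ^ 2 = 4 := by
      apply mul_left_cancel₀ hqpos.ne'
      rw [← hE, hEq]
      ring
    have h5 : ∑ i ∈ Dᶜ, (c i : ℝ) ^ 2 = 0 := by linarith
    rw [Finset.sum_eq_zero_iff_of_nonneg fun _ _ => sq_nonneg _] at h5
    intro i hi
    simpa using h5 i (Finset.mem_compl.mpr hi)
  have hmul : ∀ i ∈ D, half m * i = half m * j := by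
    intro i hi
    simp only [hD, Finset.mem_insert, Finset.mem_singleton] at hi
    rcases hi with rfl | rfl | rfl | rfl
    · rfl
    · linear_combination -j * half_add_half (m := m)
    · linear_combination half_mul_half (m := m)
    · linear_combination half_mul_half (m := m) - j * half_add_half (m := m)
  have hflip : fourier c (flip m) = stdAddChar (half m * j) * fourier c 1 := by
    rw [fourier, fourier, Finset.mul_sum]
    refine Finset.sum_congr rfl fun i _ => ?_
    by_cases hi : i ∈ D
    · rw [coe_flip, add_mul, hmul i hi, AddChar.map_add_eq_mul]
      ring
    · simp [hzero i hi]
  have hsq : (stdAddChar (half m * j) : ℂ) ^ 2 = 1 := by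
    rw [sq, ← AddChar.map_add_eq_mul, ← add_mul, half_add_half, zero_mul, AddChar.map_zero_eq_one]
  rw [hu, hxc] at hflip
  ext
  push_cast
  linear_combination ((galois (flip m) x : ℂ) + stdAddChar (half m * j) * x) / 2 * hflip +
    (x : ℂ) ^ 2 * hsq

lemma galois_flip_gap : galois (flip m) (gap (2 ^ (m + 4))) = 2 + root 1 + root (-1) := by
  rw [gap, map_sub, map_sub, galois_flip_root_one, galois_flip_root_neg_one, map_ofNat]
  ring

lemma energy_galois {q : ℕ} [NeZero q] (v : (ZMod q)ˣ) (x : CycRing q) :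
    energy (galois v x) = energy x := by
  have h : ∀ u, galois u (galois v x) = galois (u * v) x := by
    intro u
    obtain ⟨a, rfl⟩ := exists_coeff x
    simp [galois_root, mul_assoc]
  simp only [energy, h]
  exact Equiv.sum_comp (Equiv.mulRight v) fun u => ‖(galois u x : ℂ)‖ ^ 2

lemma energy_one_sub_root_of_pow_two :
    energy (1 - root (1 : ZMod (2 ^ (m + 4)))) = 2 ^ (m + 4) := by
  have h1 : energy (1 - root (1 : ZMod (2 ^ (m + 4)))) +
      energy (galois (flip m) (1 - root (1 : ZMod (2 ^ (m + 4))))) = 2 * 2 ^ (m + 4) := by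
    rw [energy, energy, ← Finset.sum_add_distrib]
    have h2 : ∀ u : (ZMod (2 ^ (m + 4)))ˣ, ‖(galois u (1 - root 1) : ℂ)‖ ^ 2 +
        ‖(galois u (galois (flip m) (1 - root 1)) : ℂ)‖ ^ 2 = 4 := by
      intro u
      rw [map_sub (galois (flip m)), map_one (galois (flip m)), galois_flip_root_one]
      simp only [map_sub, map_one, map_neg, galois_root]
      have h3 := parallelogram_law_with_norm ℝ (1 : ℂ) (root ((u : ZMod (2 ^ (m + 4))) * 1) : ℂ)
      have h4 : ‖(root ((u : ZMod (2 ^ (m + 4))) * 1) : ℂ)‖ = 1 := by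
        rw [coe_root]
        exact AddChar.norm_apply _ _
      rw [h4, norm_one] at h3
      push_cast
      rw [sub_neg_eq_add]
      linarith
    rw [Finset.sum_congr rfl fun u _ => h2 u, Finset.sum_const, Finset.card_univ,
      ZMod.card_units_eq_totient, Nat.totient_prime_pow_succ Nat.prime_two]
    simp
    ring
  rw [energy_galois] at h1
  linarith

lemma sq_ne_two_mul_gap_of_pow_two (x : CycRing (2 ^ (m + 4))) :
    x ^ 2 ≠ 2 * gap (2 ^ (m + 4)) := by
  intro hx
  set y := galois (flip m) x with hy
  have hy2 : y ^ 2 = 2 * (2 + root 1 + root (-1)) := by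
    rw [hy, ← map_pow, hx, map_mul, galois_flip_gap, map_ofNat]
  have hyx : galois (flip m) y = x := galois_flip_galois_flip x
  have hr : root 1 * root (-1) = (1 : CycRing (2 ^ (m + 4))) := by
    rw [← root_add, add_neg_cancel, root_zero]
  have hi : root (quarter m) * root (quarter m) = -1 := by
    rw [← root_add, quarter_add_quarter, ← zero_add (half m), root_add_half, root_zero]
  set g := 2 * (root (quarter m) * (root 1 - root (-1))) with hg
  have hg0 : g ≠ 0 := by
    rw [hg]
    refine mul_ne_zero two_ne_zero (mul_ne_zero ?_ (sub_ne_zero.mpr fun h => ?_))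
    · rintro h
      rw [h] at hi
      simp at hi
    · have h2 := root_injective h
      refine two_pow_ne_zero (m := m) (k := 1) (by omega) ?_
      linear_combination h2
  have hgg : galois (flip m) g = -g := by
    rw [hg, map_mul, map_mul, map_sub, galois_flip_root_one, galois_flip_root_neg_one,
      galois_flip_root, half_mul_quarter, add_zero, map_ofNat]
    ring
  have hsq : (x * y) ^ 2 = g ^ 2 := by
    rw [gap] at hx
    rw [hg]
    linear_combination y ^ 2 * hx + 2 * (2 - root 1 - root (-1)) * hy2 -
      4 * (root 1 - root (-1)) ^ 2 * hi - 16 * hr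
  have hxy : galois (flip m) (x * y) = x * y := by
    rw [map_mul, hyx, ← hy, mul_comm]
  have h2 : (2 : CycRing (2 ^ (m + 4))) ≠ 0 := two_ne_zero
  rcases sq_eq_sq_iff_eq_or_eq_neg.mp hsq with h | h
  · rw [h, hgg] at hxy
    exact mul_ne_zero h2 hg0 (by linear_combination -hxy)
  · rw [h, map_neg, hgg] at hxy
    exact mul_ne_zero h2 hg0 (by linear_combination hxy)

theorem sum_sq_ne_of_pow_two {ι : Type*} (s : Finset ι) (x : ι → CycRing (2 ^ (m + 4)))
    (hr : ∀ i ∈ s, conj (x i : ℂ) = x i) : ∑ i ∈ s, x i ^ 2 ≠ 2 * gap (2 ^ (m + 4)) := by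
  intro h
  have hq : 11 ≤ 2 ^ (m + 4) := by
    have := Nat.pow_le_pow_right (n := 2) (by norm_num) (show 4 ≤ m + 4 by omega)
    omega
  obtain ⟨x, y, hx, hy, hxy⟩ := exists_two_squares hq s x hr h fun y hy h0 => by
    have h1 := (le_energy_of_pow_two hy h0).1
    have : (0 : ℝ) < 2 ^ (m + 4) := by positivity
    rw [energy_one_sub_root_of_pow_two]
    linarith
  have hE := energy_add_energy hx hy 2 hxy
  rw [energy_one_sub_root_of_pow_two] at hE
  push_cast at hE
  by_cases hx0 : x = 0
  · exact sq_ne_two_mul_gap_of_pow_two y (by rw [← hxy, hx0]; ring)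
  by_cases hy0 : y = 0
  · exact sq_ne_two_mul_gap_of_pow_two x (by rw [← hxy, hy0]; ring)
  obtain ⟨hx1, hx2⟩ := le_energy_of_pow_two hx hx0
  obtain ⟨hy1, hy2⟩ := le_energy_of_pow_two hy hy0
  have hflip := congrArg (galois (flip m)) hxy
  rw [map_add, map_pow, map_pow, hx2 (by linarith), hy2 (by linarith), hxy, map_mul, map_ofNat,
    galois_flip_gap, gap] at hflip
  have h1 : root 1 = root (-1 + half m) := by
    rw [root_add_half]
    have h2 : (2 : CycRing (2 ^ (m + 4))) ≠ 0 := two_ne_zero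
    apply mul_left_cancel₀ (mul_ne_zero h2 h2)
    linear_combination -hflip
  refine two_pow_ne_zero (m := m) (k := 2) (by omega) ?_
  linear_combination 2 * root_injective h1 + half_add_half (m := m)

end PowTwo

section TotallyReal

variable {q : ℕ} [NeZero q]

lemma stdAddChar_one_add_neg_one : (stdAddChar (1 : ZMod q) : ℂ) + stdAddChar (-1 : ZMod q) =
    ((2 * Real.cos (2 * Real.pi / q) : ℝ) : ℂ) := by
  have h := gap_eq (q := q)
  rw [gap] at h
  push_cast at h ⊢
  rw [coe_two, coe_root, coe_root] at h
  linear_combination -h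

lemma ofReal_mem_adjoin (x : Kq q) :
    ((x : ℝ) : ℂ) ∈ IntermediateField.adjoin ℚ {(stdAddChar (1 : ZMod q) : ℂ)} := by
  have h : (Kq q).map (Complex.ofRealAm.restrictScalars ℚ) ≤
      IntermediateField.adjoin ℚ {(stdAddChar (1 : ZMod q) : ℂ)} := by
    rw [Kq, IntermediateField.adjoin_map, IntermediateField.adjoin_le_iff]
    rintro _ ⟨_, rfl, rfl⟩
    have h1 := IntermediateField.mem_adjoin_simple_self ℚ (stdAddChar (1 : ZMod q) : ℂ)
    change ((2 * Real.cos (2 * Real.pi / q) : ℝ) : ℂ) ∈ _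
    rw [← stdAddChar_one_add_neg_one, AddChar.map_neg_eq_inv]
    exact add_mem h1 (inv_mem h1)
  exact h ⟨x, x.2, rfl⟩

lemma exists_cycRing (x : 𝓞 (Kq q)) : ∃ y : CycRing q, (y : ℂ) = (((x : Kq q) : ℝ) : ℂ) := by
  set ζ : ℂ := stdAddChar (1 : ZMod q)
  have hprim : IsPrimitiveRoot ζ q := isPrimitiveRoot_stdAddChar_one
  let L := IntermediateField.adjoin ℚ {ζ}
  have : IsCyclotomicExtension {q} ℚ L :=
    (IntermediateField.isCyclotomicExtension_singleton_iff_eq_adjoin _ _ _ _ hprim).mpr rfl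
  let z : L := ⟨ζ, IntermediateField.mem_adjoin_simple_self ℚ ζ⟩
  have hz : IsPrimitiveRoot z q := hprim.of_map_of_injective (f := L.val) L.val.injective
  let X : L := ⟨((x : Kq q) : ℝ), ofReal_mem_adjoin _⟩
  have h_int : IsIntegral ℤ X := by
    have h1 : IsIntegral ℤ ((Complex.ofRealHom.comp (Kq q).val.toRingHom) (x : Kq q)) :=
      map_isIntegral_int _ x.isIntegral_coe
    exact (isIntegral_algHom_iff (L.val.restrictScalars ℤ) L.val.injective).mp h1
  obtain ⟨y, hy⟩ :=
    (IsCyclotomicExtension.Rat.isIntegralClosure_adjoin_singleton hz).isIntegral_iff.mp h_int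
  refine ⟨⟨L.val y, ?_⟩, congrArg L.val hy⟩
  have h2 : L.val y ∈ (Algebra.adjoin ℤ {z}).map (L.val.restrictScalars ℤ) := ⟨y, y.2, rfl⟩
  rw [AlgHom.map_adjoin_singleton] at h2
  exact h2

lemma embedding_two_cos_lt (hq : 2 ≤ q) {K : IntermediateField ℚ ℝ} {β : K}
    (hβ : (β : ℝ) = 2 * Real.cos (2 * Real.pi / q)) (σ : K →+* ℝ) : σ β < 2 := by
  have hq2 : (2 : ℝ) ≤ q := by exact_mod_cast hq
  have hne : β ≠ 2 := by
    intro h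
    have h1 : Real.cos (2 * Real.pi / q) < 1 := by
      rw [← Real.cos_zero]
      refine Real.cos_lt_cos_of_nonneg_of_le_pi le_rfl ?_ (by positivity)
      rw [div_le_iff₀ (by linarith)]
      nlinarith [Real.pi_pos]
    rw [h] at hβ
    have h2 : ((2 : K) : ℝ) = 2 := rfl
    linarith
  have hT : (Polynomial.Chebyshev.T K q).eval (β / 2) = 1 := by
    apply Subtype.val_injective
    have h := Polynomial.Chebyshev.algebraMap_eval_T (R' := ℝ) (β / 2) q
    change algebraMap K ℝ _ = algebraMap K ℝ 1
    rw [h, map_one]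
    have h1 : algebraMap K ℝ (β / 2) = Real.cos (2 * Real.pi / q) := by
      rw [map_div₀, map_ofNat]
      change (β : ℝ) / 2 = _
      rw [hβ]
      ring
    rw [h1, Polynomial.Chebyshev.T_real_cos]
    rw [show ((q : ℤ) : ℝ) * (2 * Real.pi / q) = 2 * Real.pi by push_cast; field_simp]
    exact Real.cos_two_pi
  have hσ : (Polynomial.Chebyshev.T ℝ q).eval (σ β / 2) = 1 := by
    have h1 := congrArg σ hT
    rw [map_one, ← Polynomial.eval_map_apply, Polynomial.Chebyshev.map_T, map_div₀, map_ofNat] at h1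
    exact h1
  by_contra! hc
  rcases hc.eq_or_lt with h | h
  · exact hne (σ.injective (by rw [← h, map_ofNat]))
  · have := Polynomial.Chebyshev.one_lt_eval_T_real (n := q) (by exact_mod_cast NeZero.ne q)
      (x := σ β / 2) (by linarith)
    linarith

lemma exists_sum_sq_eq_two_mul_gap (hq : 2 ≤ q)
    (h : ∀ α : 𝓞 (Kq q), TotallyPositive (Kq q) α → IsSumOfSquares (2 * α)) :
    ∃ (k : ℕ) (x : Fin k → CycRing q), (∀ i, conj (x i : ℂ) = x i) ∧
      ∑ i, x i ^ 2 = 2 * gap q := by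
  let β : Kq q := ⟨2 * Real.cos (2 * Real.pi / q), IntermediateField.mem_adjoin_simple_self ℚ _⟩
  have h_int : IsIntegral ℤ β := by
    have h1 : IsIntegral ℤ ((2 * Real.cos (2 * Real.pi / q) : ℝ) : ℂ) := by
      rw [← stdAddChar_one_add_neg_one, AddChar.map_neg_eq_inv]
      have hprim := isPrimitiveRoot_stdAddChar_one (q := q)
      exact (hprim.isIntegral (NeZero.pos q)).add (hprim.inv.isIntegral (NeZero.pos q))
    have h2 : Function.Injective (Complex.ofRealHom.comp (Kq q).val.toRingHom) :=
      RingHom.injective _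
    exact (isIntegral_algHom_iff
      (Complex.ofRealHom.comp (Kq q).val.toRingHom).toIntAlgHom h2).mp h1
  let B : 𝓞 (Kq q) := ⟨β, h_int⟩
  have hpos : TotallyPositive (Kq q) (2 - B) := by
    intro σ
    have h1 : ((2 - B : 𝓞 (Kq q)) : Kq q) = 2 - β := rfl
    rw [h1, map_sub, map_ofNat, sub_pos]
    exact embedding_two_cos_lt hq rfl σ
  obtain ⟨k, x, hx⟩ := h _ hpos
  choose y hy using fun i => exists_cycRing (x i)
  refine ⟨k, y, fun i => by rw [hy, Complex.conj_ofReal], ?_⟩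
  apply Subtype.ext
  have h2 := congrArg (fun z : 𝓞 (Kq q) => (((z : Kq q) : ℝ) : ℂ)) hx
  have htwo : ((2 : Kq q) : ℝ) = 2 := rfl
  simp only [map_mul, map_sub, map_sum, map_pow, map_ofNat] at h2
  push_cast [htwo] at h2
  push_cast [hy]
  rw [coe_two, gap_eq, ← h2]
  change 2 * (2 - ((2 * Real.cos (2 * Real.pi / q) : ℝ) : ℂ)) = _
  push_cast
  rfl

end TotallyReal

end CyclotomicSquares

/-- Let `q ≥ 5` be an odd prime or a power of two. If every element of `2𝓞_{K_q}⁺` is a sum of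
squares of integers of `K_q`, then `q = 5`, `7` or `8`. -/
theorem stmt2 (q : ℕ) (hq5 : 5 ≤ q)
    (hq : (Nat.Prime q ∧ Odd q) ∨ ∃ m : ℕ, q = 2 ^ m)
    (h : ∀ α : 𝓞 ↥(Kq q), TotallyPositive ↥(Kq q) α → IsSumOfSquares (2 * α)) :
    q = 5 ∨ q = 7 ∨ q = 8 := by
  have : NeZero q := ⟨by omega⟩
  obtain ⟨k, x, hr, hx⟩ := CyclotomicSquares.exists_sum_sq_eq_two_mul_gap (by omega) h
  rcases hq with ⟨hp, hodd⟩ | ⟨m, rfl⟩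
  · by_cases hq11 : 11 ≤ q
    · have : Fact q.Prime := ⟨hp⟩
      exact absurd hx (CyclotomicSquares.sum_sq_ne_of_prime hq11 _ x fun i _ => hr i)
    · interval_cases q <;> first | omega | revert hp hodd; decide
  · by_cases hm : 4 ≤ m
    · obtain ⟨n, rfl⟩ := Nat.exists_eq_add_of_le' hm
      exact absurd hx (CyclotomicSquares.sum_sq_ne_of_pow_two _ x fun i _ => hr i)
    · interval_cases m <;> omega
end

section
/- Let K be a totally real number field of degree d and let γ ∈ O_K^+. If Tr_{K/ℚ}(γ) < (5/2)d, then γ is indecomposable or γ ∈ ℤ. -/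
open NumberField

/-- A totally positive integer is indecomposable if it is not the sum of two
totally positive integers. -/
def Indecomposable (K : Type*) [Field K] (α : 𝓞 K) : Prop :=
  ¬ ∃ β γ : 𝓞 K, TotallyPositive K β ∧ TotallyPositive K γ ∧ α = β + γ

namespace TotallyRealTrace

/-- The tangent line to `log` at `k` lies above its graph. -/
lemma log_le_tangent {u k : ℝ} (hu : 0 < u) (hk : 0 < k) :
    Real.log u ≤ u / k - 1 + Real.log k := by
  have h := Real.log_le_sub_one_of_pos (div_pos hu hk)
  rw [Real.log_div hu.ne' hk.ne'] at h
  linarith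

/-- Numerical bounds on logarithms follow from bounds on integer powers. -/
lemma mul_log_le_of_pow_le_exp {P : ℝ} (hP : 0 < P) (q : ℕ) {t : ℝ}
    (h : P ^ q ≤ Real.exp t) : q * Real.log P ≤ t := by
  rw [← Real.log_pow]
  exact (Real.log_le_iff_le_exp (pow_pos hP q)).2 h

lemma pow_le_exp_natCast (n : ℕ) : (2.7 : ℝ) ^ n ≤ Real.exp n := by
  rw [← Real.exp_one_pow]
  exact pow_le_pow_left₀ (by norm_num) (by linarith [Real.exp_one_gt_d9]) n

lemma exp_natCast_le_pow (n : ℕ) : Real.exp n ≤ (2.72 : ℝ) ^ n := by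
  rw [← Real.exp_one_pow]
  exact pow_le_pow_left₀ (Real.exp_pos 1).le (by linarith [Real.exp_one_lt_d9]) n

lemma mul_weighted_log_le {a b c N : ℝ} (ha : 0 < a) (hb : 0 < b) (hc : 0 < c)
    (q : ℕ) (h : (a ^ 2 * b ^ 3 * c) ^ q ≤ Real.exp N) :
    q * (2 * Real.log a + 3 * Real.log b + Real.log c) ≤ N := by
  have := mul_log_le_of_pow_le_exp (by positivity) q h
  rwa [Real.log_mul (by positivity) (by positivity), Real.log_mul (by positivity) (by positivity),
    Real.log_pow, Real.log_pow] at this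

lemma pow_le_exp_neg_natCast {x : ℝ} (n : ℕ) (h : x * (2.72 : ℝ) ^ n ≤ 1) (hx : 0 ≤ x) :
    x ≤ Real.exp (-n) := by
  rw [Real.exp_neg, ← one_div, le_div_iff₀ (Real.exp_pos _)]
  exact (mul_le_mul_of_nonneg_left (exp_natCast_le_pow n) hx).trans h

/-- The auxiliary function inequality behind the trace bound `3/2`. -/
lemma auxiliary_log_inequality {x : ℝ} (hx : 0 < x) (hx1 : x - 1 ≠ 0)
    (hq : x ^ 2 - 3 * x + 1 ≠ 0) :
    2 * Real.log |x| + 3 * Real.log |x - 1| + Real.log |x ^ 2 - 3 * x + 1| ≤ 10 / 3 * x - 5 := by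
  rw [abs_of_pos hx]
  rcases lt_or_gt_of_ne hx1 with h1 | h1 <;> rcases lt_or_gt_of_ne hq with h2 | h2
  · rw [abs_of_neg h1, abs_of_neg h2]
    have e1 := log_le_tangent hx (show (0 : ℝ) < 11 / 20 by norm_num)
    have e2 := log_le_tangent (neg_pos.2 h1) (show (0 : ℝ) < 9 / 20 by norm_num)
    have e3 := log_le_tangent (neg_pos.2 h2) (show (0 : ℝ) < 139 / 400 by norm_num)
    have e4 := mul_weighted_log_le (a := 11 / 20) (b := 9 / 20) (c := 139 / 400)
      (by norm_num) (by norm_num) (by norm_num) 2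
      (pow_le_exp_neg_natCast 9 (by norm_num) (by norm_num))
    push_cast at e4
    nlinarith
  · rw [abs_of_neg h1, abs_of_pos h2]
    have hx' : x < 2 / 5 := by nlinarith
    have e1 := log_le_tangent hx (show (0 : ℝ) < 1 / 6 by norm_num)
    have e2 := log_le_tangent (neg_pos.2 h1) (show (0 : ℝ) < 5 / 6 by norm_num)
    have e3 := log_le_tangent h2 (show (0 : ℝ) < 19 / 36 by norm_num)
    have e4 := mul_weighted_log_le (a := 1 / 6) (b := 5 / 6) (c := 19 / 36)
      (by norm_num) (by norm_num) (by norm_num) 3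
      (pow_le_exp_neg_natCast 14 (by norm_num) (by norm_num))
    push_cast at e4
    nlinarith
  · rw [abs_of_pos h1, abs_of_neg h2]
    have e1 := log_le_tangent hx (show (0 : ℝ) < 2 by norm_num)
    have e2 := log_le_tangent h1 (show (0 : ℝ) < 1 by norm_num)
    have e3 := log_le_tangent (neg_pos.2 h2) (show (0 : ℝ) < 1 by norm_num)
    have e4 := mul_weighted_log_le (a := 2) (b := 1) (c := 1)
      (by norm_num) (by norm_num) (by norm_num) 2
      (le_trans (by norm_num) (pow_le_exp_natCast 3))
    push_cast at e4
    nlinarith [sq_nonneg (x - 2 + 1 / 6)]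
  · rw [abs_of_pos h1, abs_of_pos h2]
    have hx' : 261 / 100 < x := by nlinarith
    have e1 := log_le_tangent hx (show (0 : ℝ) < 7 / 2 by norm_num)
    have e2 := log_le_tangent h1 (show (0 : ℝ) < 5 / 2 by norm_num)
    have e3 := log_le_tangent (show 0 < x - 19 / 50 by linarith) (show (0 : ℝ) < 78 / 25 by norm_num)
    have e3' := log_le_tangent (show 0 < x - 261 / 100 by linarith) (show (0 : ℝ) < 89 / 100 by norm_num)
    have e5 : Real.log (x ^ 2 - 3 * x + 1) ≤ Real.log (x - 19 / 50) + Real.log (x - 261 / 100) := by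
      rw [← Real.log_mul (by linarith) (by linarith)]
      exact Real.log_le_log h2 (by nlinarith)
    have e4 := mul_weighted_log_le (a := 7 / 2) (b := 5 / 2) (c := 78 / 25 * (89 / 100))
      (by norm_num) (by norm_num) (by norm_num) 2
      (le_trans (by norm_num) (pow_le_exp_natCast 13))
    rw [Real.log_mul (by norm_num) (by norm_num)] at e4
    push_cast at e4
    linarith

/-- At the roots of `X ^ 2 - 3 X + 1`, the function `x ↦ x - 3 / 2` is a positive multiple
of `log`. -/
lemma exists_eq_add_mul_log : ∃ a : ℝ, 0 < a ∧ ∀ x : ℝ, x ^ 2 - 3 * x + 1 = 0 →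
    x = 3 / 2 + a * Real.log |x| := by
  have h5 : √5 ^ 2 = 5 := Real.sq_sqrt (by norm_num)
  have hs : 2 < √5 := by
    rw [Real.lt_sqrt (by norm_num)]; norm_num
  set r : ℝ := (3 + √5) / 2 with hr
  have hlog : 0 < Real.log r := Real.log_pos (by linarith)
  refine ⟨(r - 3 / 2) / Real.log r, div_pos (by linarith) hlog, fun x hx ↦ ?_⟩
  rw [Real.log_abs]
  have hi : r⁻¹ = 3 - r := by
    apply inv_eq_of_mul_eq_one_right
    rw [hr]
    linarith
  have hmul : (x - r) * (x - r⁻¹) = 0 := by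
    rw [hi, hr]
    linarith
  rcases mul_eq_zero.1 hmul with h | h
  · rw [sub_eq_zero.1 h]
    field_simp
    ring
  · rw [sub_eq_zero.1 h, Real.log_inv, mul_neg, div_mul_cancel₀ _ hlog.ne', hi]
    ring

variable {K : Type*} [Field K] [NumberField K]

/-- The real embedding underlying a complex embedding of a totally real field. -/
noncomputable def realEmbedding (htr : ∀ (σ : K →+* ℂ) (x : K), (σ x).im = 0)
    (σ : K →ₐ[ℚ] ℂ) : K →+* ℝ :=
  NumberField.ComplexEmbedding.IsReal.embedding (φ := (σ : K →+* ℂ))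
    (ComplexEmbedding.isReal_iff.2 (RingHom.ext fun x ↦ Complex.conj_eq_iff_im.2 (htr σ x)))

lemma coe_realEmbedding (htr : ∀ (σ : K →+* ℂ) (x : K), (σ x).im = 0)
    (σ : K →ₐ[ℚ] ℂ) (x : K) : (realEmbedding htr σ x : ℂ) = σ x :=
  NumberField.ComplexEmbedding.IsReal.coe_embedding_apply _ x

lemma trace_eq_sum_realEmbedding (htr : ∀ (σ : K →+* ℂ) (x : K), (σ x).im = 0)
    (x : K) :
    ((Algebra.trace ℚ K x : ℚ) : ℝ) = ∑ σ : K →ₐ[ℚ] ℂ, realEmbedding htr σ x := by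
  have h := trace_eq_sum_embeddings (K := ℚ) (L := K) ℂ (x := x)
  simp only [← coe_realEmbedding htr] at h
  rw [eq_ratCast] at h
  exact_mod_cast h

lemma norm_eq_prod_realEmbedding (htr : ∀ (σ : K →+* ℂ) (x : K), (σ x).im = 0)
    (x : K) :
    ((Algebra.norm ℚ x : ℚ) : ℝ) = ∏ σ : K →ₐ[ℚ] ℂ, realEmbedding htr σ x := by
  have h := Algebra.norm_eq_prod_embeddings ℚ ℂ x
  simp only [← coe_realEmbedding htr] at h
  rw [eq_ratCast] at h
  exact_mod_cast h

lemma sum_log_nonneg (htr : ∀ (σ : K →+* ℂ) (x : K), (σ x).im = 0)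
    {x : 𝓞 K} (hx : x ≠ 0) :
    0 ≤ ∑ σ : K →ₐ[ℚ] ℂ, Real.log |realEmbedding htr σ (x : K)| := by
  have hx' : (x : K) ≠ 0 := by simpa using hx
  rw [← Real.log_prod fun σ _ ↦ abs_ne_zero.2 ((map_ne_zero _).2 hx'), ← Finset.abs_prod,
    ← norm_eq_prod_realEmbedding, ← Algebra.coe_norm_int]
  apply Real.log_nonneg
  have h := Int.one_le_abs (Algebra.norm_ne_zero_iff.2 hx : Algebra.norm ℤ x ≠ 0)
  exact_mod_cast h

lemma sum_const_embeddings (c : ℝ) :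
    ∑ _σ : K →ₐ[ℚ] ℂ, c = Module.finrank ℚ K * c := by
  rw [Finset.sum_const, Finset.card_univ, AlgHom.card, nsmul_eq_mul]

lemma ne_zero_of_totallyPositive (htr : ∀ (σ : K →+* ℂ) (x : K), (σ x).im = 0)
    {x : 𝓞 K} (hx : TotallyPositive K x) : x ≠ 0 := by
  rintro rfl
  have σ : K →ₐ[ℚ] ℂ := IsAlgClosed.lift
  simpa using hx (realEmbedding htr σ)

/-- A totally positive integer has trace at least the degree. -/
lemma finrank_le_trace (htr : ∀ (σ : K →+* ℂ) (x : K), (σ x).im = 0)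
    {x : 𝓞 K} (hx : TotallyPositive K x) :
    (Module.finrank ℚ K : ℚ) ≤ Algebra.trace ℚ K (x : K) := by
  rw [← Rat.cast_le (K := ℝ), trace_eq_sum_realEmbedding htr]
  have h0 := sum_log_nonneg htr (ne_zero_of_totallyPositive htr hx)
  have hle : ∑ σ : K →ₐ[ℚ] ℂ, Real.log |realEmbedding htr σ (x : K)| ≤
      ∑ σ : K →ₐ[ℚ] ℂ, (realEmbedding htr σ (x : K) - 1) :=
    Finset.sum_le_sum fun σ _ ↦ by
      rw [Real.log_abs]
      exact Real.log_le_sub_one_of_pos (hx _)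
  rw [Finset.sum_sub_distrib, sum_const_embeddings] at hle
  push_cast
  linarith

/-- A totally positive integer other than `1` has trace at least `3 / 2` times the degree. -/
lemma three_halves_mul_finrank_le_trace (htr : ∀ (σ : K →+* ℂ) (x : K), (σ x).im = 0)
    {x : 𝓞 K} (hx : TotallyPositive K x) (hx1 : x ≠ 1) :
    (3 / 2 : ℚ) * Module.finrank ℚ K ≤ Algebra.trace ℚ K (x : K) := by
  rw [← Rat.cast_le (K := ℝ), trace_eq_sum_realEmbedding htr]
  push_cast
  have h0 := sum_log_nonneg htr (ne_zero_of_totallyPositive htr hx)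
  have hmap (σ : K →ₐ[ℚ] ℂ) : realEmbedding htr σ ((x ^ 2 - 3 * x + 1 : 𝓞 K) : K) =
      realEmbedding htr σ (x : K) ^ 2 - 3 * realEmbedding htr σ (x : K) + 1 := by
    have h3 : algebraMap (𝓞 K) K 3 = 3 := map_ofNat _ 3
    have h3' : realEmbedding htr σ 3 = 3 := map_ofNat _ 3
    simp [h3, h3']
  by_cases hq : x ^ 2 - 3 * x + 1 = 0
  · obtain ⟨a, ha0, ha⟩ := exists_eq_add_mul_log
    have hσ (σ : K →ₐ[ℚ] ℂ) : realEmbedding htr σ (x : K) =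
        3 / 2 + a * Real.log |realEmbedding htr σ (x : K)| := by
      apply ha
      rw [← hmap, hq]
      simp
    rw [Finset.sum_congr rfl fun σ _ ↦ hσ σ, Finset.sum_add_distrib, sum_const_embeddings,
      ← Finset.mul_sum]
    linarith [mul_nonneg ha0.le h0]
  · have h1 := sum_log_nonneg htr (sub_ne_zero.2 hx1)
    have h2 := sum_log_nonneg htr hq
    have hle := Finset.sum_le_sum fun (σ : K →ₐ[ℚ] ℂ) (_ : σ ∈ Finset.univ) ↦
      auxiliary_log_inequality (hx (realEmbedding htr σ))
        (by
          have : ((x - 1 : 𝓞 K) : K) ≠ 0 := by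
            simpa only [ne_eq, RingOfIntegers.coe_eq_zero_iff] using sub_ne_zero.2 hx1
          simpa using (map_ne_zero (realEmbedding htr σ)).2 this)
        (by
          have : ((x ^ 2 - 3 * x + 1 : 𝓞 K) : K) ≠ 0 := by
            simpa only [ne_eq, RingOfIntegers.coe_eq_zero_iff] using hq
          exact hmap σ ▸ (map_ne_zero (realEmbedding htr σ)).2 this)
    simp only [hmap] at h2
    simp only [map_sub, map_one] at h1
    rw [Finset.sum_add_distrib, Finset.sum_add_distrib, Finset.sum_sub_distrib,
      sum_const_embeddings, ← Finset.mul_sum, ← Finset.mul_sum, ← Finset.mul_sum] at hle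
    linarith

end TotallyRealTrace

/-- If `K` is a totally real number field of degree `d` and `γ ∈ 𝓞_K` is totally positive
with `Tr_{K/ℚ}(γ) < (5/2) d`, then `γ` is indecomposable or `γ ∈ ℤ`. -/
theorem stmt4 (K : Type*) [Field K] [NumberField K]
    (htr : ∀ (σ : K →+* ℂ) (x : K), (σ x).im = 0)
    (γ : 𝓞 K) (hγ : TotallyPositive K γ)
    (hTr : Algebra.trace ℚ K (γ : K) < (5 / 2 : ℚ) * (Module.finrank ℚ K : ℚ)) :
    Indecomposable K γ ∨ ∃ n : ℤ, γ = (n : 𝓞 K) := by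
  by_contra! hcon
  obtain ⟨hdec, hint⟩ := hcon
  obtain ⟨β, δ, hβ, hδ, rfl⟩ := not_not.1 hdec
  have hd : (0 : ℚ) < Module.finrank ℚ K := by exact_mod_cast Module.finrank_pos
  rw [show ((β + δ : 𝓞 K) : K) = β + δ from map_add _ _ _, map_add] at hTr
  have hβd := TotallyRealTrace.finrank_le_trace htr hβ
  have hδd := TotallyRealTrace.finrank_le_trace htr hδ
  by_cases h1 : β = 1
  · by_cases h2 : δ = 1
    · exact hint 2 (by rw [h1, h2]; norm_num)
    · linarith [TotallyRealTrace.three_halves_mul_finrank_le_trace htr hδ h2]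
  · linarith [TotallyRealTrace.three_halves_mul_finrank_le_trace htr hβ h1]
end

section
/- Let K be a totally real number field of degree d and let c > 1 be a real number such that every α ∈ O_K^+ with Tr_{K/ℚ}(α) < cd equals 1. Let γ ∈ O_K^+ be primitive, meaning no rational integer n ≥ 2 divides γ in O_K, and suppose Nr_{K/ℚ}(γ) < 2^{d−1}(1+c). Then γ is indecomposable. -/
open NumberField

theorem prod_add_sq_ge_five_pow {ι : Type*} [Fintype ι] (a b : ι → ℝ) (ha : ∀ i, 0 < a i)
    (hb : ∀ i, 0 < b i) (hab : 1 ≤ (∏ i, a i) * ∏ i, b i)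
    (hsub : 1 ≤ (∏ i, (a i - b i)) ^ 2) :
    (5 : ℝ) ^ Fintype.card ι ≤ (∏ i, (a i + b i)) ^ 2 := by
  have amgm : ∀ x y : ℝ, 0 ≤ x → 0 ≤ y → 5 ^ 5 * (x * y ^ 4) ≤ (x + 4 * y) ^ 5 := by
    intro x y hx hy
    have : 0 ≤ (x - y) ^ 2 * (x ^ 3 + 22 * x ^ 2 * y + 203 * x * y ^ 2 + 1024 * y ^ 3) := by
      positivity
    linarith
  have key : ∏ i, (5 ^ 5 * ((a i - b i) ^ 2 * (a i * b i) ^ 4)) ≤ ∏ i, ((a i + b i) ^ 2) ^ 5 := by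
    refine Finset.prod_le_prod (fun i _ => by positivity) fun i _ => ?_
    refine (amgm _ _ (sq_nonneg _) (mul_pos (ha i) (hb i)).le).trans_eq ?_
    ring
  simp only [Finset.prod_mul_distrib, Finset.prod_pow, Finset.prod_const, Finset.card_univ] at key
  rw [← Finset.prod_mul_distrib] at hab
  have h1 : (1 : ℝ) ≤ (∏ i, (a i - b i)) ^ 2 * (∏ i, a i * b i) ^ 4 :=
    one_le_mul_of_one_le_of_one_le hsub (one_le_pow₀ hab)
  rw [Finset.prod_mul_distrib] at h1
  refine le_of_pow_le_pow_left₀ (n := 5) (by norm_num) (by positivity) ?_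
  refine le_trans ?_ key
  rw [pow_right_comm]
  exact le_mul_of_one_le_right (by positivity) h1

theorem four_pow_mul_prod_le_prod_add_sq {ι : Type*} [Fintype ι] (a b : ι → ℝ)
    (ha : ∀ i, 0 < a i) (hb : ∀ i, 0 < b i) :
    4 ^ Fintype.card ι * ((∏ i, a i) * ∏ i, b i) ≤ (∏ i, (a i + b i)) ^ 2 := by
  have key : ∏ i, (4 * (a i * b i)) ≤ ∏ i, (a i + b i) ^ 2 := by
    refine Finset.prod_le_prod (fun i _ => ?_) fun i _ => ?_
    · have := ha i; have := hb i; positivity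
    · nlinarith [sq_nonneg (a i - b i)]
  simpa only [Finset.prod_mul_distrib, Finset.prod_pow, Finset.prod_const, Finset.card_univ]
    using key

theorem three_mul_two_pow_le_of_five_pow_le {d : ℕ} (hd : 4 ≤ d) {x : ℝ} (hx : 0 ≤ x)
    (h : (5 : ℝ) ^ d ≤ x ^ 2) : 2 ^ (d - 1) * 3 ≤ x := by
  obtain ⟨k, rfl⟩ := Nat.exists_eq_add_of_le hd
  refine le_of_pow_le_pow_left₀ (n := 2) two_ne_zero hx (le_trans ?_ h)
  have h45 : (4 : ℝ) ^ k ≤ 5 ^ k := pow_le_pow_left₀ (by norm_num) (by norm_num) k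
  have h4 : ((2 : ℝ) ^ k) ^ 2 = 4 ^ k := by rw [pow_right_comm]; norm_num
  have e : 4 + k - 1 = k + 3 := by omega
  rw [e, pow_add, pow_add, mul_pow, mul_pow, h4]
  have : (0 : ℝ) < 4 ^ k := by positivity
  linarith

/-- In degree at most three, the bound on `∏ (1 + ε i)` follows from bounds on the elementary
symmetric functions of `ε`. -/
theorem two_pow_mul_le_prod_one_add {d : ℕ} (hd0 : 0 < d) (hd : d < 4) {c : ℝ} (hc : 1 < c)
    (hc2 : c ≤ 2) (ε : Fin d → ℝ) (hε : ∀ i, 0 < ε i) (hsum : c * d ≤ ∑ i, ε i)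
    (hprod : 2 ≤ ∏ i, ε i ∨ ∏ i, ε i = 1 ∧ c * d ≤ ∑ i, (ε i)⁻¹) :
    2 ^ (d - 1) * (1 + c) ≤ ∏ i, (1 + ε i) := by
  interval_cases d
  · simp at hsum ⊢
    linarith
  · simp only [Fin.prod_univ_two, Fin.sum_univ_two] at *
    norm_num at *
    have : 1 ≤ ε 0 * ε 1 := by rcases hprod with h | h <;> linarith
    linarith
  · simp only [Fin.prod_univ_three, Fin.sum_univ_three] at *
    have h0 := hε 0
    have h1 := hε 1
    have h2 := hε 2
    generalize ε 0 = x at *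
    generalize ε 1 = y at *
    generalize ε 2 = z at *
    norm_num at *
    rcases hprod with h | ⟨h, h'⟩
    · have e2 : 3 ≤ x * y + y * z + z * x := by
        refine le_of_pow_le_pow_left₀ (n := 2) two_ne_zero (by positivity) ?_
        have : 2 * 3 ≤ (x * y * z) * (x + y + z) :=
          mul_le_mul h (by linarith) (by norm_num) (by positivity)
        nlinarith [sq_nonneg (x * y - y * z), sq_nonneg (y * z - z * x),
          sq_nonneg (z * x - x * y)]
      linarith
    · have e2 : x⁻¹ + y⁻¹ + z⁻¹ = x * y + y * z + z * x := by
        have hx : x⁻¹ = y * z := inv_eq_of_mul_eq_one_right (by linarith)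
        have hy : y⁻¹ = z * x := inv_eq_of_mul_eq_one_right (by linarith)
        have hz : z⁻¹ = x * y := inv_eq_of_mul_eq_one_right (by linarith)
        rw [hx, hy, hz]; ring
      linarith

theorem exists_real_embeddings (K : Type*) [Field K] [NumberField K]
    (htr : ∀ (σ : K →+* ℂ) (x : K), (σ x).im = 0) :
    ∃ e : Fin (Module.finrank ℚ K) → (K →+* ℝ), ∀ x : K,
      ((Algebra.norm ℚ x : ℚ) : ℝ) = ∏ i, e i x ∧
      ((Algebra.trace ℚ K x : ℚ) : ℝ) = ∑ i, e i x := by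
  have hreal : ∀ σ : K →+* ℂ, ComplexEmbedding.IsReal σ := fun σ =>
    RingHom.ext fun x => Complex.conj_eq_iff_im.mpr (htr σ x)
  let f : Fin (Module.finrank ℚ K) ≃ (K →ₐ[ℚ] ℂ) :=
    (Fintype.equivFinOfCardEq (AlgHom.card ℚ K ℂ)).symm
  refine ⟨fun i => (hreal (f i).toRingHom).embedding, fun x => ⟨?_, ?_⟩⟩
  · have h := Algebra.norm_eq_prod_embeddings ℚ ℂ x
    rw [← f.prod_comp] at h
    apply Complex.ofReal_injective
    push_cast [ComplexEmbedding.IsReal.coe_embedding_apply]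
    simpa using h
  · have h := trace_eq_sum_embeddings ℂ (K := ℚ) (x := x)
    rw [← f.sum_comp] at h
    apply Complex.ofReal_injective
    push_cast [ComplexEmbedding.IsReal.coe_embedding_apply]
    simpa using h

theorem one_le_norm_sq {K : Type*} [Field K] [NumberField K] {x : 𝓞 K} (hx : x ≠ 0) :
    (1 : ℝ) ≤ ((Algebra.norm ℚ (x : K) : ℚ) : ℝ) ^ 2 := by
  rw [← Algebra.coe_norm_int]
  have h : Algebra.norm ℤ x ≠ 0 := Algebra.norm_ne_zero_iff.mpr hx
  have h1 : 1 ≤ (Algebra.norm ℤ x) ^ 2 := Int.add_one_le_iff.mpr (sq_pos_of_ne_zero h)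
  exact_mod_cast h1

theorem one_le_norm_of_pos {K : Type*} [Field K] [NumberField K] {x : 𝓞 K}
    (hx : (0 : ℝ) < ((Algebra.norm ℚ (x : K) : ℚ) : ℝ)) :
    (1 : ℝ) ≤ ((Algebra.norm ℚ (x : K) : ℚ) : ℝ) := by
  rw [← Algebra.coe_norm_int] at *
  have h1 : 0 < Algebra.norm ℤ x := by exact_mod_cast hx
  exact_mod_cast h1

theorem norm_eq_one_of_isUnit {K : Type*} [Field K] [NumberField K] {x : 𝓞 K}
    (hx : (0 : ℝ) < ((Algebra.norm ℚ (x : K) : ℚ) : ℝ)) (h : IsUnit x) :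
    ((Algebra.norm ℚ (x : K) : ℚ) : ℝ) = 1 := by
  have h' := isUnit_iff_norm.mp h
  rw [RingOfIntegers.coe_norm, abs_of_pos (by exact_mod_cast hx)] at h'
  exact_mod_cast h'

theorem two_le_norm_of_not_isUnit {K : Type*} [Field K] [NumberField K] {x : 𝓞 K}
    (hx : (0 : ℝ) < ((Algebra.norm ℚ (x : K) : ℚ) : ℝ)) (h : ¬ IsUnit x) :
    (2 : ℝ) ≤ ((Algebra.norm ℚ (x : K) : ℚ) : ℝ) := by
  rw [isUnit_iff_norm, RingOfIntegers.coe_norm, abs_of_pos (by exact_mod_cast hx)] at h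
  rw [← Algebra.coe_norm_int] at *
  have h1 : 0 < Algebra.norm ℤ x := by exact_mod_cast hx
  have h2 : Algebra.norm ℤ x ≠ 1 := by exact_mod_cast h
  have h3 : 2 ≤ Algebra.norm ℤ x := by omega
  exact_mod_cast h3

theorem norm_add_ge_of_isUnit {K : Type*} [Field K] [NumberField K]
    {d : ℕ} (hd0 : 0 < d) (hd : d < 4) (e : Fin d → (K →+* ℝ))
    (he : ∀ x : K, ((Algebra.norm ℚ x : ℚ) : ℝ) = ∏ i, e i x ∧
      ((Algebra.trace ℚ K x : ℚ) : ℝ) = ∑ i, e i x)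
    {c : ℝ} (hc : 1 < c) (hc2 : c ≤ 2)
    (hsmall : ∀ α : 𝓞 K, TotallyPositive K α →
      ((Algebra.trace ℚ K (α : K) : ℚ) : ℝ) < c * (d : ℝ) → α = 1)
    {α β : 𝓞 K} (hα : TotallyPositive K α) (hβ : TotallyPositive K β) (hne : α ≠ β)
    (hu : IsUnit α) :
    2 ^ (d - 1) * (1 + c) ≤ ((Algebra.norm ℚ ((α + β : 𝓞 K) : K) : ℚ) : ℝ) := by
  obtain ⟨ε, rfl⟩ : α ∣ β := hu.dvd
  have hε : TotallyPositive K ε := fun σ => by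
    have := hβ σ
    rw [RingOfIntegers.coe_eq_algebraMap, map_mul, map_mul] at this
    exact (mul_pos_iff_of_pos_left (hα σ)).mp this
  have hε1 : ε ≠ 1 := by rintro rfl; simp at hne
  have pos : ∀ x : 𝓞 K, TotallyPositive K x → (0 : ℝ) < ((Algebra.norm ℚ (x : K) : ℚ) : ℝ) :=
    fun x hx => by
      rw [(he x).1]
      exact Finset.prod_pos fun i _ => hx (e i)
  have trace_ge : ∀ x : 𝓞 K, TotallyPositive K x → x ≠ 1 → c * d ≤ ∑ i, e i x :=
    fun x hx h1 => by
      rw [← (he x).2]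
      exact not_lt.mp fun h => h1 (hsmall x hx h)
  have heq : ((Algebra.norm ℚ ((α + α * ε : 𝓞 K) : K) : ℚ) : ℝ) = ∏ i, (1 + e i ε) := by
    have : ((α + α * ε : 𝓞 K) : K) = α * (1 + ε) := by push_cast; ring
    rw [this, map_mul, Rat.cast_mul, norm_eq_one_of_isUnit (pos α hα) hu, one_mul, (he _).1]
    simp
  rw [heq]
  refine two_pow_mul_le_prod_one_add hd0 hd hc hc2 _ (fun i => hε (e i)) (trace_ge ε hε hε1) ?_
  by_cases hεu : IsUnit ε
  · right
    rw [← (he ε).1]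
    refine ⟨norm_eq_one_of_isUnit (pos ε hε) hεu, ?_⟩
    obtain ⟨δ, hδ⟩ := hεu.exists_right_inv
    have hinv : ∀ σ : K →+* ℝ, (σ (ε : K))⁻¹ = σ (δ : K) := fun σ => by
      refine inv_eq_of_mul_eq_one_right ?_
      rw [← map_mul, ← map_mul, hδ, map_one, map_one]
    simp only [hinv]
    refine trace_ge δ (fun σ => ?_) ?_
    · rw [← hinv]
      exact inv_pos.mpr (hε σ)
    · rintro rfl
      exact hε1 (by simpa using hδ)
  · left
    rw [← (he ε).1]
    exact two_le_norm_of_not_isUnit (pos ε hε) hεu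

/-- Let `K` be a totally real number field of degree `d` and let `c > 1` be such that every
totally positive integer of trace `< c d` equals `1`. If `γ` is a primitive totally positive
integer with `Nr(γ) < 2^(d-1) (1 + c)`, then `γ` is indecomposable. -/
theorem stmt5 (K : Type*) [Field K] [NumberField K]
    (htr : ∀ (σ : K →+* ℂ) (x : K), (σ x).im = 0)
    (c : ℝ) (hc : 1 < c)
    (hsmall : ∀ α : 𝓞 K, TotallyPositive K α →
      ((Algebra.trace ℚ K (α : K) : ℚ) : ℝ) < c * (Module.finrank ℚ K : ℝ) → α = 1)
    (γ : 𝓞 K) (hγ : TotallyPositive K γ)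
    (hprim : ∀ n : ℤ, 2 ≤ n → ¬ ((n : 𝓞 K) ∣ γ))
    (hNr : ((Algebra.norm ℚ (γ : K) : ℚ) : ℝ) <
      2 ^ (Module.finrank ℚ K - 1) * (1 + c)) :
    Indecomposable K γ := by
  rintro ⟨α, β, hα, hβ, rfl⟩
  refine absurd hNr (not_lt.mpr ?_)
  have hd0 : 0 < Module.finrank ℚ K := Module.finrank_pos
  obtain ⟨e, he⟩ := exists_real_embeddings K htr
  generalize Module.finrank ℚ K = d at *
  have hc2 : c ≤ 2 := by
    by_contra! h
    have map_two : ∀ σ : K →+* ℝ, σ ((2 : 𝓞 K) : K) = 2 := fun σ =>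
      map_ofNat (σ.comp (algebraMap (𝓞 K) K)) 2
    have h2 : (2 : 𝓞 K) = 1 := by
      refine hsmall 2 (fun σ => (map_two σ).symm ▸ two_pos) ?_
      rw [(he _).2]
      have : (0 : ℝ) < d := by exact_mod_cast hd0
      simp only [map_two, Finset.sum_const, Finset.card_univ, Fintype.card_fin, nsmul_eq_mul]
      nlinarith
    norm_num at h2
  have hne : α ≠ β := by
    rintro rfl
    exact hprim 2 le_rfl ⟨α, by push_cast; ring⟩
  have pos : ∀ x : 𝓞 K, TotallyPositive K x → (0 : ℝ) < ((Algebra.norm ℚ (x : K) : ℚ) : ℝ) :=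
    fun x hx => by
      rw [(he x).1]
      exact Finset.prod_pos fun i _ => hx (e i)
  rcases lt_or_ge d 4 with hd | hd
  · by_cases hαu : IsUnit α
    · exact norm_add_ge_of_isUnit hd0 hd e he hc hc2 hsmall hα hβ hne hαu
    by_cases hβu : IsUnit β
    · rw [add_comm α β]
      exact norm_add_ge_of_isUnit hd0 hd e he hc hc2 hsmall hβ hα hne.symm hβu
    have h := four_pow_mul_prod_le_prod_add_sq (fun i => e i α) (fun i => e i β)
      (fun i => hα (e i)) (fun i => hβ (e i))
    have hsum : ((Algebra.norm ℚ ((α + β : 𝓞 K) : K) : ℚ) : ℝ) = ∏ i, (e i α + e i β) := by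
      rw [(he _).1]; simp
    rw [← hsum, ← (he _).1, ← (he _).1, Fintype.card_fin] at h
    have hαβ : (2 : ℝ) * 2 ≤ _ := mul_le_mul (two_le_norm_of_not_isUnit (pos α hα) hαu)
      (two_le_norm_of_not_isUnit (pos β hβ) hβu) (by norm_num) (pos α hα).le
    have h4 : ((2 : ℝ) ^ d * 2) ^ 2 ≤ ((Algebra.norm ℚ ((α + β : 𝓞 K) : K) : ℚ) : ℝ) ^ 2 := by
      refine le_trans ?_ h
      rw [mul_pow, pow_right_comm, show (2 : ℝ) ^ 2 = 4 by norm_num]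
      exact mul_le_mul_of_nonneg_left (by linarith) (by positivity)
    refine le_trans ?_ (le_of_pow_le_pow_left₀ two_ne_zero (pos _ hγ).le h4)
    obtain ⟨k, rfl⟩ := Nat.exists_eq_succ_of_ne_zero hd0.ne'
    rw [Nat.succ_sub_one, pow_succ, mul_assoc]
    exact mul_le_mul_of_nonneg_left (by linarith) (by positivity)
  · have hsum : ((Algebra.norm ℚ ((α + β : 𝓞 K) : K) : ℚ) : ℝ) = ∏ i, (e i α + e i β) := by
      rw [(he _).1]; simp
    have h := prod_add_sq_ge_five_pow (fun i => e i α) (fun i => e i β)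
      (fun i => hα (e i)) (fun i => hβ (e i))
      (by
        rw [← (he _).1, ← (he _).1]
        exact one_le_mul_of_one_le_of_one_le (one_le_norm_of_pos (pos α hα))
          (one_le_norm_of_pos (pos β hβ)))
      (by
        have := one_le_norm_sq (sub_ne_zero.mpr hne)
        rw [(he _).1] at this
        simpa using this)
    rw [Fintype.card_fin, ← hsum] at h
    refine le_trans ?_ (three_mul_two_pow_le_of_five_pow_le hd (pos _ hγ).le h)
    exact mul_le_mul_of_nonneg_left (by linarith) (by positivity)
end

section
/- Let K be a totally real number field. If every element of 2O_K^+ is a sum of squares of elements of O_K, then K is generated as a field extension of ℚ by the set of all α ∈ O_K with house(α) < 2 + √6. -/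
open NumberField

/-- When every complex embedding of `K` is real, the house of `x` is attained at some real
embedding. -/
theorem exists_real_embedding_abs_eq_house {K : Type*} [Field K] [NumberField K]
    (htr : ∀ (σ : K →+* ℂ) (x : K), (σ x).im = 0) (x : K) :
    ∃ σ : K →+* ℝ, |σ x| = house x := by
  obtain ⟨φ, -, hφ⟩ := Finset.exists_mem_eq_sup' (s := (Finset.univ : Finset (K →+* ℂ)))
    Finset.univ_nonempty (fun φ => ‖φ x‖₊)
  have hreal : ComplexEmbedding.IsReal φ := by
    rw [ComplexEmbedding.isReal_iff]
    ext y
    exact Complex.conj_eq_iff_im.mpr (htr φ y)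
  refine ⟨hreal.embedding, ?_⟩
  rw [house_eq_sup', hφ, coe_nnnorm, ← hreal.coe_embedding_apply, Complex.norm_real,
    Real.norm_eq_abs]

/-- The absolute value of a real conjugate of `x` is at most the house of `x`. -/
theorem abs_real_embedding_le_house {K : Type*} [Field K] [NumberField K]
    (σ : K →+* ℝ) (x : K) : |σ x| ≤ house x := by
  have h := norm_embedding_le_house x (Complex.ofRealHom.comp σ)
  simpa using h

/-- A real number that is at least `2 + √6` can be exceeded by a natural number `n` with
`t + n < t ^ 2 / 2`. -/
theorem exists_nat_gt_add_lt_sq_div_two {t : ℝ} (ht : 2 + √6 ≤ t) :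
    ∃ n : ℕ, t < n ∧ t + n < t ^ 2 / 2 := by
  have h6 : (2.4 : ℝ) < √6 := Real.lt_sqrt_of_sq_lt (by norm_num)
  rcases lt_or_ge t 5 with h5 | h5
  · exact ⟨5, by exact_mod_cast h5, by push_cast; nlinarith⟩
  · refine ⟨⌊t⌋₊ + 1, by exact_mod_cast Nat.lt_floor_add_one t, ?_⟩
    have := Nat.floor_le (show 0 ≤ t by linarith)
    push_cast
    nlinarith

/-- Adding to an algebraic integer a natural number greater than its house makes it totally
positive. -/
theorem totallyPositive_add_natCast {K : Type*} [Field K] [NumberField K] {x : 𝓞 K} {n : ℕ}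
    (hn : house (x : K) < n) : TotallyPositive K (x + n) := by
  intro σ
  have h := abs_le.mp (abs_real_embedding_le_house σ (x : K))
  simp only [map_add, map_natCast]
  linarith [h.1]

theorem coe_add_natCast {K : Type*} [Field K] (x : 𝓞 K) (n : ℕ) :
    ((x + n : 𝓞 K) : K) = x + n := by
  simp

/-- An intermediate field contains `x` as soon as it contains a translate of `x` by a natural
number. -/
theorem mem_of_coe_add_natCast_mem {K : Type*} [Field K] [NumberField K]
    {F : IntermediateField ℚ K} {x : 𝓞 K} {n : ℕ} (h : ((x + n : 𝓞 K) : K) ∈ F) :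
    (x : K) ∈ F := by
  rw [coe_add_natCast] at h
  simpa using sub_mem h (natCast_mem F n)

/-- An intermediate field of a number field that contains every totally positive algebraic
integer is the whole field. -/
theorem eq_top_of_totallyPositive_mem {K : Type*} [Field K] [NumberField K]
    {F : IntermediateField ℚ K} (hF : ∀ α : 𝓞 K, TotallyPositive K α → (α : K) ∈ F) :
    F = ⊤ := by
  have hint (x : 𝓞 K) : (x : K) ∈ F := by
    obtain ⟨n, hn⟩ := exists_nat_gt (house (x : K))
    exact mem_of_coe_add_natCast_mem (hF _ (totallyPositive_add_natCast hn))
  refine eq_top_iff.mpr fun x _ => ?_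
  obtain ⟨a, b, -, rfl⟩ := IsFractionRing.div_surjective (A := 𝓞 K) x
  exact div_mem (hint a) (hint b)

/-- If every element of `2𝓞_K⁺` is a sum of squares, then `K` is generated over `ℚ` by
the algebraic integers of house `< 2 + √6`. -/
theorem stmt6 (K : Type*) [Field K] [NumberField K]
    (htr : ∀ (σ : K →+* ℂ) (x : K), (σ x).im = 0)
    (h2 : ∀ α : 𝓞 K, TotallyPositive K α → IsSumOfSquares (2 * α)) :
    IntermediateField.adjoin ℚ
      {x : K | (∃ α : 𝓞 K, (α : K) = x) ∧
        ∀ σ : K →+* ℝ, |σ x| < 2 + Real.sqrt 6} = ⊤ := by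
  set F := IntermediateField.adjoin ℚ
      {x : K | (∃ α : 𝓞 K, (α : K) = x) ∧ ∀ σ : K →+* ℝ, |σ x| < 2 + Real.sqrt 6}
  refine eq_top_of_totallyPositive_mem ?_
  by_contra! ⟨α₀, hα₀, hα₀F⟩
  let S : Set (𝓞 K) :=
    {α | TotallyPositive K α ∧ (α : K) ∉ F ∧ house (α : K) ≤ house (α₀ : K)}
  have hSfin : S.Finite := by
    refine Set.Finite.of_finite_image (f := ((↑) : 𝓞 K → K)) ?_
      RingOfIntegers.coe_injective.injOn
    refine (Embeddings.finite_of_norm_le K ℂ (house (α₀ : K))).subset ?_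
    rintro _ ⟨α, hα, rfl⟩
    exact ⟨α.isIntegral_coe, fun φ => (norm_embedding_le_house _ φ).trans hα.2.2⟩
  obtain ⟨α, ⟨hα, hαF, hαle⟩, hmin⟩ :=
    Set.exists_min_image S (fun α => house (α : K)) hSfin ⟨α₀, hα₀, hα₀F, le_rfl⟩
  obtain ⟨k, x, hx⟩ := h2 α hα
  have hxK : 2 * (α : K) = ∑ i, (x i : K) ^ 2 := by
    have h := congrArg (algebraMap (𝓞 K) K) hx
    simpa only [map_mul, map_ofNat, map_sum, map_pow] using h
  obtain ⟨i, hi⟩ : ∃ i, (x i : K) ∉ F := by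
    by_contra! h
    have h2α : 2 * (α : K) ∈ F := hxK ▸ sum_mem fun i _ => pow_mem (h i) 2
    exact hαF (by simpa using div_mem h2α (ofNat_mem F 2))
  have hge : 2 + √6 ≤ house (x i : K) := by
    by_contra! h
    exact hi (IntermediateField.subset_adjoin ℚ _
      ⟨⟨x i, rfl⟩, fun σ => (abs_real_embedding_le_house σ _).trans_lt h⟩)
  have hsq : house (x i : K) ^ 2 ≤ 2 * house (α : K) := by
    obtain ⟨σ, hσ⟩ := exists_real_embedding_abs_eq_house htr (x i : K)
    have hsum : 2 * σ (α : K) = ∑ j, σ (x j : K) ^ 2 := by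
      have h := congrArg σ hxK
      simpa only [map_mul, map_ofNat, map_sum, map_pow] using h
    calc house (x i : K) ^ 2 = σ (x i : K) ^ 2 := by rw [← hσ, sq_abs]
      _ ≤ ∑ j, σ (x j : K) ^ 2 :=
        Finset.single_le_sum (f := fun j => σ (x j : K) ^ 2) (fun j _ => sq_nonneg _)
          (Finset.mem_univ i)
      _ = 2 * σ (α : K) := hsum.symm
      _ ≤ 2 * house (α : K) := by
        gcongr
        exact (le_abs_self _).trans (abs_real_embedding_le_house σ _)
  obtain ⟨n, hn, hlt⟩ := exists_nat_gt_add_lt_sq_div_two hge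
  have hβF : ((x i + n : 𝓞 K) : K) ∉ F := mt mem_of_coe_add_natCast_mem hi
  have hβ : house ((x i + n : 𝓞 K) : K) < house (α : K) := by
    have h : house ((x i + n : 𝓞 K) : K) ≤ house (x i : K) + n := by
      rw [coe_add_natCast]
      have hnat : house (n : K) = n := by simpa using house_intCast (K := K) (n : ℤ)
      exact (house_add_le _ _).trans_eq (by rw [hnat])
    linarith
  exact hβ.not_ge (hmin _ ⟨totallyPositive_add_natCast hn, hβF, hβ.le.trans hαle⟩)
end

section
/- Fix a squarefree integer D > 1. There exists a constant c > 0, depending only on D, such that for every totally real quartic number field K containing √D, with discriminant Δ, and for every β ∈ O_K with β ∉ ℚ(√D), one has Tr_{K/ℚ}(β²) ≥ c·Δ^{1/2}. -/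
open NumberField

/-- The discriminant of a family of integers forming a `ℚ`-basis is at least the field
discriminant in absolute value. -/
theorem abs_discr_le_abs_discr_of_linearIndependent {K : Type*} [Field K] [NumberField K]
    {ι : Type*} [Fintype ι] [DecidableEq ι] (hι : Fintype.card ι = Module.finrank ℚ K)
    (b : ι → 𝓞 K) (hb : LinearIndependent ℚ (fun i => (b i : K))) :
    (|NumberField.discr K| : ℚ) ≤ |Algebra.discr ℚ (fun i => (b i : K))| := by
  classical
  have e : Module.Free.ChooseBasisIndex ℤ (𝓞 K) ≃ ι := by
    refine Fintype.equivOfCardEq ?_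
    rw [hι, Module.finrank_eq_card_basis (integralBasis K)]
  set B := (integralBasis K).reindex e with hB
  have hB' : Algebra.discr ℚ B = (NumberField.discr K : ℚ) := by
    rw [hB, Module.Basis.coe_reindex, Algebra.discr_reindex, coe_discr]
  set Q : Matrix ι ι ℤ := Matrix.of fun i j => (RingOfIntegers.basis K).repr (b j) (e.symm i)
    with hQ
  have hBQ : B.toMatrix (fun i => (b i : K)) = Q.map (algebraMap ℤ ℚ) := by
    ext i j
    simp [hB, hQ, Module.Basis.toMatrix_apply, integralBasis_repr_apply]
  have hdet : (B.toMatrix (fun i => (b i : K))).det = (Q.det : ℚ) := by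
    rw [hBQ]
    exact ((algebraMap ℤ ℚ).map_det Q).symm
  have key : Algebra.discr ℚ (fun i => (b i : K)) = (Q.det : ℚ) ^ 2 * NumberField.discr K := by
    rw [← hB', ← hdet, ← Algebra.discr_of_matrix_vecMul, Module.Basis.toMatrix_map_vecMul]
  have hne : Algebra.discr ℚ (fun i => (b i : K)) ≠ 0 := by
    have : Nonempty ι := Fintype.card_pos_iff.1 (hι ▸ Module.finrank_pos)
    have := Algebra.discr_not_zero_of_basis ℚ (basisOfLinearIndependentOfCardEqFinrank hb hι)
    rwa [coe_basisOfLinearIndependentOfCardEqFinrank] at this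
  have hQ0 : Q.det ≠ 0 := by
    rintro h
    exact hne (by rw [key, h]; simp)
  have h1 : (1 : ℚ) ≤ (Q.det : ℚ) ^ 2 := by
    exact_mod_cast (sq_pos_of_ne_zero hQ0 : 0 < Q.det ^ 2)
  rw [key, abs_mul, abs_of_nonneg (sq_nonneg (Q.det : ℚ))]
  exact le_mul_of_one_le_left (abs_nonneg _) h1

/-- A determinant whose `j`-th column is bounded by `B j` is at most `n! ∏ B j`. -/
theorem norm_det_le_factorial_mul_prod {ι : Type*} [Fintype ι] [DecidableEq ι]
    (M : Matrix ι ι ℂ) (B : ι → ℝ) (h : ∀ i j, ‖M i j‖ ≤ B j) :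
    ‖M.det‖ ≤ (Fintype.card ι).factorial * ∏ j, B j := by
  rw [Matrix.det_apply]
  refine (norm_sum_le _ _).trans ?_
  have : ∀ σ ∈ (Finset.univ : Finset (Equiv.Perm ι)),
      ‖Equiv.Perm.sign σ • ∏ i, M (σ i) i‖ ≤ ∏ j, B j := by
    intro σ _
    have hs : ‖Equiv.Perm.sign σ • ∏ i, M (σ i) i‖ = ‖∏ i, M (σ i) i‖ := by
      rcases Int.units_eq_one_or (Equiv.Perm.sign σ) with h | h <;> simp [h]
    rw [hs, norm_prod]
    exact Finset.prod_le_prod (fun _ _ => norm_nonneg _) (fun i _ => h _ _)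
  refine (Finset.sum_le_card_nsmul _ _ _ this).trans ?_
  simp [Fintype.card_perm]

/-- The discriminant of a family whose conjugates are bounded by `B j`. -/
theorem abs_discr_le_of_norm_embedding_le {K : Type*} [Field K] [NumberField K]
    {ι : Type*} [Fintype ι] [DecidableEq ι] (hι : Fintype.card ι = Module.finrank ℚ K)
    (b : ι → K) (B : ι → ℝ) (h : ∀ (σ : K →ₐ[ℚ] ℂ) j, ‖σ (b j)‖ ≤ B j) :
    ((|Algebra.discr ℚ b| : ℚ) : ℝ) ≤ ((Fintype.card ι).factorial * ∏ j, B j) ^ 2 := by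
  have e : ι ≃ (K →ₐ[ℚ] ℂ) := Fintype.equivOfCardEq (by rw [hι, AlgHom.card])
  have h1 := Algebra.discr_eq_det_embeddingsMatrixReindex_pow_two ℚ ℂ b e
  have h2 : ((|Algebra.discr ℚ b| : ℚ) : ℝ) = ‖algebraMap ℚ ℂ (Algebra.discr ℚ b)‖ := by
    simp
  rw [h2, h1, norm_pow, ← Matrix.det_transpose]
  gcongr
  refine norm_det_le_factorial_mul_prod _ _ fun i j => ?_
  simpa [Algebra.embeddingsMatrixReindex, Algebra.embeddingsMatrix] using h (e i) j

/-- In a totally real field every conjugate of `x` satisfies `|σ x|² ≤ Tr (x²)`. -/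
theorem sq_norm_embedding_le_trace_sq {K : Type*} [Field K] [NumberField K]
    (hK : ∀ (σ : K →+* ℂ) (x : K), (σ x).im = 0) (x : K) (σ : K →ₐ[ℚ] ℂ) :
    ‖σ x‖ ^ 2 ≤ ((Algebra.trace ℚ K (x ^ 2) : ℚ) : ℝ) := by
  have hre : ∀ τ : K →ₐ[ℚ] ℂ, (τ (x ^ 2)).re = ‖τ x‖ ^ 2 := by
    intro τ
    have : (τ x).im = 0 := hK (τ : K →+* ℂ) x
    rw [map_pow, Complex.sq_norm, Complex.normSq_apply, pow_two, Complex.mul_re, this]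
    ring
  have h := congrArg Complex.re (trace_eq_sum_embeddings (K := ℚ) ℂ (x := x ^ 2))
  rw [Complex.re_sum, Finset.sum_congr rfl fun τ _ => hre τ] at h
  have h' : ((Algebra.trace ℚ K (x ^ 2) : ℚ) : ℝ) = ∑ τ : K →ₐ[ℚ] ℂ, ‖τ x‖ ^ 2 := by
    rw [← h]; simp
  rw [h']
  exact Finset.single_le_sum (f := fun τ : K →ₐ[ℚ] ℂ => ‖τ x‖ ^ 2)
    (fun τ _ => sq_nonneg _) (Finset.mem_univ σ)

theorem Int.not_isSquare_of_squarefree {D : ℤ} (hD : Squarefree D) (hD1 : 1 < D) :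
    ¬ IsSquare D := by
  rintro ⟨r, rfl⟩
  have := Int.isUnit_iff.1 (hD r dvd_rfl)
  rcases this with rfl | rfl <;> norm_num at hD1

/-- If `s² = D` is not a square and `β ∉ ℚ(s)`, then `1, s, β, sβ` are independent over `ℚ`. -/
theorem linearIndependent_one_sqrt_mul {K : Type*} [Field K] [CharZero K] {D : ℤ}
    (hD : ¬ IsSquare D) {s β : K} (hs : s ^ 2 = D)
    (hβ : β ∉ IntermediateField.adjoin ℚ {s}) :
    LinearIndependent ℚ ![1, s, β, s * β] := by
  have hpair : ∀ a c : ℚ, (a : K) + c * s = 0 → a = 0 ∧ c = 0 := by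
    intro a c h
    have hc : c = 0 := by
      by_contra hc
      refine hD (Rat.isSquare_intCast_iff.1 ⟨a / c, ?_⟩)
      have hcK : (c : K) ≠ 0 := by exact_mod_cast hc
      have : (D : K) = ((a / c * (a / c) : ℚ) : K) := by
        have h1 : s = -(a / c : K) := by
          field_simp
          linear_combination h
        rw [← hs, h1]
        push_cast
        ring
      exact_mod_cast this
    subst hc
    simpa using h
  rw [Fintype.linearIndependent_iff]
  intro g hg
  simp only [Fin.sum_univ_four, Matrix.cons_val, Rat.smul_def] at hg
  have hS : s ∈ IntermediateField.adjoin ℚ {s} :=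
    IntermediateField.mem_adjoin_simple_self ℚ s
  have hmem : ∀ a c : ℚ, (a : K) + c * s ∈ IntermediateField.adjoin ℚ {s} := fun a c =>
    add_mem (SubfieldClass.ratCast_mem _ a) (mul_mem (SubfieldClass.ratCast_mem _ c) hS)
  have h0 : (g 2 : K) + g 3 * s = 0 := by
    by_contra hne
    apply hβ
    have : β = -((g 0 : K) + g 1 * s) / ((g 2 : K) + g 3 * s) := by
      rw [eq_div_iff hne]
      linear_combination hg
    rw [this]
    exact div_mem (neg_mem (hmem _ _)) (hmem _ _)
  have h1 : (g 0 : K) + g 1 * s = 0 := by linear_combination hg - β * h0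
  obtain ⟨h2, h3⟩ := hpair _ _ h0
  obtain ⟨h4, h5⟩ := hpair _ _ h1
  intro i
  fin_cases i <;> assumption

/-- Fix a squarefree integer `D > 1`. There is `c > 0` (depending only on `D`) such that for
every totally real quartic field `K` containing `√D` with discriminant `Δ` and every
`β ∈ 𝓞_K` with `β ∉ ℚ(√D)`, we have `Tr(β²) ≥ c Δ^(1/2)`. -/
theorem stmt8 (D : ℤ) (hD : Squarefree D) (hD1 : 1 < D) :
    ∃ c : ℝ, 0 < c ∧
      ∀ (K : Type) [Field K] [NumberField K],
        (∀ (σ : K →+* ℂ) (x : K), (σ x).im = 0) →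
        Module.finrank ℚ K = 4 →
        ∀ s : K, s ^ 2 = (D : K) →
        ∀ β : 𝓞 K, (β : K) ∉ IntermediateField.adjoin ℚ {s} →
          c * Real.sqrt (|NumberField.discr K| : ℝ) ≤
            ((Algebra.trace ℚ K ((β : K) ^ 2) : ℚ) : ℝ) := by
  have hD0 : (0 : ℝ) < D := by exact_mod_cast (by lia : 0 < D)
  refine ⟨1 / (24 * D), by positivity, ?_⟩
  intro K _ _ hK hdim s hs β hβ
  set T : ℝ := ((Algebra.trace ℚ K ((β : K) ^ 2) : ℚ) : ℝ) with hT
  have hσβ : ∀ σ : K →ₐ[ℚ] ℂ, ‖σ (β : K)‖ ≤ √T := fun σ =>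
    Real.le_sqrt_of_sq_le (sq_norm_embedding_le_trace_sq hK _ σ)
  have hT0 : 0 ≤ T := by
    obtain ⟨σ⟩ : Nonempty (K →ₐ[ℚ] ℂ) :=
      Fintype.card_pos_iff.1 (by rw [AlgHom.card, hdim]; norm_num)
    exact (sq_nonneg _).trans (sq_norm_embedding_le_trace_sq hK _ σ)
  have hσs : ∀ σ : K →ₐ[ℚ] ℂ, ‖σ s‖ ≤ √(D : ℝ) := fun σ => by
    refine Real.le_sqrt_of_sq_le (le_of_eq ?_)
    rw [← norm_pow, ← map_pow, hs, map_intCast, Complex.norm_intCast, abs_of_pos hD0]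
  have hsint : IsIntegral ℤ s := by
    refine IsIntegral.of_pow (n := 2) two_pos ?_
    rw [hs]
    exact isIntegral_algebraMap (x := D)
  let s' : 𝓞 K := ⟨s, hsint⟩
  have hb : (fun i => ((![1, s', β, s' * β] i : 𝓞 K) : K)) = ![1, s, (β : K), s * β] := by
    ext i
    fin_cases i
    · simp
    · rfl
    · rfl
    · exact map_mul (algebraMap (𝓞 K) K) s' β
  have hli := linearIndependent_one_sqrt_mul (Int.not_isSquare_of_squarefree hD hD1) hs hβ
  have h1 := abs_discr_le_abs_discr_of_linearIndependent (by simp [hdim])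
    ![1, s', β, s' * β] (by rw [hb]; exact hli)
  rw [hb] at h1
  have h2 := abs_discr_le_of_norm_embedding_le (by simp [hdim]) ![1, s, (β : K), s * β]
    ![1, √(D : ℝ), √T, √(D : ℝ) * √T] (by
      intro σ j
      fin_cases j
      · simp
      · exact hσs σ
      · exact hσβ σ
      · simpa using mul_le_mul (hσs σ) (hσβ σ) (norm_nonneg _) (Real.sqrt_nonneg _))
  have h3 : (|NumberField.discr K| : ℝ) ≤ (24 * D * T) ^ 2 := by
    have h4 : (|NumberField.discr K| : ℝ) ≤
        ((|Algebra.discr ℚ ![1, s, (β : K), s * β]| : ℚ) : ℝ) := by exact_mod_cast h1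
    refine (h4.trans h2).trans (le_of_eq ?_)
    have hDD := Real.mul_self_sqrt hD0.le
    have hTT := Real.mul_self_sqrt hT0
    simp only [Fin.prod_univ_four, Matrix.cons_val, Fintype.card_fin, Nat.factorial]
    congr 1
    push_cast
    linear_combination 24 * √T * √T * hDD + 24 * D * hTT
  rw [one_div_mul_eq_div, div_le_iff₀ (by positivity), mul_comm T]
  exact (Real.sqrt_le_left (by positivity)).2 h3
end

section
/- Let q = 2^n with n > 3, and let α_n = ω + 2 ∈ O_{2^n}, where ω = ζ_{2^n} + ζ_{2^n}^{-1}. Then 2α_n cannot be written as a sum of squares of elements of O_{2^n}. -/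
open NumberField

/-- `ω = ζ_q + ζ_q⁻¹ = 2 cos(2π/q)` as a real number. -/
noncomputable def omegaReal (q : ℕ) : ℝ := 2 * Real.cos (2 * Real.pi / q)

/-- `2 cos(2πk/q) = ζ_q^k + ζ_q^{-k}`. -/
noncomputable def twoCos (q : ℕ) (k : ℤ) : ℝ := 2 * Real.cos (2 * Real.pi * k / q)

/-- The family `1, ω_1, ω_2, …` with `ω_j = ζ_q^j + ζ_q^{-j}`. -/
noncomputable def cosBasis (q j : ℕ) : ℝ := if j = 0 then 1 else twoCos q j

lemma twoCos_zero (q : ℕ) : twoCos q 0 = 2 := by simp [twoCos]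

lemma twoCos_neg (q : ℕ) (k : ℤ) : twoCos q (-k) = twoCos q k := by
  rw [twoCos, twoCos, ← Real.cos_neg]
  congr 2
  push_cast
  ring

lemma twoCos_mul (q : ℕ) (i j : ℤ) :
    twoCos q i * twoCos q j = twoCos q (i + j) + twoCos q (i - j) := by
  have h := Real.two_mul_cos_mul_cos (2 * Real.pi * i / q) (2 * Real.pi * j / q)
  have h1 : 2 * Real.pi * (i + j : ℤ) / q = 2 * Real.pi * i / q + 2 * Real.pi * j / q := by
    push_cast; ring
  have h2 : 2 * Real.pi * (i - j : ℤ) / q = 2 * Real.pi * i / q - 2 * Real.pi * j / q := by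
    push_cast; ring
  rw [twoCos, twoCos, twoCos, twoCos, h1, h2]
  linear_combination 2 * h

/-- In terms of a standard primitive root of unity. -/
lemma ofReal_twoCos (q : ℕ) (k : ℤ) : ((twoCos q k : ℝ) : ℂ) =
    Complex.exp (2 * Real.pi * Complex.I / q) ^ k +
      Complex.exp (2 * Real.pi * Complex.I / q) ^ (-k) := by
  rw [← Complex.exp_int_mul, ← Complex.exp_int_mul, twoCos]
  push_cast
  rw [Complex.two_cos]
  congr 2 <;> ring

lemma exp_pow_half {d : ℕ} (hd : d ≠ 0) :
    Complex.exp (2 * Real.pi * Complex.I / (4 * d : ℕ)) ^ (2 * d) = -1 := by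
  rw [← Complex.exp_nat_mul, ← Complex.exp_pi_mul_I]
  congr 1
  have : (d : ℂ) ≠ 0 := by exact_mod_cast hd
  push_cast
  field_simp
  ring

lemma linearIndependent_exp_pow {n d : ℕ} (hd : 2 ^ n = 4 * d) (hd0 : d ≠ 0) :
    LinearIndependent ℚ (fun i : Fin (2 * d) =>
      Complex.exp (2 * Real.pi * Complex.I / (4 * d : ℕ)) ^ (i : ℕ)) := by
  have hζ := Complex.isPrimitiveRoot_exp (4 * d) (by omega)
  have h := linearIndependent_pow (K := ℚ) (Complex.exp (2 * Real.pi * Complex.I / (4 * d : ℕ)))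
  have hdeg : (minpoly ℚ (Complex.exp (2 * Real.pi * Complex.I / (4 * d : ℕ)))).natDegree
      = 2 * d := by
    rw [← Polynomial.cyclotomic_eq_minpoly_rat hζ (by omega), Polynomial.natDegree_cyclotomic,
      ← hd]
    obtain ⟨m, rfl⟩ : ∃ m, n = m + 1 := ⟨n - 1, by
      rcases n with _ | n
      · simp at hd; omega
      · rfl⟩
    rw [Nat.totient_prime_pow_succ Nat.prime_two]
    rw [pow_succ] at hd
    omega
  rw [hdeg] at h
  exact h

/-- The normalised trace, as a linear functional on `ℝ`. -/
lemma exists_functional {n d : ℕ} (hd : 2 ^ n = 4 * d) (hd0 : d ≠ 0) :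
    ∃ T : ℝ →ₗ[ℚ] ℚ, T 1 = 1 ∧
      ∀ k : ℤ, |k| < 2 * d → T (twoCos (4 * d) k) = if k = 0 then 2 else 0 := by
  have hli := linearIndependent_exp_pow hd hd0
  set ζ := Complex.exp (2 * Real.pi * Complex.I / (4 * d : ℕ)) with hζ
  have hhalf : ζ ^ (2 * d) = -1 := exp_pow_half hd0
  let b := Module.Basis.extend hli.linearIndepOn_id
  let g : ℂ →ₗ[ℚ] ℚ := b.constr ℚ (fun v => if (v : ℂ) = 1 then 1 else 0)
  have hg : ∀ i < 2 * d, g (ζ ^ i) = if i = 0 then 1 else 0 := by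
    intro i hi
    have hmem : ζ ^ i ∈ hli.linearIndepOn_id.extend (Set.subset_univ _) :=
      hli.linearIndepOn_id.subset_extend _ ⟨⟨i, hi⟩, rfl⟩
    have h1 : b ⟨ζ ^ i, hmem⟩ = ζ ^ i := by simp [b]
    rw [← h1, Module.Basis.constr_basis]
    have : ζ ^ i = 1 ↔ i = 0 := by
      constructor
      · intro h
        have := hli.injective (a₁ := ⟨i, hi⟩) (a₂ := ⟨0, by omega⟩) (by simpa using h)
        simpa using this
      · rintro rfl; simp
    simp [this]
  let T : ℝ →ₗ[ℚ] ℚ := g ∘ₗ (Complex.ofRealAm.toLinearMap.restrictScalars ℚ)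
  have hT : ∀ x : ℝ, T x = g x := fun x => rfl
  have key : ∀ k : ℕ, 0 < k → k < 2 * d → T (twoCos (4 * d) k) = 0 := by
    intro k hk hk2
    have h2 : ζ ^ (-(k : ℤ)) = -ζ ^ (2 * d - k) := by
      rw [zpow_neg, zpow_natCast]
      refine inv_eq_of_mul_eq_one_right ?_
      rw [mul_neg, ← pow_add, Nat.add_sub_cancel' hk2.le, hhalf, neg_neg]
    rw [hT, ofReal_twoCos, ← hζ, h2, zpow_natCast, map_add, map_neg, hg k hk2,
      hg (2 * d - k) (by omega), if_neg (by omega), if_neg (by omega)]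
    simp
  have h1 : T 1 = 1 := by
    rw [hT]
    simpa using hg 0 (by omega)
  refine ⟨T, h1, fun k hk => ?_⟩
  split_ifs with h0
  · rw [h0, twoCos_zero, show (2 : ℝ) = 1 + 1 by norm_num, map_add, h1]
    norm_num
  · rw [Int.abs_eq_natAbs] at hk
    rcases Int.natAbs_eq k with h | h
    · rw [h]; exact key _ (by omega) (by omega)
    · rw [h, twoCos_neg]; exact key _ (by omega) (by omega)

/-- Integers of the maximal real subfield are integral combinations of the `ω_j`. -/
lemma exists_coeff {n d : ℕ} (hd : 2 ^ n = 4 * d) (hd0 : d ≠ 0) (x : ℝ)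
    (hx : x ∈ Kq (4 * d)) (hint : IsIntegral ℤ x) :
    ∃ a : ℕ → ℤ, (∀ j, d ≤ j → a j = 0) ∧
      x = ∑ j ∈ Finset.range d, (a j : ℝ) * cosBasis (4 * d) j := by
  have hli := linearIndependent_exp_pow hd hd0
  have hhalf := exp_pow_half hd0
  have hprim := Complex.isPrimitiveRoot_exp (4 * d) (by omega)
  have htc := ofReal_twoCos (4 * d)
  set ζ := Complex.exp (2 * Real.pi * Complex.I / (4 * d : ℕ)) with hζ
  have hζ0 : ζ ≠ 0 := Complex.exp_ne_zero _
  have hζi : IsIntegral ℤ ζ := hprim.isIntegral (by omega)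
  -- `x` lies in `ℚ(ζ)`
  have hmem : (x : ℂ) ∈ IntermediateField.adjoin ℚ {ζ} := by
    have hle : Kq (4 * d) ≤ (IntermediateField.adjoin ℚ {ζ}).comap
        (Complex.ofRealAm.restrictScalars ℚ) := by
      rw [Kq, IntermediateField.adjoin_le_iff, Set.singleton_subset_iff]
      change ((2 * Real.cos (2 * Real.pi / (4 * d : ℕ)) : ℝ) : ℂ) ∈ IntermediateField.adjoin ℚ {ζ}
      have h1 := htc 1
      rw [twoCos, Int.cast_one, mul_one] at h1
      rw [h1]
      have hg := IntermediateField.mem_adjoin_simple_self ℚ ζ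
      exact add_mem (zpow_mem hg _) (zpow_mem hg _)
    exact hle hx
  -- so it is an integral combination of powers of `ζ`
  obtain ⟨c, hc⟩ : ∃ c : ℕ → ℤ, (x : ℂ) = ∑ j ∈ Finset.range (2 * d), (c j : ℂ) * ζ ^ j := by
    have hcyc : IsCyclotomicExtension {2 ^ n} ℚ (IntermediateField.adjoin ℚ {ζ}) := by
      change IsCyclotomicExtension {2 ^ n} ℚ (IntermediateField.adjoin ℚ {ζ}).toSubalgebra
      rw [IntermediateField.adjoin_simple_toSubalgebra_of_isAlgebraic
        (hζi.tower_top (A := ℚ)).isAlgebraic]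
      have : NeZero (4 * d) := ⟨by omega⟩
      rw [hd]
      exact hprim.adjoin_isCyclotomicExtension ℚ
    let z : IntermediateField.adjoin ℚ {ζ} := IntermediateField.AdjoinSimple.gen ℚ ζ
    have hz : (z : ℂ) = ζ := rfl
    have hzp : IsPrimitiveRoot z (2 ^ n) := by
      rw [hd]
      exact IsPrimitiveRoot.of_map_of_injective
        (f := algebraMap (IntermediateField.adjoin ℚ {ζ}) ℂ) hprim
        (algebraMap (IntermediateField.adjoin ℚ {ζ}) ℂ).injective
    have : Fact (Nat.Prime 2) := ⟨Nat.prime_two⟩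
    have hcl := IsCyclotomicExtension.Rat.isIntegralClosure_adjoin_singleton_of_prime_pow hzp
    have hxi : IsIntegral ℤ (⟨x, hmem⟩ : IntermediateField.adjoin ℚ {ζ}) := by
      rw [← isIntegral_algebraMap_iff (B := ℂ)
        (algebraMap (IntermediateField.adjoin ℚ {ζ}) ℂ).injective]
      exact hint.map (Complex.ofRealAm.restrictScalars ℤ)
    obtain ⟨⟨y, hy⟩, hyx⟩ := hcl.isIntegral_iff.1 hxi
    rw [Algebra.adjoin_singleton_eq_range_aeval] at hy
    obtain ⟨P, rfl⟩ := hy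
    have hPx : (x : ℂ) = Polynomial.aeval ζ P := by
      have := congrArg (algebraMap (IntermediateField.adjoin ℚ {ζ}) ℂ) hyx
      change ((Polynomial.aeval z P : IntermediateField.adjoin ℚ {ζ}) : ℂ) = x at this
      rw [← this]
      exact (Polynomial.aeval_algebraMap_apply ℂ z P).symm
    let Q : Polynomial ℤ := Polynomial.X ^ (2 * d) + 1
    have hQm : Q.Monic := Polynomial.monic_X_pow_add_C 1 (by omega)
    have hQd : Q.natDegree = 2 * d := Polynomial.natDegree_X_pow_add_C (r := 1)
    have hQ0 : Polynomial.aeval ζ Q = 0 := by simp [Q, hhalf]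
    have hlt : (P %ₘ Q).natDegree < 2 * d := by
      rw [← hQd]
      exact Polynomial.natDegree_modByMonic_lt P hQm (fun h => by simp [h] at hQd; omega)
    refine ⟨(P %ₘ Q).coeff, ?_⟩
    rw [hPx]
    conv_lhs => rw [← Polynomial.modByMonic_add_div P Q]
    rw [map_add, map_mul, hQ0, zero_mul, add_zero, Polynomial.aeval_eq_sum_range' hlt]
    simp
  -- reality gives the antisymmetry of the coefficients
  have hneg : ∀ k, k ≤ 2 * d → ζ ^ (-(k : ℤ)) = -ζ ^ (2 * d - k) := by
    intro k hk2
    rw [zpow_neg, zpow_natCast]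
    refine inv_eq_of_mul_eq_one_right ?_
    rw [mul_neg, ← pow_add, Nat.add_sub_cancel' hk2, hhalf, neg_neg]
  have hconj : (starRingEnd ℂ) ζ = ζ ^ (-1 : ℤ) := by
    rw [zpow_neg_one, ← Complex.inv_eq_conj]
    exact hprim.norm'_eq_one (by omega)
  obtain ⟨m, hm⟩ : ∃ m, 2 * d = m + 1 := ⟨2 * d - 1, by omega⟩
  have hc' : (x : ℂ) = c 0 - ∑ j ∈ Finset.range m, (c (m - j) : ℂ) * ζ ^ (j + 1) := by
    have h1 := congrArg (starRingEnd ℂ) hc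
    rw [Complex.conj_ofReal, map_sum, hm, Finset.sum_range_succ'] at h1
    rw [h1, ← Finset.sum_range_reflect, sub_eq_add_neg, add_comm, ← Finset.sum_neg_distrib]
    congr 1
    · simp
    · refine Finset.sum_congr rfl fun j hj => ?_
      have hj := Finset.mem_range.1 hj
      have h3 := hneg (m - 1 - j + 1) (by omega)
      rw [map_mul, map_pow, hconj, ← zpow_natCast, ← zpow_mul, neg_one_mul, h3,
        show 2 * d - (m - 1 - j + 1) = j + 1 by omega, show m - 1 - j + 1 = m - j by omega]
      simp
  have hanti : ∀ j < m, c (j + 1) = - c (m - j) := by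
    have h0 : ∑ j ∈ Finset.range (2 * d),
        (if j = 0 then (0 : ℚ) else c j + c (2 * d - j)) • ζ ^ j = 0 := by
      rw [hm, Finset.sum_range_succ'] at hc ⊢
      have := hc.symm.trans hc'
      simp only [pow_zero, mul_one] at this
      have h4 : ∑ j ∈ Finset.range m, (c (j + 1) : ℂ) * ζ ^ (j + 1)
        + ∑ j ∈ Finset.range m, (c (m - j) : ℂ) * ζ ^ (j + 1) = 0 := by
        linear_combination this
      rw [← h4, ← Finset.sum_add_distrib]
      simp only [if_true, zero_smul, add_zero]
      refine Finset.sum_congr rfl fun j hj => ?_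
      rw [if_neg (by omega), Nat.add_sub_add_right, Algebra.smul_def]
      simp
      ring
    intro j hj
    rw [Finset.sum_range] at h0
    have h5 := Fintype.linearIndependent_iff.1 hli
      (fun i => if (i : ℕ) = 0 then (0 : ℚ) else c i + c (2 * d - i)) h0 ⟨j + 1, by omega⟩
    simp only [Nat.add_eq_zero_iff, one_ne_zero, and_false, if_false] at h5
    rw [hm, Nat.add_sub_add_right] at h5
    have h6 : c (j + 1) + c (m - j) = 0 := by exact_mod_cast h5
    omega
  refine ⟨fun j => if j < d then c j else 0, fun j hj => if_neg (by omega), ?_⟩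
  obtain ⟨e, rfl⟩ : ∃ e, d = e + 1 := ⟨d - 1, by omega⟩
  have hmid : c (e + 1) = 0 := by
    have := hanti e (by omega)
    rw [show m - e = e + 1 by omega] at this
    omega
  have hupper : ∑ j ∈ Finset.range (e + 1), (c (e + 1 + j) : ℂ) * ζ ^ (e + 1 + j) =
      ∑ j ∈ Finset.range e, (c (j + 1) : ℂ) * ζ ^ (-((j + 1 : ℕ) : ℤ)) := by
    rw [← Finset.sum_range_reflect, Finset.sum_range_succ, show e + 1 + (e + 1 - 1 - e) = e + 1 by
      omega, hmid, Int.cast_zero, zero_mul, add_zero]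
    refine Finset.sum_congr rfl fun j hj => ?_
    have hj := Finset.mem_range.1 hj
    rw [hneg (j + 1) (by omega), hanti j (by omega), show e + 1 + (e + 1 - 1 - j) = m - j by omega,
      show 2 * (e + 1) - (j + 1) = m - j by omega]
    push_cast
    ring
  have hfin : (x : ℂ) = ((∑ j ∈ Finset.range (e + 1),
      ((if j < e + 1 then c j else 0 : ℤ) : ℝ) * cosBasis (4 * (e + 1)) j : ℝ) : ℂ) := by
    rw [hc, two_mul, Finset.sum_range_add, hupper, Finset.sum_range_succ', Finset.sum_range_succ']
    push_cast
    rw [add_right_comm, ← Finset.sum_add_distrib]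
    congr 1
    · refine Finset.sum_congr rfl fun j hj => ?_
      have hj := Finset.mem_range.1 hj
      rw [if_pos (by omega), cosBasis, if_neg (by omega), htc, zpow_natCast, mul_add]
      push_cast
      rfl
  exact_mod_cast hfin

section Functional

variable {d : ℕ} {T : ℝ →ₗ[ℚ] ℚ}

lemma functional_mul_sq (T : ℝ →ₗ[ℚ] ℚ) (y : ℝ) (a : ℕ → ℤ) (b : ℕ → ℝ) (d : ℕ) :
    T (y * (∑ j ∈ Finset.range d, (a j : ℝ) * b j) ^ 2) =
      ∑ i ∈ Finset.range d, ∑ j ∈ Finset.range d, ((a i * a j : ℤ) : ℚ) * T (y * (b i * b j)) := by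
  rw [sq, Finset.sum_mul_sum, Finset.mul_sum, map_sum]
  refine Finset.sum_congr rfl fun i _ => ?_
  rw [Finset.mul_sum, map_sum]
  refine Finset.sum_congr rfl fun j _ => ?_
  rw [← smul_eq_mul (a := ((a i * a j : ℤ) : ℚ)), ← map_smul]
  congr 1
  rw [Algebra.smul_def]
  simp
  ring

lemma functional_basis_mul (hT1 : T 1 = 1)
    (hT : ∀ k : ℤ, |k| < 2 * d → T (twoCos (4 * d) k) = if k = 0 then 2 else 0)
    {i j : ℕ} (hi : i < d) (hj : j < d) :
    T (1 * (cosBasis (4 * d) i * cosBasis (4 * d) j)) =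
      if i = j then (if i = 0 then 1 else 2) else 0 := by
  rw [one_mul]
  unfold cosBasis
  rcases Nat.eq_zero_or_pos i with rfl | hi0 <;> rcases Nat.eq_zero_or_pos j with rfl | hj0
  · simpa using hT1
  · rw [if_pos rfl, one_mul, if_neg (by omega), hT _ (by rw [abs_lt]; omega)]
    simp only [hj0.ne', hj0.ne, Nat.cast_eq_zero, if_false]
  · rw [if_pos rfl, mul_one, if_neg (by omega), hT _ (by rw [abs_lt]; omega)]
    simp only [hi0.ne', Nat.cast_eq_zero, if_false]
  · rw [if_neg (by omega), if_neg (by omega), twoCos_mul, map_add,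
      hT _ (by rw [abs_lt]; omega), hT _ (by rw [abs_lt]; omega), if_neg (by omega), zero_add,
      if_neg (show ¬ i = 0 by omega)]
    simp only [sub_eq_zero, Nat.cast_inj]

lemma functional_shift_basis_mul
    (hT : ∀ k : ℤ, |k| < 2 * d → T (twoCos (4 * d) k) = if k = 0 then 2 else 0)
    {i j : ℕ} (hi : i < d) (hj : j < d) :
    T (twoCos (4 * d) 1 * (cosBasis (4 * d) i * cosBasis (4 * d) j)) =
      (if i + 1 = j then 2 else 0) + (if j + 1 = i then 2 else 0) := by
  unfold cosBasis
  rcases Nat.eq_zero_or_pos i with rfl | hi0 <;> rcases Nat.eq_zero_or_pos j with rfl | hj0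
  · simp only [if_true, mul_one]
    rw [hT _ (by rw [abs_lt]; omega)]
    simp
  · rw [if_pos rfl, one_mul, if_neg (by omega), twoCos_mul, map_add,
      hT _ (by rw [abs_lt]; omega), hT _ (by rw [abs_lt]; omega)]
    split_ifs <;> first | contradiction | omega | norm_num
  · rw [if_pos rfl, mul_one, if_neg (by omega), twoCos_mul, map_add,
      hT _ (by rw [abs_lt]; omega), hT _ (by rw [abs_lt]; omega)]
    split_ifs <;> first | contradiction | omega | norm_num
  · rw [if_neg (by omega), if_neg (by omega), twoCos_mul, mul_add, twoCos_mul, twoCos_mul,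
      map_add, map_add, map_add,
      hT _ (by rw [abs_lt]; omega), hT _ (by rw [abs_lt]; omega), hT _ (by rw [abs_lt]; omega),
      hT _ (by rw [abs_lt]; omega)]
    split_ifs <;> first | contradiction | omega | norm_num

lemma functional_sq (hT1 : T 1 = 1)
    (hT : ∀ k : ℤ, |k| < 2 * d → T (twoCos (4 * d) k) = if k = 0 then 2 else 0) (a : ℕ → ℤ) :
    T ((∑ j ∈ Finset.range d, (a j : ℝ) * cosBasis (4 * d) j) ^ 2) =
      ((∑ j ∈ Finset.range d, (if j = 0 then 1 else 2) * a j ^ 2 : ℤ) : ℚ) := by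
  rw [← one_mul (_ ^ 2), functional_mul_sq]
  push_cast
  refine Finset.sum_congr rfl fun i hi => ?_
  rw [Finset.sum_eq_single i]
  · rw [functional_basis_mul hT1 hT (Finset.mem_range.1 hi) (Finset.mem_range.1 hi), if_pos rfl]
    ring
  · intro j hj hji
    rw [functional_basis_mul hT1 hT (Finset.mem_range.1 hi) (Finset.mem_range.1 hj),
      if_neg hji.symm, mul_zero]
  · exact fun h => absurd hi h

lemma functional_shift_sq
    (hT : ∀ k : ℤ, |k| < 2 * d → T (twoCos (4 * d) k) = if k = 0 then 2 else 0) (a : ℕ → ℤ)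
    (ha : ∀ j, d ≤ j → a j = 0) :
    T (twoCos (4 * d) 1 * (∑ j ∈ Finset.range d, (a j : ℝ) * cosBasis (4 * d) j) ^ 2) =
      ((4 * ∑ j ∈ Finset.range d, a j * a (j + 1) : ℤ) : ℚ) := by
  rw [functional_mul_sq]
  have hshift : ∀ i ∈ Finset.range d, ∑ j ∈ Finset.range d,
      ((a i * a j : ℤ) : ℚ) * (if i + 1 = j then 2 else 0) = 2 * (a i * a (i + 1) : ℤ) := by
    intro i _
    simp only [mul_ite, mul_zero, Finset.sum_ite_eq, Finset.mem_range]
    split_ifs with h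
    · ring
    · rw [ha (i + 1) (by omega)]; simp
  have hexp : ∀ i ∈ Finset.range d, ∑ j ∈ Finset.range d, ((a i * a j : ℤ) : ℚ) *
        T (twoCos (4 * d) 1 * (cosBasis (4 * d) i * cosBasis (4 * d) j)) =
      ∑ j ∈ Finset.range d, ((a i * a j : ℤ) : ℚ) * (if i + 1 = j then 2 else 0) +
      ∑ j ∈ Finset.range d, ((a j * a i : ℤ) : ℚ) * (if j + 1 = i then 2 else 0) := by
    intro i hi
    rw [← Finset.sum_add_distrib]
    refine Finset.sum_congr rfl fun j hj => ?_
    rw [functional_shift_basis_mul hT (Finset.mem_range.1 hi) (Finset.mem_range.1 hj),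
      mul_comm (a j) (a i), mul_add]
  rw [Finset.sum_congr rfl hexp, Finset.sum_add_distrib, Finset.sum_comm (s := Finset.range d)
    (f := fun i j => ((a j * a i : ℤ) : ℚ) * (if j + 1 = i then 2 else 0)),
    Finset.sum_congr rfl hshift, ← Finset.mul_sum]
  push_cast
  ring

end Functional

/-- Integer vectors of total weighted length `4` whose neighbouring products sum to `1`. -/
lemma coeff_classification {k d : ℕ} (a : Fin k → ℕ → ℤ) (ha : ∀ i j, d ≤ j → a i j = 0)
    (hsq : ∑ i, ∑ j ∈ Finset.range d, (if j = 0 then 1 else 2) * a i j ^ 2 = 4)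
    (hadj : ∑ i, ∑ j ∈ Finset.range d, a i j * a i (j + 1) = 1) :
    ∃ i j, j + 1 < d ∧ a i j * a i (j + 1) = 1 ∧ (∀ l, l ≠ j → l ≠ j + 1 → a i l = 0) ∧
      (j = 0 ∨ ∀ i', i' ≠ i → ∀ l, a i' l = 0) := by
  rw [← Finset.sum_product'] at hsq hadj
  obtain ⟨⟨i, j⟩, hmem, hne⟩ := Finset.exists_ne_zero_of_sum_ne_zero (hadj.trans_ne one_ne_zero)
  have h0 := left_ne_zero_of_mul hne
  have h1 := right_ne_zero_of_mul hne
  simp only at h0 h1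
  have hjd : j + 1 < d := by
    by_contra h
    exact h1 (ha i _ (by omega))
  have hp0 : 1 ≤ a i j ^ 2 := by have := sq_pos_of_ne_zero h0; omega
  have hp1 : 1 ≤ a i (j + 1) ^ 2 := by have := sq_pos_of_ne_zero h1; omega
  have hbudget : ∀ i' l, l < d → (i', l) ≠ (i, j) → (i', l) ≠ (i, j + 1) →
      (if j = 0 then 1 else 2) + 2 + (if l = 0 then 1 else 2) * a i' l ^ 2 ≤ 4 := by
    intro i' l hl hne1 hne2
    have hsub : ({(i, j), (i, j + 1), (i', l)} : Finset (Fin k × ℕ)) ⊆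
        Finset.univ ×ˢ Finset.range d := by
      intro p hp
      simp only [Finset.mem_insert, Finset.mem_singleton] at hp
      rcases hp with rfl | rfl | rfl <;> simp <;> omega
    have hle := Finset.sum_le_sum_of_subset_of_nonneg
      (f := fun p : Fin k × ℕ => (if p.2 = 0 then 1 else 2) * a p.1 p.2 ^ 2) hsub
      (fun p _ _ => by split_ifs <;> positivity)
    rw [hsq, Finset.sum_insert (by simp [hne1.symm]), Finset.sum_insert (by simp [hne2.symm]),
      Finset.sum_singleton] at hle
    simp only [Nat.add_eq_zero_iff, one_ne_zero, and_false, if_false] at hle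
    refine le_trans ?_ hle
    split_ifs <;> linarith
  have hzero : ∀ i' l, (i', l) ≠ (i, j) → (i', l) ≠ (i, j + 1) → (l ≠ 0 ∨ j ≠ 0) →
      a i' l = 0 := by
    intro i' l hne1 hne2 hor
    by_contra hnz
    have hld : l < d := by
      by_contra h
      exact hnz (ha i' l (by omega))
    have hb := hbudget i' l hld hne1 hne2
    have := sq_pos_of_ne_zero hnz
    split_ifs at hb <;> omega
  refine ⟨i, j, hjd, ?_, fun l hl hl' => hzero i l (by simpa) (by simpa) (by omega), ?_⟩
  · rw [Finset.sum_eq_single (i, j)] at hadj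
    · exact hadj
    · rintro ⟨i', l⟩ _ hne1
      by_cases hii : i' = i
      · subst hii
        have hlj : l ≠ j := by simpa using hne1
        by_cases hl : l + 1 = j
        · rw [hzero i' l (by simpa) (by simp; omega) (by omega), zero_mul]
        · rw [hzero i' (l + 1) (by simpa) (by simpa) (by omega), mul_zero]
      · rw [hzero i' (l + 1) (by simp [hii]) (by simp [hii]) (by omega), mul_zero]
    · exact fun h => absurd hmem h
  · by_cases hj : j = 0
    · exact Or.inl hj
    · exact Or.inr fun i' hi l => hzero i' l (by simp [hi]) (by simp [hi]) (Or.inr hj)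

lemma three_lt_twoCos_one_sq {q : ℕ} (hq : 16 ≤ q) : 3 < twoCos q 1 ^ 2 := by
  have hpi := Real.pi_pos
  have hq' : (16 : ℝ) ≤ q := by exact_mod_cast hq
  have hlt : Real.cos (Real.pi / 6) < Real.cos (2 * Real.pi * (1 : ℤ) / q) := by
    apply Real.cos_lt_cos_of_nonneg_of_le_pi
    · positivity
    · linarith
    · rw [Int.cast_one, mul_one, div_lt_div_iff₀ (by linarith) (by norm_num)]
      nlinarith
  rw [Real.cos_pi_div_six] at hlt
  have h3 : (√3) ^ 2 = 3 := Real.sq_sqrt (by norm_num)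
  have h0 : 0 ≤ √3 := Real.sqrt_nonneg 3
  rw [twoCos]
  nlinarith

/-- If `8 ∣ q`, then `4 + 2ω` is not the square of `ω_j + ω_{j+1}`. -/
lemma twoCos_add_twoCos_sq_ne {d j : ℕ} (hd : 2 ∣ d) (hj : j + 1 < d) :
    (twoCos (4 * d) j + twoCos (4 * d) (j + 1)) ^ 2 ≠ 4 + 2 * twoCos (4 * d) 1 := by
  intro h
  have hpi := Real.pi_pos
  have hd0 : (0 : ℝ) < d := by exact_mod_cast (by omega : 0 < d)
  set t := Real.pi / (4 * d) with ht
  have htd : t * (4 * d) = Real.pi := by rw [ht]; field_simp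
  have ht0 : 0 < t := by positivity
  have e0 : twoCos (4 * d) j = 2 * Real.cos ((2 * j + 1) * t - t) := by
    rw [twoCos, ht]; congr 2; push_cast; ring
  have e1 : twoCos (4 * d) (j + 1) = 2 * Real.cos ((2 * j + 1) * t + t) := by
    rw [twoCos, ht]; congr 2; push_cast; ring
  have e2 : twoCos (4 * d) 1 = 2 * Real.cos (2 * t) := by
    rw [twoCos, ht]; congr 2; push_cast; ring
  rw [e0, e1, e2, Real.cos_sub, Real.cos_add, Real.cos_two_mul] at h
  have hct : 0 < Real.cos t := by
    apply Real.cos_pos_of_mem_Ioo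
    have hd1 : (2 : ℝ) ≤ d := by exact_mod_cast (by omega : 2 ≤ d)
    constructor <;> nlinarith
  have hhalf : Real.cos (2 * ((2 * j + 1) * t)) = 0 := by
    rw [Real.cos_two_mul]
    have : Real.cos t ^ 2 * (2 * Real.cos ((2 * j + 1) * t) ^ 2 - 1) = 0 := by
      linear_combination h / 8
    exact (mul_eq_zero.1 this).resolve_left (by positivity)
  obtain ⟨m, hm⟩ := Real.cos_eq_zero_iff.1 hhalf
  have h2 : (4 * (2 * j + 1) : ℝ) = (2 * m + 1) * (4 * d) := by
    rw [← htd] at hm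
    have := mul_right_cancel₀ ht0.ne' (show 4 * (2 * j + 1) * t = (2 * m + 1) * (4 * d) * t by
      linear_combination 2 * hm)
    exact this
  have h3 : (4 * (2 * j + 1) : ℤ) = (2 * m + 1) * (4 * d) := by exact_mod_cast h2
  obtain ⟨e, rfl⟩ := hd
  push_cast at h3
  have h4 : (2 * j + 1 : ℤ) = 2 * ((2 * m + 1) * e) := by linarith
  omega

/-- For `q = 2^n` with `n > 3` and `α_n = ω + 2 ∈ 𝓞_{K_{2^n}}`, the element `2α_n` is not a
sum of squares in `𝓞_{K_{2^n}}`. -/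
theorem stmt10 (n : ℕ) (hn : 3 < n) (α : 𝓞 ↥(Kq (2 ^ n)))
    (hα : ((α : ↥(Kq (2 ^ n))) : ℝ) = omegaReal (2 ^ n) + 2) :
    ¬ IsSumOfSquares (2 * α) := by
  rintro ⟨k, x, hx⟩
  obtain ⟨d, hd, hd4⟩ : ∃ d, 2 ^ n = 4 * d ∧ 4 ∣ d := by
    obtain ⟨m, rfl⟩ := Nat.exists_eq_add_of_lt hn
    exact ⟨2 ^ (m + 2), by ring, ⟨2 ^ m, by ring⟩⟩
  have hd0 : d ≠ 0 := by rintro rfl; simp at hd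
  have hsum : 4 + 2 * twoCos (4 * d) 1 = ∑ i, ((x i : Kq (2 ^ n)) : ℝ) ^ 2 := by
    have h := congrArg (fun z : 𝓞 ↥(Kq (2 ^ n)) => ((z : Kq (2 ^ n)) : ℝ)) hx
    have hω : omegaReal (2 ^ n) = twoCos (4 * d) 1 := by rw [hd]; simp [omegaReal, twoCos]
    simp only [map_mul, map_sum, map_pow] at h
    push_cast at h
    rw [hα, hω] at h
    rw [← h]
    have h2 : (((algebraMap (𝓞 (Kq (2 ^ n))) (Kq (2 ^ n))) 2 : Kq (2 ^ n)) : ℝ) = 2 := by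
      rw [map_ofNat]; rfl
    rw [h2]
    ring
  have hcoeff : ∀ i, ∃ a : ℕ → ℤ, (∀ j, d ≤ j → a j = 0) ∧ ((x i : Kq (2 ^ n)) : ℝ) =
      ∑ j ∈ Finset.range d, (a j : ℝ) * cosBasis (4 * d) j := fun i => by
    apply exists_coeff hd hd0
    · rw [← hd]; exact SetLike.coe_mem _
    · exact map_isIntegral_int (algebraMap (Kq (2 ^ n)) ℝ) (RingOfIntegers.isIntegral_coe (x i))
  choose a ha hxa using hcoeff
  obtain ⟨T, hT1, hT⟩ := exists_functional hd hd0
  have hT2 : ∀ (m : ℤ) (y : ℝ), T (m * y) = m * T y := fun m y => by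
    rw [← zsmul_eq_mul, map_zsmul, zsmul_eq_mul]
  simp only [hxa] at hsum
  have hd4' : 4 ≤ d := Nat.le_of_dvd (by omega) hd4
  have hTω : T (twoCos (4 * d) 1) = 0 := by
    rw [hT 1 (by rw [abs_lt]; omega), if_neg one_ne_zero]
  have hTω2 : T (twoCos (4 * d) 2) = 0 := by
    rw [hT 2 (by rw [abs_lt]; omega), if_neg two_ne_zero]
  have hsq : ∑ i, ∑ j ∈ Finset.range d, (if j = 0 then 1 else 2) * a i j ^ 2 = 4 := by
    have h := congrArg T hsum
    rw [map_sum, Finset.sum_congr rfl fun i _ => functional_sq hT1 hT (a i), map_add,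
      show (4 : ℝ) = (4 : ℤ) * 1 by norm_num, hT2, hT1,
      show (2 : ℝ) = (2 : ℤ) by norm_num, hT2, hTω] at h
    have h' : ((∑ i, ∑ j ∈ Finset.range d, (if j = 0 then 1 else 2) * a i j ^ 2 : ℤ) : ℚ)
        = (4 : ℤ) := by
      rw [Int.cast_sum, ← h]; norm_num
    exact_mod_cast h'
  have hadj : ∑ i, ∑ j ∈ Finset.range d, a i j * a i (j + 1) = 1 := by
    have h := congrArg (fun z => T (twoCos (4 * d) 1 * z)) hsum
    have hω2 : twoCos (4 * d) 1 * (4 + 2 * twoCos (4 * d) 1) =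
        (4 : ℤ) * twoCos (4 * d) 1 + (2 : ℤ) * twoCos (4 * d) 2 + (4 : ℤ) * 1 := by
      have := twoCos_mul (4 * d) 1 1
      rw [show (1 + 1 : ℤ) = 2 by norm_num, sub_self, twoCos_zero] at this
      push_cast
      linear_combination 2 * this
    rw [Finset.mul_sum, map_sum,
      Finset.sum_congr rfl fun i _ => functional_shift_sq hT (a i) (ha i), hω2, map_add, map_add,
      hT2, hT2, hT2, hTω, hTω2, hT1, ← Int.cast_sum, ← Finset.mul_sum] at h
    have h' : ((4 * ∑ i, ∑ j ∈ Finset.range d, a i j * a i (j + 1) : ℤ) : ℚ) = (4 : ℤ) := by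
      rw [← h]; norm_num
    have := Int.cast_injective h'
    omega
  obtain ⟨i, j, hj, hprod, hrest, hcase⟩ := coeff_classification a ha hsq hadj
  have hxi : ∑ l ∈ Finset.range d, (a i l : ℝ) * cosBasis (4 * d) l =
      a i j * cosBasis (4 * d) j + a i (j + 1) * twoCos (4 * d) (j + 1) := by
    rw [Finset.sum_eq_add j (j + 1) (by omega)]
    · simp [cosBasis]
    · rintro l _ ⟨hl, hl'⟩
      rw [hrest l hl hl', Int.cast_zero, zero_mul]
    · exact fun h => absurd (Finset.mem_range.2 (by omega)) h
    · exact fun h => absurd (Finset.mem_range.2 hj) h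
  have hunit : a i j = a i (j + 1) ∧ a i j ^ 2 = 1 := by
    rcases Int.eq_one_or_neg_one_of_mul_eq_one' hprod with ⟨h, h'⟩ | ⟨h, h'⟩ <;> simp [h, h']
  have hunit' : (a i j : ℝ) ^ 2 = 1 := by exact_mod_cast hunit.2
  rw [← hunit.1, ← mul_add] at hxi
  by_cases hj0 : j = 0
  · subst hj0
    have hle := Finset.single_le_sum (f := fun i =>
      (∑ l ∈ Finset.range d, (a i l : ℝ) * cosBasis (4 * d) l) ^ 2)
      (fun i _ => sq_nonneg _) (Finset.mem_univ i)
    rw [← hsum, hxi, mul_pow, hunit', one_mul, cosBasis, if_pos rfl, Nat.cast_zero, zero_add]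
      at hle
    have := three_lt_twoCos_one_sq (q := 4 * d) (by omega)
    nlinarith
  · have hother := hcase.resolve_left hj0
    rw [Finset.sum_eq_single i (fun i' _ hi' => by simp [hother i' hi'])
      (fun h => absurd (Finset.mem_univ i) h), hxi, mul_pow, hunit', one_mul, cosBasis,
      if_neg hj0] at hsum
    exact twoCos_add_twoCos_sq_ne (dvd_trans (by norm_num) hd4) hj hsum.symm
end

section
/- Let q = 2^n with n > 3, let d = 2^{n−2}, and let γ_n = ω + ω_{d−1} + 3 ∈ O_{2^n}, where ω = ζ_{2^n} + ζ_{2^n}^{-1} and ω_j = ζ_{2^n}^j + ζ_{2^n}^{-j}. Then: (i) γ_n is totally positive; (ii) Tr_{K_{2^n}/ℚ}(γ_n) = 3d; (iii) Nr_{K_{2^n}/ℚ}(γ_n) = 2^d + 1. -/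
open NumberField

/-- `ω_j = ζ_q^j + ζ_q^{-j} = 2 cos(2πj/q)` as a real number. -/
noncomputable def omegaJReal (q : ℕ) (j : ℕ) : ℝ := 2 * Real.cos (2 * Real.pi * j / q)

namespace Polynomial.Chebyshev

theorem C_two_mul_eq_sq_sub_two (R : Type*) [CommRing R] (k : ℤ) :
    C R (2 * k) = C R k ^ 2 - 2 := by
  have h := C_mul_C R k k
  rw [sub_self, C_zero, ← two_mul] at h
  rw [sq, h, add_sub_cancel_right]

theorem C_two_pow_succ (R : Type*) [CommRing R] (m : ℕ) :
    C R (2 ^ (m + 1)) = C R (2 ^ m) ^ 2 - 2 := by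
  rw [pow_succ', C_two_mul_eq_sq_sub_two]

theorem monic_C_two_pow_and_natDegree (m : ℕ) :
    (C ℤ (2 ^ m)).Monic ∧ (C ℤ (2 ^ m)).natDegree = 2 ^ m := by
  induction m with
  | zero => simp [monic_X]
  | succ m ih =>
    obtain ⟨hm, hd⟩ := ih
    have hm2 := hm.pow 2
    have hd2 : (C ℤ (2 ^ m) ^ 2).natDegree = 2 ^ (m + 1) := by
      rw [hm.natDegree_pow, hd, pow_succ']
    have hpos : 0 < 2 ^ (m + 1) := by positivity
    rw [C_two_pow_succ, show (2 : ℤ[X]) = Polynomial.C 2 from rfl]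
    refine ⟨hm2.sub_of_left ?_, by rw [natDegree_sub_C, hd2]⟩
    refine degree_C_le.trans_lt (natDegree_pos_iff_degree_pos.mp ?_)
    rw [hd2]
    exact hpos

theorem C_two_pow_zmod_two (m : ℕ) : C (ZMod 2) (2 ^ m) = X ^ 2 ^ m := by
  induction m with
  | zero => simp
  | succ m ih =>
    have h2 : (2 : (ZMod 2)[X]) = 0 := CharTwo.two_eq_zero
    rw [C_two_pow_succ, ih, h2, sub_zero, ← pow_mul, pow_succ]

theorem C_two_pow_coeff_zero (m : ℕ) :
    (C ℤ (2 ^ (m + 1))).coeff 0 = 2 ∨ (C ℤ (2 ^ (m + 1))).coeff 0 = -2 := by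
  simp only [coeff_zero_eq_eval_zero]
  induction m with
  | zero => right; norm_num [C_two]
  | succ m ih =>
    left
    rw [C_two_pow_succ]
    rcases ih with h | h <;> simp [h]

theorem irreducible_C_two_pow (m : ℕ) (hm : m ≠ 0) : Irreducible (C ℤ (2 ^ m)) := by
  obtain ⟨hmon, hdeg⟩ := monic_C_two_pow_and_natDegree m
  have hE : (C ℤ (2 ^ m)).IsEisensteinAt (Ideal.span {2}) := by
    refine ⟨?_, ?_, ?_⟩
    · rw [hmon.leadingCoeff, Ideal.mem_span_singleton]
      decide
    · intro k hk
      rw [hdeg] at hk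
      rw [Ideal.mem_span_singleton]
      have h := congrArg (coeff · k) ((map_C (Int.castRingHom (ZMod 2)) (2 ^ m)).trans
        (C_two_pow_zmod_two m))
      simp only [coeff_map, coeff_X_pow, hk.ne, if_false, eq_intCast] at h
      exact (ZMod.intCast_zmod_eq_zero_iff_dvd _ 2).mp h
    · obtain ⟨m, rfl⟩ := Nat.exists_eq_succ_of_ne_zero hm
      rw [Ideal.span_singleton_pow, Ideal.mem_span_singleton]
      rcases C_two_pow_coeff_zero m with h | h <;> rw [h] <;> decide
  refine hE.irreducible ((Ideal.span_singleton_prime two_ne_zero).mpr Int.prime_two)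
    hmon.isPrimitive ?_
  rw [hdeg]
  positivity

/-- The Vieta–Lucas polynomial of index `2 ^ m` is the minimal polynomial over `ℚ` of each of
its roots. -/
theorem minpoly_eq_C_two_pow {m : ℕ} (hm : m ≠ 0) {L : Type*} [Field L] [CharZero L] {x : L}
    (hx : (C L (2 ^ m)).eval x = 0) : minpoly ℚ x = C ℚ (2 ^ m) := by
  obtain ⟨hmon, -⟩ := monic_C_two_pow_and_natDegree m
  have hmap : (C ℤ (2 ^ m)).map (algebraMap ℤ ℚ) = C ℚ (2 ^ m) := map_C _ _
  refine (minpoly.eq_of_irreducible_of_monic ?_ (by rw [aeval_C, hx]) ?_).symm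
  · rw [← hmap]
    exact (hmon.irreducible_iff_irreducible_map_fraction_map).mp (irreducible_C_two_pow m hm)
  · rw [← hmap]
    exact hmon.map _

theorem natDegree_C_two_pow_rat (m : ℕ) : (C ℚ (2 ^ m)).natDegree = 2 ^ m := by
  obtain ⟨hmon, hdeg⟩ := monic_C_two_pow_and_natDegree m
  rw [← map_C (algebraMap ℤ ℚ), hmon.natDegree_map, hdeg]

end Polynomial.Chebyshev

/-- The angle `2π(4j+1)/(4d)`; these run over the classes `k ≡ 1 [MOD 4]` modulo `4d`. -/
noncomputable def conjAngle (d j : ℕ) : ℝ := 2 * Real.pi * (4 * j + 1) / (4 * d)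

theorem mul_conjAngle {d : ℕ} (hd : d ≠ 0) (j : ℕ) :
    d * conjAngle d j = Real.pi / 2 + j * (2 * Real.pi) := by
  have : (d : ℝ) ≠ 0 := by exact_mod_cast hd
  rw [conjAngle]
  field_simp
  ring

theorem cos_mul_conjAngle {d : ℕ} (hd : d ≠ 0) (j : ℕ) : Real.cos (d * conjAngle d j) = 0 := by
  rw [mul_conjAngle hd, Real.cos_add_nat_mul_two_pi, Real.cos_pi_div_two]

theorem cos_sub_one_mul_conjAngle {d : ℕ} (hd : d ≠ 0) (j : ℕ) :
    Real.cos ((d - 1) * conjAngle d j) = Real.sin (conjAngle d j) := by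
  rw [sub_one_mul, mul_conjAngle hd, add_sub_right_comm, Real.cos_add_nat_mul_two_pi,
    Real.cos_pi_div_two_sub]

theorem cos_conjAngle_injOn {d i j : ℕ} (hi : i < d) (hj : j < d)
    (h : Real.cos (conjAngle d i) = Real.cos (conjAngle d j)) : i = j := by
  have hd : (d : ℝ) ≠ 0 := by
    have : d ≠ 0 := by lia
    exact_mod_cast this
  have hpi := Real.pi_ne_zero
  obtain ⟨k, hk | hk⟩ := Real.cos_eq_cos_iff.mp h
  · have hZ : (4 * j + 1 : ℤ) = 4 * (d * k) + (4 * i + 1) := by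
      have : (4 * j + 1 : ℝ) = 4 * (d * k) + (4 * i + 1) := by
        simp only [conjAngle] at hk
        field_simp at hk
        linarith
      exact_mod_cast this
    have hdvd : (d : ℤ) ∣ j - i := ⟨k, by linarith⟩
    have := Int.eq_zero_of_abs_lt_dvd hdvd (by rw [abs_lt]; constructor <;> lia)
    lia
  · have hZ : (4 * j + 1 : ℤ) = 4 * (d * k) - (4 * i + 1) := by
      have : (4 * j + 1 : ℝ) = 4 * (d * k) - (4 * i + 1) := by
        simp only [conjAngle] at hk
        field_simp at hk
        linarith
      exact_mod_cast this
    lia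

/-- The complex number `e^{iθ_j}` attached to the angle `conjAngle d j`. -/
noncomputable def conjPoint (d j : ℕ) : ℂ := Complex.exp (conjAngle d j * Complex.I)

theorem conjPoint_re (d j : ℕ) : (conjPoint d j).re = Real.cos (conjAngle d j) :=
  Complex.exp_ofReal_mul_I_re _

theorem conjPoint_im (d j : ℕ) : (conjPoint d j).im = Real.sin (conjAngle d j) :=
  Complex.exp_ofReal_mul_I_im _

theorem conjPoint_eq_mul_pow {d : ℕ} (hd : d ≠ 0) (j : ℕ) :
    conjPoint d j = conjPoint d 0 * Complex.exp (2 * Real.pi * Complex.I / d) ^ j := by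
  have : (d : ℂ) ≠ 0 := by exact_mod_cast hd
  rw [conjPoint, conjPoint, ← Complex.exp_nat_mul, ← Complex.exp_add]
  refine congrArg Complex.exp ?_
  simp only [conjAngle]
  push_cast
  field_simp
  ring

theorem conjPoint_zero_pow {d : ℕ} (hd : d ≠ 0) : conjPoint d 0 ^ d = Complex.I := by
  rw [conjPoint, ← Complex.exp_nat_mul, ← mul_assoc]
  have := mul_conjAngle hd 0
  have h2 : (d : ℂ) * conjAngle d 0 = Real.pi / 2 := by
    rw [← Complex.ofReal_natCast, ← Complex.ofReal_mul, this]
    simp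
  rw [h2, Complex.exp_pi_div_two_mul_I]

theorem sum_conjPoint {d : ℕ} (hd : 1 < d) : ∑ j ∈ Finset.range d, conjPoint d j = 0 := by
  have hd0 : d ≠ 0 := by lia
  rw [Finset.sum_congr rfl fun j _ => conjPoint_eq_mul_pow hd0 j, ← Finset.mul_sum,
    (Complex.isPrimitiveRoot_exp d hd0).geom_sum_eq_zero hd, mul_zero]

theorem prod_add_conjPoint {d : ℕ} (hd : d ≠ 0) (heven : Even d) (a : ℂ) :
    ∏ j ∈ Finset.range d, (a + conjPoint d j) = a ^ d - Complex.I := by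
  obtain ⟨ζ, hζdef⟩ : ∃ ζ, ζ = Complex.exp (2 * Real.pi * Complex.I / d) := ⟨_, rfl⟩
  have hζ := Complex.isPrimitiveRoot_exp d hd
  rw [← hζdef] at hζ
  have h := hζ.pow_sub_pow_eq_prod_sub_mul a (-conjPoint d 0) (Nat.pos_of_ne_zero hd)
  rw [heven.neg_pow, conjPoint_zero_pow hd] at h
  rw [h]
  refine Finset.prod_bij (fun j _ => ζ ^ j) ?_ ?_ ?_ ?_
  · intro j _
    rw [Polynomial.mem_nthRootsFinset (Nat.pos_of_ne_zero hd), ← pow_mul, mul_comm, pow_mul,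
      hζ.pow_eq_one, one_pow]
  · intro i hi j hj hij
    exact hζ.pow_inj (Finset.mem_range.mp hi) (Finset.mem_range.mp hj) hij
  · intro z hz
    rw [Polynomial.mem_nthRootsFinset (Nat.pos_of_ne_zero hd)] at hz
    have : NeZero d := ⟨hd⟩
    obtain ⟨i, hi, rfl⟩ := hζ.eq_pow_of_pow_eq_one hz
    exact ⟨i, Finset.mem_range.mpr hi, rfl⟩
  · intro j _
    rw [conjPoint_eq_mul_pow hd j, ← hζdef]
    ring

/-- The real conjugate of `γ` attached to the angle `conjAngle d j`. -/
noncomputable def gammaConj (d j : ℕ) : ℝ :=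
  2 * Real.cos (conjAngle d j) + 2 * Real.sin (conjAngle d j) + 3

theorem gammaConj_pos (d j : ℕ) : 0 < gammaConj d j := by
  have := Real.sin_sq_add_cos_sq (conjAngle d j)
  rw [gammaConj]
  nlinarith [sq_nonneg (Real.cos (conjAngle d j) - Real.sin (conjAngle d j)),
    sq_nonneg (Real.cos (conjAngle d j) + Real.sin (conjAngle d j) + 1),
    sq_nonneg (Real.cos (conjAngle d j) + Real.sin (conjAngle d j) + 3 / 2)]

theorem sum_gammaConj {d : ℕ} (hd : 1 < d) :
    ∑ j ∈ Finset.range d, gammaConj d j = 3 * d := by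
  have h := sum_conjPoint hd
  have hre := congrArg Complex.re h
  have him := congrArg Complex.im h
  simp only [Complex.re_sum, Complex.im_sum, conjPoint_re, conjPoint_im, Complex.zero_re,
    Complex.zero_im] at hre him
  simp only [gammaConj, Finset.sum_add_distrib, ← Finset.mul_sum, hre, him]
  simp [mul_comm]

theorem gammaConj_eq_normSq (d j : ℕ) :
    gammaConj d j = Complex.normSq (1 + Complex.I + conjPoint d j) := by
  have := Real.sin_sq_add_cos_sq (conjAngle d j)
  simp only [gammaConj, Complex.normSq_apply, Complex.add_re, Complex.add_im, Complex.one_re,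
    Complex.one_im, Complex.I_re, Complex.I_im, conjPoint_re, conjPoint_im]
  linarith

theorem prod_gammaConj {d : ℕ} (hd : d ≠ 0) (h4 : 4 ∣ d) :
    ∏ j ∈ Finset.range d, gammaConj d j = 2 ^ d + 1 := by
  simp_rw [gammaConj_eq_normSq]
  rw [← map_prod, prod_add_conjPoint hd (even_iff_two_dvd.mpr (dvd_trans (by norm_num) h4))]
  obtain ⟨e, rfl⟩ := h4
  have h : (1 + Complex.I) ^ 4 = ((-4 : ℝ) : ℂ) := by
    have hI := Complex.I_sq
    push_cast
    linear_combination (Complex.I ^ 2 + 4 * Complex.I + 5) * hI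
  rw [pow_mul, h, ← Complex.ofReal_pow, Complex.normSq_apply]
  simp only [Complex.sub_re, Complex.sub_im, Complex.ofReal_re, Complex.ofReal_im, Complex.I_re,
    Complex.I_im]
  have : ((-4 : ℝ) ^ e) * (-4) ^ e = 2 ^ (4 * e) := by
    rw [← mul_pow, pow_mul]
    norm_num
  linarith

/-- The generator `2 cos (2π/q)` of `Kq q`. -/
noncomputable abbrev KqGen (q : ℕ) : ↥(Kq q) :=
  IntermediateField.AdjoinSimple.gen ℚ (2 * Real.cos (2 * Real.pi / q))

theorem eval_C_two_mul_cos_conjAngle (m j : ℕ) :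
    (Polynomial.Chebyshev.C ℝ (2 ^ m)).eval (2 * Real.cos (conjAngle (2 ^ m) j)) = 0 := by
  have h := cos_mul_conjAngle (d := 2 ^ m) (by positivity) j
  rw [Polynomial.Chebyshev.C_two_mul_real_cos]
  push_cast at h ⊢
  rw [h, mul_zero]

theorem eval_C_sub_one_two_mul_cos_conjAngle (m j : ℕ) :
    (Polynomial.Chebyshev.C ℝ (2 ^ m - 1)).eval (2 * Real.cos (conjAngle (2 ^ m) j)) =
      2 * Real.sin (conjAngle (2 ^ m) j) := by
  have h := cos_sub_one_mul_conjAngle (d := 2 ^ m) (by positivity) j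
  rw [Polynomial.Chebyshev.C_two_mul_real_cos]
  push_cast at h ⊢
  rw [h]

theorem two_pi_div_eq_conjAngle (d : ℕ) : 2 * Real.pi / (4 * d : ℕ) = conjAngle d 0 := by
  simp [conjAngle]

theorem minpoly_two_mul_cos {m : ℕ} (hm : m ≠ 0) :
    minpoly ℚ (2 * Real.cos (2 * Real.pi / (4 * 2 ^ m : ℕ))) =
      Polynomial.Chebyshev.C ℚ (2 ^ m) := by
  refine Polynomial.Chebyshev.minpoly_eq_C_two_pow hm ?_
  rw [two_pi_div_eq_conjAngle, eval_C_two_mul_cos_conjAngle]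

theorem isIntegral_two_mul_cos {m : ℕ} (hm : m ≠ 0) :
    IsIntegral ℚ (2 * Real.cos (2 * Real.pi / (4 * 2 ^ m : ℕ))) := by
  rw [← minpoly.ne_zero_iff, minpoly_two_mul_cos hm]
  refine Polynomial.ne_zero_of_natDegree_gt (n := 0) ?_
  rw [Polynomial.Chebyshev.natDegree_C_two_pow_rat]
  positivity

theorem finiteDimensional_Kq {m : ℕ} (hm : m ≠ 0) : FiniteDimensional ℚ (Kq (4 * 2 ^ m)) :=
  IntermediateField.adjoin.finiteDimensional (isIntegral_two_mul_cos hm)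

theorem finrank_Kq {m : ℕ} (hm : m ≠ 0) : Module.finrank ℚ (Kq (4 * 2 ^ m)) = 2 ^ m := by
  rw [Kq, IntermediateField.adjoin.finrank (isIntegral_two_mul_cos hm), minpoly_two_mul_cos hm,
    Polynomial.Chebyshev.natDegree_C_two_pow_rat]

theorem exists_algHom_Kq {m : ℕ} (hm : m ≠ 0) (j : ℕ) :
    ∃ σ : ↥(Kq (4 * 2 ^ m)) →ₐ[ℚ] ℂ,
      σ (KqGen (4 * 2 ^ m)) = (2 * Real.cos (conjAngle (2 ^ m) j) : ℝ) := by
  have hint := isIntegral_two_mul_cos hm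
  refine ⟨(IntermediateField.algHomAdjoinIntegralEquiv ℚ hint).symm
    ⟨((2 * Real.cos (conjAngle (2 ^ m) j) : ℝ) : ℂ), ?_⟩,
    IntermediateField.algHomAdjoinIntegralEquiv_symm_apply_gen ℚ hint _⟩
  rw [Polynomial.mem_aroots, minpoly_two_mul_cos hm, Polynomial.Chebyshev.aeval_C]
  refine ⟨?_, ?_⟩
  · rw [← minpoly_two_mul_cos hm]
    exact minpoly.ne_zero hint
  · rw [← Complex.coe_algebraMap, ← Polynomial.Chebyshev.algebraMap_eval_C,
      eval_C_two_mul_cos_conjAngle, map_zero]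

theorem eq_KqGen_add_aeval (m : ℕ) {γ : ↥(Kq (4 * 2 ^ m))}
    (hγ : (γ : ℝ) = omegaJReal (4 * 2 ^ m) 1 + omegaJReal (4 * 2 ^ m) (2 ^ m - 1) + 3) :
    γ = KqGen (4 * 2 ^ m) +
      Polynomial.aeval (KqGen (4 * 2 ^ m)) (Polynomial.Chebyshev.C ℚ (2 ^ m - 1)) + 3 := by
  have hgen : ((KqGen (4 * 2 ^ m) : ↥(Kq (4 * 2 ^ m))) : ℝ) =
      2 * Real.cos (2 * Real.pi / (4 * 2 ^ m : ℕ)) :=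
    IntermediateField.AdjoinSimple.coe_gen ℚ _
  have hcast : ((2 ^ m - 1 : ℕ) : ℝ) = ((2 ^ m - 1 : ℤ) : ℝ) := by
    rw [Nat.cast_sub Nat.one_le_two_pow]
    push_cast
    rfl
  apply Subtype.ext
  have haeval : ((Polynomial.aeval (KqGen (4 * 2 ^ m))
      (Polynomial.Chebyshev.C ℚ (2 ^ m - 1)) : ↥(Kq (4 * 2 ^ m))) : ℝ) =
      2 * Real.cos ((2 ^ m - 1 : ℤ) * (2 * Real.pi / (4 * 2 ^ m : ℕ))) := by
    rw [← Polynomial.Chebyshev.C_two_mul_real_cos, ← hgen, ← Polynomial.Chebyshev.aeval_C (R := ℚ)]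
    exact (Polynomial.aeval_algebraMap_apply ℝ (KqGen (4 * 2 ^ m)) _).symm
  rw [hγ]
  change _ = ((KqGen (4 * 2 ^ m) : ↥(Kq (4 * 2 ^ m))) : ℝ) + _ + 3
  rw [haeval, hgen]
  simp only [omegaJReal, hcast, Nat.cast_one, mul_one]
  congr 4
  ring

theorem algHom_gamma {m : ℕ} {γ : ↥(Kq (4 * 2 ^ m))}
    (hγ : (γ : ℝ) = omegaJReal (4 * 2 ^ m) 1 + omegaJReal (4 * 2 ^ m) (2 ^ m - 1) + 3)
    {j : ℕ} {σ : ↥(Kq (4 * 2 ^ m)) →ₐ[ℚ] ℂ}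
    (hσ : σ (KqGen (4 * 2 ^ m)) = (2 * Real.cos (conjAngle (2 ^ m) j) : ℝ)) :
    σ γ = (gammaConj (2 ^ m) j : ℂ) := by
  rw [eq_KqGen_add_aeval m hγ, map_add, map_add, ← Polynomial.aeval_algHom_apply, hσ,
    Polynomial.Chebyshev.aeval_C, ← Complex.coe_algebraMap,
    ← Polynomial.Chebyshev.algebraMap_eval_C, eval_C_sub_one_two_mul_cos_conjAngle, gammaConj,
    map_ofNat σ 3]
  simp

/-- The embeddings of `Kq (4 * 2 ^ m)` are indexed by the angles `conjAngle (2 ^ m) j`. -/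
theorem exists_equiv_algHom_Kq {m : ℕ} (hm : m ≠ 0) :
    ∃ e : Fin (2 ^ m) ≃ (↥(Kq (4 * 2 ^ m)) →ₐ[ℚ] ℂ), ∀ j,
      e j (KqGen (4 * 2 ^ m)) = (2 * Real.cos (conjAngle (2 ^ m) j) : ℝ) := by
  have := finiteDimensional_Kq hm
  choose σ hσ using fun j : Fin (2 ^ m) => exists_algHom_Kq hm j
  refine ⟨Equiv.ofBijective σ ((Fintype.bijective_iff_injective_and_card σ).mpr ⟨?_, ?_⟩), hσ⟩
  · intro i j hij
    have h := hσ i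
    rw [hij, hσ j, Complex.ofReal_inj] at h
    exact Fin.ext (cos_conjAngle_injOn i.2 j.2 (by linarith))
  · rw [Fintype.card_fin, AlgHom.card, finrank_Kq hm]

/-- For `q = 2^n` with `n > 3`, `d = 2^(n-2)`, and `γ_n = ω + ω_{d-1} + 3 ∈ 𝓞_{K_{2^n}}`:
(i) `γ_n` is totally positive, (ii) `Tr(γ_n) = 3d`, and (iii) `Nr(γ_n) = 2^d + 1`. -/
theorem stmt11 (n : ℕ) (hn : 3 < n) (q d : ℕ) (hq : q = 2 ^ n) (hd : d = 2 ^ (n - 2))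
    (γ : 𝓞 ↥(Kq q))
    (hγ : ((γ : ↥(Kq q)) : ℝ) = omegaJReal q 1 + omegaJReal q (d - 1) + 3) :
    (∀ σ : ↥(Kq q) →+* ℝ, 0 < σ (γ : ↥(Kq q))) ∧
    Algebra.trace ℚ ↥(Kq q) (γ : ↥(Kq q)) = 3 * (d : ℚ) ∧
    Algebra.norm ℚ (γ : ↥(Kq q)) = 2 ^ d + 1 := by
  obtain ⟨m, rfl⟩ : ∃ m, n = m + 2 := ⟨n - 2, by lia⟩
  obtain rfl : d = 2 ^ m := by simpa using hd
  obtain rfl : q = 4 * 2 ^ m := by rw [hq, pow_add, mul_comm]; norm_num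
  have hm : m ≠ 0 := by lia
  have h4 : 4 ∣ 2 ^ m := by
    rw [show 4 = 2 ^ 2 by norm_num]
    exact pow_dvd_pow 2 (by lia)
  have := finiteDimensional_Kq hm
  obtain ⟨e, he⟩ := exists_equiv_algHom_Kq hm
  have hγe : ∀ j, e j (γ : ↥(Kq (4 * 2 ^ m))) = (gammaConj (2 ^ m) j : ℂ) :=
    fun j => algHom_gamma hγ (he j)
  refine ⟨fun σ => ?_, ?_, ?_⟩
  · obtain ⟨j, hj⟩ := e.surjective (Complex.ofRealHom.comp σ).toRatAlgHom
    have h : ((σ (γ : ↥(Kq (4 * 2 ^ m))) : ℝ) : ℂ) = (gammaConj (2 ^ m) j : ℂ) := by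
      rw [← hγe, hj]
      rfl
    rw [Complex.ofReal_inj.mp h]
    exact gammaConj_pos _ _
  · apply (algebraMap ℚ ℂ).injective
    rw [trace_eq_sum_embeddings, ← e.sum_comp]
    simp_rw [hγe]
    rw [Fin.sum_univ_eq_sum_range (fun j => (gammaConj (2 ^ m) j : ℂ)), ← Complex.ofReal_sum,
      sum_gammaConj (Nat.one_lt_two_pow hm)]
    simp
  · apply (algebraMap ℚ ℂ).injective
    rw [Algebra.norm_eq_prod_embeddings, ← e.prod_comp]
    simp_rw [hγe]
    rw [Fin.prod_univ_eq_prod_range (fun j => (gammaConj (2 ^ m) j : ℂ)), ← Complex.ofReal_prod,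
      prod_gammaConj (by positivity) h4]
    simp
end

section
/- Let q = 2^n with n ≥ 3 and let α_n = ω + 2 ∈ O_{2^n}, where ω = ζ_{2^n} + ζ_{2^n}^{-1}. If F is any totally real number field containing K_{2^n}, then α_n is an indecomposable totally positive integer in O_F. -/
open NumberField

/-- If `x` is sent to `0` by an iterate of `y ↦ y ^ 2 - 2`, then `2 + x` divides `2`, and `2 - x`
is associated to `2 + x`. -/
theorem two_add_dvd_two_of_iterate_eq_zero {R : Type*} [CommRing R] [IsDomain R]
    (h2 : (2 : R) ≠ 0) (m : ℕ) (x : R) (hx : (fun y : R => y ^ 2 - 2)^[m] x = 0) :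
    2 + x ∣ 2 ∧ Associated (2 + x) (2 - x) ∧ (0 < m → (2 + x) ^ 2 ∣ 2) := by
  induction m generalizing x with
  | zero =>
    obtain rfl : x = 0 := hx
    simp
  | succ m ih =>
    rw [Function.iterate_succ_apply] at hx
    obtain ⟨⟨t, ht⟩, ⟨u, hu⟩, -⟩ := ih _ hx
    have hsq : 2 + (x ^ 2 - 2) = x ^ 2 := by ring
    rw [hsq] at ht hu
    have hx2 : x ^ 2 ≠ 0 := fun h => h2 (by rw [ht, h, zero_mul])
    have hprod : (1 + x * t) * (1 - x * t) = -(u : R) := by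
      apply mul_left_cancel₀ hx2
      linear_combination (2 + x ^ 2 * t) * ht + hu
    have hunit : IsUnit ((1 + x * t) * (1 - x * t)) := hprod ▸ u.isUnit.neg
    obtain ⟨⟨a, ha⟩, ⟨b, hb⟩⟩ := IsUnit.mul_iff.mp hunit
    have hp : 2 + x = x * a := by rw [ha]; linear_combination ht
    have hm : 2 - x = -(x * b) := by rw [hb]; linear_combination ht
    have hsq_dvd : (2 + x) ^ 2 ∣ 2 := by
      rw [hp, mul_pow, ← Units.val_pow_eq_pow_val, Units.mul_right_dvd]
      exact ⟨t, ht⟩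
    refine ⟨(dvd_pow_self _ two_ne_zero).trans hsq_dvd, ?_, fun _ => hsq_dvd⟩
    rw [hp, hm, ← mul_neg]
    exact (associated_mul_unit_left x a a.isUnit).trans
      (associated_mul_unit_right x _ b.isUnit.neg)

theorem abs_lt_two_of_iterate_eq_zero (m : ℕ) (y : ℝ)
    (hy : (fun y : ℝ => y ^ 2 - 2)^[m] y = 0) : |y| < 2 := by
  induction m generalizing y with
  | zero =>
    obtain rfl : y = 0 := hy
    simp
  | succ m ih =>
    rw [Function.iterate_succ_apply] at hy
    have h := (abs_lt.mp (ih _ hy)).2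
    exact abs_lt_of_sq_lt_sq (by linarith) zero_le_two

theorem iterate_two_mul_cos_eq_zero (m : ℕ) :
    (fun y : ℝ => y ^ 2 - 2)^[m] (2 * Real.cos (2 * Real.pi / 2 ^ (m + 2))) = 0 := by
  induction m with
  | zero =>
    rw [Function.iterate_zero_apply, show 2 * Real.pi / 2 ^ (0 + 2) = Real.pi / 2 by ring,
      Real.cos_pi_div_two, mul_zero]
  | succ m ih =>
    have hcos : (2 * Real.cos (2 * Real.pi / 2 ^ (m + 1 + 2))) ^ 2 - 2 =
        2 * Real.cos (2 * Real.pi / 2 ^ (m + 2)) := by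
      rw [show 2 * Real.pi / 2 ^ (m + 2) = 2 * (2 * Real.pi / 2 ^ (m + 1 + 2)) by field_simp; ring,
        Real.cos_two_mul]
      ring
    rw [Function.iterate_succ_apply, hcos, ih]

theorem map_iterate_sq_sub_two {R S : Type*} [CommRing R] [CommRing S] (g : R →+* S) (m : ℕ)
    (x : R) : g ((fun y : R => y ^ 2 - 2)^[m] x) = (fun y : S => y ^ 2 - 2)^[m] (g x) :=
  Function.Semiconj.iterate_right (f := g) (fun y => by simp [map_ofNat g 2]) m x

/-- In a totally real field every infinite place is the absolute value of a real embedding. -/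
theorem exists_real_embedding_of_infinitePlace {F : Type*} [Field F]
    (htr : ∀ (σ : F →+* ℂ) (x : F), (σ x).im = 0) (v : InfinitePlace F) :
    ∃ σ : F →+* ℝ, ∀ x, v x = |σ x| := by
  have hreal : ComplexEmbedding.IsReal v.embedding :=
    RingHom.ext fun x => Complex.conj_eq_iff_im.mpr (htr _ x)
  refine ⟨hreal.embedding, fun x => ?_⟩
  rw [← InfinitePlace.norm_embedding_eq, ← hreal.coe_embedding_apply, Complex.norm_real,
    Real.norm_eq_abs]

/-- In a totally real field, a totally positive integer whose square divides `2` is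
indecomposable. -/
theorem indecomposable_of_sq_dvd_two {F : Type*} [Field F] [NumberField F]
    (htr : ∀ (σ : F →+* ℂ) (x : F), (σ x).im = 0) {α : 𝓞 F} (hα : α ^ 2 ∣ 2) :
    Indecomposable F α := by
  rintro ⟨β, γ, hβ, hγ, rfl⟩
  obtain ⟨δ, hδ⟩ := hα
  have hlt (v : InfinitePlace F) : v ((β * γ * δ : 𝓞 F) : F) < 1 := by
    obtain ⟨σ, hσ⟩ := exists_real_embedding_of_infinitePlace htr v
    have hσδ : 2 = (σ β + σ γ) ^ 2 * σ δ := by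
      have h := congrArg (σ.comp (algebraMap (𝓞 F) F)) hδ
      rwa [map_mul, map_pow, map_add, map_ofNat] at h
    have hδ_pos : 0 < σ δ := by
      by_contra! h
      nlinarith [sq_nonneg (σ β + σ γ)]
    have hpos := mul_pos (mul_pos (hβ σ) (hγ σ)) hδ_pos
    have hmul : σ ((β * γ * δ : 𝓞 F) : F) = σ β * σ γ * σ δ := by
      simp only [map_mul]
    rw [hσ, hmul, abs_of_pos hpos]
    nlinarith [mul_nonneg (sq_nonneg (σ β - σ γ)) hδ_pos.le]
  obtain ⟨v⟩ := (inferInstance : Nonempty (InfinitePlace F))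
  obtain ⟨σ, -⟩ := exists_real_embedding_of_infinitePlace htr v
  have hβ0 : β ≠ 0 := by rintro rfl; simpa using hβ σ
  have hγ0 : γ ≠ 0 := by rintro rfl; simpa using hγ σ
  have hδ0 : δ ≠ 0 := by rintro rfl; simp at hδ
  exact (hlt v).not_ge
    (InfinitePlace.one_le_of_lt_one (mul_ne_zero (mul_ne_zero hβ0 hγ0) hδ0) fun z _ => hlt z)

/-- For `q = 2^n` with `n ≥ 3` and `α_n = ω + 2`, if `F` is a totally real number field
containing `K_{2^n}`, then `α_n` is an indecomposable totally positive integer of `F`. -/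
theorem stmt12 (n : ℕ) (hn : 3 ≤ n) (q : ℕ) (hq : q = 2 ^ n)
    (F : Type*) [Field F] [NumberField F]
    (htr : ∀ (σ : F →+* ℂ) (x : F), (σ x).im = 0)
    (f : ↥(Kq q) →+* F)
    (w : ↥(Kq q)) (hw : (w : ℝ) = omegaReal q)
    (α : 𝓞 F) (hα : (α : F) = f w + 2) :
    TotallyPositive F α ∧ Indecomposable F α := by
  obtain ⟨m, rfl⟩ : ∃ m, n = m + 2 := ⟨n - 2, by omega⟩
  have hK : (fun y : Kq q => y ^ 2 - 2)^[m] w = 0 := by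
    apply Subtype.val_injective
    have h := map_iterate_sq_sub_two (algebraMap (Kq q) ℝ) m w
    have hw' : algebraMap (Kq q) ℝ w = 2 * Real.cos (2 * Real.pi / 2 ^ (m + 2)) := by
      simpa [omegaReal, hq] using hw
    rwa [hw', iterate_two_mul_cos_eq_zero] at h
  have hF : (fun y : F => y ^ 2 - 2)^[m] (f w) = 0 := by
    rw [← map_iterate_sq_sub_two, hK, map_zero]
  have hO : (fun y : 𝓞 F => y ^ 2 - 2)^[m] (α - 2) = 0 := by
    apply RingOfIntegers.coe_injective
    have h := map_iterate_sq_sub_two (algebraMap (𝓞 F) F) m (α - 2)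
    have hα' : algebraMap (𝓞 F) F (α - 2) = f w := by
      rw [map_sub, map_ofNat]
      exact sub_eq_of_eq_add hα
    rwa [hα', hF, ← map_zero (algebraMap (𝓞 F) F)] at h
  refine ⟨fun σ => ?_, indecomposable_of_sq_dvd_two htr ?_⟩
  · have hσ : (fun y : ℝ => y ^ 2 - 2)^[m] (σ (f w)) = 0 := by
      rw [← map_iterate_sq_sub_two, hF, map_zero]
    have h := (abs_lt.mp (abs_lt_two_of_iterate_eq_zero m _ hσ)).1
    rw [hα, map_add, map_ofNat]
    linarith
  · simpa using (two_add_dvd_two_of_iterate_eq_zero two_ne_zero m _ hO).2.2 (by omega)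
end

section
/- Let q = 2^n with n > 3, let d = 2^{n−2}, and let γ_n = ω + ω_{d−1} + 3 ∈ O_{2^n}, where ω = ζ_{2^n} + ζ_{2^n}^{-1} and ω_j = ζ_{2^n}^j + ζ_{2^n}^{-j}. If F is any totally real number field containing K_{2^n}, then γ_n is an indecomposable totally positive integer in O_F. -/
open NumberField

open Polynomial in
/-- Elements with the same minimal polynomial in two extensions have compatible norms. -/
theorem norm_pow_finrank_eq_of_minpoly_eq {K L M : Type*} [Field K] [Field L] [Field M]
    [Algebra K L] [Algebra K M] [FiniteDimensional K L] [FiniteDimensional K M]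
    {x : L} {y : M} (h : minpoly K x = minpoly K y) :
    Algebra.norm K x ^ Module.finrank K M = Algebra.norm K y ^ Module.finrank K L := by
  apply FaithfulSMul.algebraMap_injective K (AlgebraicClosure K)
  rw [map_pow, map_pow, Algebra.norm_eq_prod_roots (AlgebraicClosure K) (IsAlgClosed.splits _),
    Algebra.norm_eq_prod_roots (AlgebraicClosure K) (IsAlgClosed.splits _), h,
    ← Module.finrank_mul_finrank K (IntermediateField.adjoin K {x}) L,
    ← Module.finrank_mul_finrank K (IntermediateField.adjoin K {y}) M,
    IntermediateField.adjoin.finrank (Algebra.IsIntegral.isIntegral x),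
    IntermediateField.adjoin.finrank (Algebra.IsIntegral.isIntegral y), h]
  ring

/-- The expression `3 + (μ + μ⁻¹) + (μ^(d-1) + μ^(-(d-1)))`, whose values at the primitive `4d`-th
roots of unity are the conjugates of `γ_n`. -/
noncomputable def conjugateExpr {K : Type*} [Field K] (d : ℕ) (μ : K) : K :=
  3 + (μ + μ⁻¹) + (μ ^ (d - 1) + (μ ^ (d - 1))⁻¹)

theorem map_conjugateExpr {K L : Type*} [Field K] [Field L] (σ : K →+* L) (d : ℕ) (μ : K) :
    σ (conjugateExpr d μ) = conjugateExpr d (σ μ) := by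
  simp [conjugateExpr, map_ofNat]

theorem conjugateExpr_eq {d : ℕ} (hd : d ≠ 0) {j μ : ℂ} (hj : j ^ 2 = -1) (hμ : μ ^ d = j) :
    conjugateExpr d μ = 3 + (1 - j) * μ + (1 + j) * μ⁻¹ := by
  have hj0 : j ≠ 0 := by rintro rfl; norm_num at hj
  have h0 : μ ≠ 0 := by rintro rfl; exact hj0 (by rw [← hμ, zero_pow hd])
  have hp : μ ^ (d - 1) = j * μ⁻¹ := by
    rw [← hμ, pow_sub₀ μ h0 (Nat.one_le_iff_ne_zero.mpr hd), pow_one]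
  have hji : j⁻¹ = -j := by
    field_simp
    linear_combination hj
  rw [conjugateExpr, hp, mul_inv, inv_inv, hji]
  ring

open Polynomial in
theorem prod_sub_nthRootsFinset {d : ℕ} (hd : d ≠ 0) {j : ℂ} (hj : j ≠ 0) (x : ℂ) :
    ∏ μ ∈ nthRootsFinset d j, (x - μ) = x ^ d - j := by
  have hsep : (X ^ d - C j : ℂ[X]).Separable :=
    separable_X_pow_sub_C j (by exact_mod_cast hd) hj
  have h := (IsAlgClosed.splits (X ^ d - C j : ℂ[X])).eval_eq_prod_roots_of_monic
    (monic_X_pow_sub_C j hd) x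
  rw [nthRootsFinset_def, Finset.prod, Multiset.toFinset_val, nthRoots,
    Multiset.dedup_eq_self.mpr (nodup_roots hsep)]
  simpa using h.symm

open Polynomial in
theorem prod_conjugateExpr_nthRootsFinset {c : ℕ} (hc : c ≠ 0) {j : ℂ} (hj : j ^ 2 = -1) :
    ∏ μ ∈ nthRootsFinset (4 * c) j, conjugateExpr (4 * c) μ = 2 ^ (4 * c) + 1 := by
  have hd : 4 * c ≠ 0 := by omega
  have hj0 : j ≠ 0 := by rintro rfl; norm_num at hj
  have hcard : (nthRootsFinset (4 * c) j).card = 4 * c := by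
    have hsep : (X ^ (4 * c) - C j : ℂ[X]).Separable :=
      separable_X_pow_sub_C j (by exact_mod_cast hd) hj0
    rw [nthRootsFinset_def, nthRoots, Multiset.toFinset_card_of_nodup (nodup_roots hsep),
      ← (IsAlgClosed.splits (X ^ (4 * c) - C j : ℂ[X])).natDegree_eq_card_roots,
      natDegree_X_pow_sub_C]
  have hterm : ∀ μ ∈ nthRootsFinset (4 * c) j, (0 - μ) * conjugateExpr (4 * c) μ =
      -(1 - j) * ((-(1 + j) - μ) * (-((1 + j) / 2) - μ)) := by
    intro μ hμ
    rw [mem_nthRootsFinset (by omega)] at hμ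
    have h0 : μ ≠ 0 := by rintro rfl; exact hj0 (by rw [← hμ, zero_pow hd])
    rw [conjugateExpr_eq hd hj hμ]
    field_simp
    linear_combination μ * (-3 * μ - 1 - j) * hj
  have hprod := Finset.prod_congr rfl hterm
  rw [Finset.prod_mul_distrib, Finset.prod_mul_distrib, Finset.prod_mul_distrib,
    Finset.prod_const, hcard, prod_sub_nthRootsFinset hd hj0, prod_sub_nthRootsFinset hd hj0,
    prod_sub_nthRootsFinset hd hj0, zero_pow hd] at hprod
  have h1 : (-(1 - j)) ^ (4 * c) = (-4) ^ c := by
    rw [pow_mul]; congr 1; linear_combination (j ^ 2 - 4 * j + 5) * hj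
  have h2 : (-(1 + j)) ^ (4 * c) = (-4) ^ c := by
    rw [pow_mul]; congr 1; linear_combination (j ^ 2 + 4 * j + 5) * hj
  have h3 : (-((1 + j) / 2)) ^ (4 * c) = ((-4) ^ c)⁻¹ := by
    rw [pow_mul, ← inv_pow]; congr 1; linear_combination (j ^ 2 + 4 * j + 5) / 16 * hj
  have h4 : ((-4 : ℂ) ^ c) * (-4) ^ c = 2 ^ (4 * c) := by
    rw [← mul_pow, pow_mul]; norm_num
  have h5 : ((-4 : ℂ) ^ c) ≠ 0 := pow_ne_zero _ (by norm_num)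
  have h6 := mul_inv_cancel₀ h5
  rw [h1, h2, h3] at hprod
  rw [← mul_right_inj' (neg_ne_zero.mpr hj0), ← h4]
  linear_combination hprod + (-4) ^ c * hj + ((-4) ^ c - j) * h6

/-- A complex number is a primitive `2^(n+2)`-th root of unity if and only if its `2^n`-th power is
a square root of `-1`. -/
theorem mem_primitiveRoots_two_pow {n : ℕ} {μ : ℂ} :
    μ ∈ primitiveRoots (2 ^ (n + 2)) ℂ ↔ μ ^ 2 ^ n = Complex.I ∨ μ ^ 2 ^ n = -Complex.I := by
  rw [mem_primitiveRoots (by positivity)]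
  have hsq : (μ ^ 2 ^ n = Complex.I ∨ μ ^ 2 ^ n = -Complex.I) ↔ μ ^ 2 ^ (n + 1) = -1 := by
    rw [← sq_eq_sq_iff_eq_or_eq_neg, Complex.I_sq, ← pow_mul, ← pow_succ]
  rw [hsq]
  constructor
  · intro h
    exact (h.pow (by positivity) (by ring : 2 ^ (n + 2) = 2 ^ (n + 1) * 2)).eq_neg_one_of_two_right
  · intro h
    rw [IsPrimitiveRoot.iff_orderOf]
    refine orderOf_eq_prime_pow ?_ ?_
    · rw [h]; norm_num
    · rw [pow_succ 2 (n + 1), pow_mul, h]; norm_num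

open Polynomial in
theorem prod_conjugateExpr_primitiveRoots (n : ℕ) :
    ∏ μ ∈ primitiveRoots (2 ^ (n + 4)) ℂ, conjugateExpr (2 ^ (n + 2)) μ =
      (2 ^ 2 ^ (n + 2) + 1) ^ 2 := by
  classical
  have hd : 2 ^ (n + 2) = 4 * 2 ^ n := by ring
  have hunion : primitiveRoots (2 ^ (n + 4)) ℂ =
      nthRootsFinset (2 ^ (n + 2)) Complex.I ∪ nthRootsFinset (2 ^ (n + 2)) (-Complex.I) := by
    ext μ
    rw [Finset.mem_union, mem_nthRootsFinset (by positivity), mem_nthRootsFinset (by positivity)]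
    exact mem_primitiveRoots_two_pow
  have hdisj : Disjoint (nthRootsFinset (2 ^ (n + 2)) Complex.I)
      (nthRootsFinset (2 ^ (n + 2)) (-Complex.I)) := by
    rw [Finset.disjoint_left]
    intro μ h1 h2
    rw [mem_nthRootsFinset (by positivity)] at h1 h2
    exact self_ne_neg.mpr Complex.I_ne_zero (h1.symm.trans h2)
  rw [hunion, Finset.prod_union hdisj, hd,
    prod_conjugateExpr_nthRootsFinset (by positivity) Complex.I_sq,
    prod_conjugateExpr_nthRootsFinset (by positivity) (by simp), sq]

theorem conjugateExpr_re_pos {n : ℕ} {μ : ℂ} (hμ : μ ∈ primitiveRoots (2 ^ (n + 2)) ℂ) :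
    0 < (conjugateExpr (2 ^ n) μ).re := by
  have hnorm : ‖μ‖ = 1 :=
    (isPrimitiveRoot_of_mem_primitiveRoots hμ).norm'_eq_one (by positivity)
  have hinv : μ⁻¹ = starRingEnd ℂ μ := Complex.inv_eq_conj hnorm
  have hsq : μ.re ^ 2 + μ.im ^ 2 = 1 := by
    have := Complex.sq_norm μ
    rw [hnorm, Complex.normSq_apply] at this
    linarith
  rcases mem_primitiveRoots_two_pow.mp hμ with h | h
  · rw [conjugateExpr_eq (by positivity) Complex.I_sq h, hinv]
    simp
    nlinarith [sq_nonneg (μ.re + μ.im), sq_nonneg (μ.re - μ.im), sq_nonneg (μ.re + μ.im + 1)]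
  · rw [conjugateExpr_eq (by positivity) (by simp) h, hinv]
    simp
    nlinarith [sq_nonneg (μ.re + μ.im), sq_nonneg (μ.re - μ.im), sq_nonneg (μ.re - μ.im + 1)]

/-- The image of `γ_n` in the cyclotomic field has norm `(2^d + 1)^2`. -/
theorem norm_conjugateExpr_of_isPrimitiveRoot {n : ℕ} {L : Type*} [Field L] [NumberField L]
    [IsCyclotomicExtension {2 ^ (n + 4)} ℚ L] {ζ : L} (hζ : IsPrimitiveRoot ζ (2 ^ (n + 4))) :
    Algebra.norm ℚ (conjugateExpr (2 ^ (n + 2)) ζ) =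
      (2 ^ 2 ^ (n + 2) + 1) ^ 2 := by
  have hirr := Polynomial.cyclotomic.irreducible_rat (n := 2 ^ (n + 4)) (by positivity)
  apply (algebraMap ℚ ℂ).injective
  rw [Algebra.norm_eq_prod_embeddings]
  calc ∏ σ : L →ₐ[ℚ] ℂ, σ (conjugateExpr (2 ^ (n + 2)) ζ)
      = ∏ μ : primitiveRoots (2 ^ (n + 4)) ℂ, conjugateExpr (2 ^ (n + 2)) (μ : ℂ) :=
        Fintype.prod_equiv (hζ.embeddingsEquivPrimitiveRoots ℂ hirr) _ _ fun σ ↦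
          map_conjugateExpr σ.toRingHom _ _
    _ = _ := by
      rw [Finset.prod_coe_sort _ (conjugateExpr (2 ^ (n + 2))),
        prod_conjugateExpr_primitiveRoots]
      simp

/-- The real embedding underlying a complex embedding with real values. -/
noncomputable def realEmbedding {F : Type*} [Field F] (σ : F →+* ℂ) (h : ∀ x, (σ x).im = 0) :
    F →+* ℝ where
  toFun x := (σ x).re
  map_one' := by simp
  map_mul' x y := by simp [h]
  map_zero' := by simp
  map_add' x y := by simp

theorem norm_eq_prod_realEmbedding {F : Type*} [Field F] [NumberField F]
    (htr : ∀ (σ : F →+* ℂ) (x : F), (σ x).im = 0) (x : F) :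
    ((Algebra.norm ℚ x : ℚ) : ℝ) =
      ∏ σ : F →ₐ[ℚ] ℂ, realEmbedding (σ : F →+* ℂ) (htr _) x := by
  apply Complex.ofReal_injective
  have h := Algebra.norm_eq_prod_embeddings ℚ ℂ x
  rw [eq_ratCast] at h
  rw [Complex.ofReal_ratCast, h, Complex.ofReal_prod]
  refine Finset.prod_congr rfl fun σ _ ↦ Complex.ext rfl ?_
  simpa using htr σ x

theorem one_le_prod_of_integer {F : Type*} [Field F] [NumberField F]
    (htr : ∀ (σ : F →+* ℂ) (x : F), (σ x).im = 0) {x : 𝓞 F} (hx : x ≠ 0)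
    (hpos : ∀ σ : F →+* ℝ, 0 ≤ σ (x : F)) :
    1 ≤ ∏ σ : F →ₐ[ℚ] ℂ, realEmbedding (σ : F →+* ℂ) (htr _) (x : F) := by
  have hnn := Finset.prod_nonneg (s := Finset.univ) fun (σ : F →ₐ[ℚ] ℂ) _ ↦
    hpos (realEmbedding (σ : F →+* ℂ) (htr _))
  rw [← norm_eq_prod_realEmbedding htr, ← Algebra.coe_norm_int] at hnn ⊢
  have hne : Algebra.norm ℤ x ≠ 0 := Algebra.norm_ne_zero_iff.mpr hx
  have : 0 ≤ Algebra.norm ℤ x := by exact_mod_cast hnn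
  have : 1 ≤ Algebra.norm ℤ x := by omega
  exact_mod_cast this

/-- The case of the weighted arithmetic-geometric mean inequality with weights `1/5`, `4/5`. -/
theorem mul_pow_four_le_add_pow_five {x p : ℝ} (hx : 0 ≤ x) (hp : 0 ≤ p) :
    3125 * (x * p ^ 4) ≤ (x + 4 * p) ^ 5 := by
  have : 0 ≤ (x - p) ^ 2 * (x ^ 3 + 22 * x ^ 2 * p + 203 * x * p ^ 2 + 1024 * p ^ 3) := by
    positivity
  linarith

/-- A sum of two distinct totally positive integers of a totally real field of degree `m` has norm
at least `5^(m/2)`; the inequality is stated after taking tenth powers. -/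
theorem le_norm_add_pow {F : Type*} [Field F] [NumberField F]
    (htr : ∀ (σ : F →+* ℂ) (x : F), (σ x).im = 0) {β δ : 𝓞 F}
    (hβ : TotallyPositive F β) (hδ : TotallyPositive F δ) (hne : β ≠ δ) :
    3125 ^ Module.finrank ℚ F ≤ Algebra.norm ℤ (β + δ) ^ 10 := by
  have h0 (α : 𝓞 F) (h : TotallyPositive F α) : α ≠ 0 := by
    rintro rfl
    have σ : F →+* ℂ := Classical.choice inferInstance
    simpa using h (realEmbedding σ (htr σ))
  have hx := one_le_prod_of_integer htr (x := (β - δ) ^ 2) (pow_ne_zero 2 (sub_ne_zero.mpr hne))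
    fun σ ↦ by simp only [map_pow]; positivity
  have hp := one_le_prod_of_integer htr (x := β * δ) (mul_ne_zero (h0 β hβ) (h0 δ hδ))
    fun σ ↦ by simpa using (mul_pos (hβ σ) (hδ σ)).le
  have key : (3125 : ℝ) ^ Module.finrank ℚ F ≤ (Algebra.norm ℤ (β + δ) : ℝ) ^ 10 := by
    have hN : (Algebra.norm ℤ (β + δ) : ℝ) = ((Algebra.norm ℚ ((β + δ : 𝓞 F) : F) : ℚ) : ℝ) := by
      rw [← Algebra.coe_norm_int]; norm_cast
    rw [hN, norm_eq_prod_realEmbedding htr, ← Finset.prod_pow, ← AlgHom.card ℚ F ℂ,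
      ← Finset.card_univ]
    calc (3125 : ℝ) ^ (Finset.univ : Finset (F →ₐ[ℚ] ℂ)).card
        ≤ 3125 ^ (Finset.univ : Finset (F →ₐ[ℚ] ℂ)).card *
          ((∏ σ : F →ₐ[ℚ] ℂ, realEmbedding (σ : F →+* ℂ) (htr _) (((β - δ) ^ 2 : 𝓞 F) : F)) *
          (∏ σ : F →ₐ[ℚ] ℂ, realEmbedding (σ : F →+* ℂ) (htr _) ((β * δ : 𝓞 F) : F)) ^ 4) :=
          le_mul_of_one_le_right (by positivity) (one_le_mul_of_one_le_of_one_le hx (one_le_pow₀ hp))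
      _ = ∏ σ : F →ₐ[ℚ] ℂ, 3125 *
          (realEmbedding (σ : F →+* ℂ) (htr _) (((β - δ) ^ 2 : 𝓞 F) : F) *
            realEmbedding (σ : F →+* ℂ) (htr _) ((β * δ : 𝓞 F) : F) ^ 4) := by
          rw [Finset.prod_mul_distrib, Finset.prod_mul_distrib, Finset.prod_const,
            Finset.prod_pow]
      _ ≤ _ := by
          refine Finset.prod_le_prod (fun σ _ ↦ ?_) fun σ _ ↦ ?_
          · have := mul_pos (hβ (realEmbedding (σ : F →+* ℂ) (htr _)))
              (hδ (realEmbedding (σ : F →+* ℂ) (htr _)))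
            simp only [map_pow, map_mul, map_sub]
            positivity
          · have := mul_pos (hβ (realEmbedding (σ : F →+* ℂ) (htr _)))
              (hδ (realEmbedding (σ : F →+* ℂ) (htr _)))
            simp only [map_pow, map_mul, map_sub, map_add]
            refine (mul_pow_four_le_add_pow_five (sq_nonneg _) this.le).trans_eq ?_
            ring
  exact_mod_cast key

theorem sq_add_one_lt_pow {n : ℕ} (h : n ≠ 0) : ((16 : ℤ) ^ n + 1) ^ 2 < 625 ^ n := by
  obtain ⟨m, rfl⟩ := Nat.exists_eq_succ_of_ne_zero h
  have h1 : (1 : ℤ) ≤ 16 ^ m := one_le_pow₀ (by norm_num)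
  have h2 : ((16 : ℤ) ^ m) ^ 2 ≤ 625 ^ m := by
    rw [← pow_mul, mul_comm, pow_mul]; gcongr; norm_num
  rw [Nat.succ_eq_add_one, pow_succ (16 : ℤ), pow_succ (625 : ℤ)]
  nlinarith

theorem coe_eq_conjugateExpr_exp (q d : ℕ) :
    ((omegaJReal q 1 + omegaJReal q (d - 1) + 3 : ℝ) : ℂ) =
      conjugateExpr d (Complex.exp (2 * Real.pi * Complex.I / q)) := by
  rw [conjugateExpr, ← Complex.exp_nat_mul, ← Complex.exp_neg, ← Complex.exp_neg]
  simp only [omegaJReal, Complex.ofReal_add, Complex.ofReal_mul, Complex.ofReal_cos, Complex.cos]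
  push_cast
  ring_nf

/-- The real number `γ_n` and its image in the cyclotomic field share their minimal polynomial. -/
theorem minpoly_eq_minpoly_conjugateExpr {n : ℕ} {L : Type*} [Field L] [NumberField L]
    [IsCyclotomicExtension {2 ^ (n + 4)} ℚ L] {ζ : L} (hζ : IsPrimitiveRoot ζ (2 ^ (n + 4)))
    {F : Type*} [Field F] [NumberField F]
    (f : Kq (2 ^ (n + 4)) →+* F) (w : Kq (2 ^ (n + 4)))
    (hw : (w : ℝ) = omegaJReal (2 ^ (n + 4)) 1 + omegaJReal (2 ^ (n + 4)) (2 ^ (n + 2) - 1) + 3) :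
    minpoly ℚ (f w) = minpoly ℚ (conjugateExpr (2 ^ (n + 2)) ζ) := by
  have hirr := Polynomial.cyclotomic.irreducible_rat (n := 2 ^ (n + 4)) (by positivity)
  have hexp := Complex.isPrimitiveRoot_exp (2 ^ (n + 4)) (by positivity)
  obtain ⟨σ, hσ⟩ := (hζ.embeddingsEquivPrimitiveRoots ℂ hirr).surjective
    ⟨_, (mem_primitiveRoots (by positivity)).mpr hexp⟩
  replace hσ : σ ζ = Complex.exp (2 * Real.pi * Complex.I / (2 ^ (n + 4) : ℕ)) :=
    congrArg Subtype.val hσ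
  have h1 : minpoly ℚ (f w) = minpoly ℚ w := minpoly.algHom_eq f.toRatAlgHom f.injective w
  have h2 : minpoly ℚ ((w : ℝ) : ℂ) = minpoly ℚ w :=
    minpoly.algHom_eq ((Complex.ofRealHom.comp (algebraMap (Kq (2 ^ (n + 4))) ℝ)).toRatAlgHom)
      (RingHom.injective _) w
  rw [h1, ← h2, hw, coe_eq_conjugateExpr_exp, ← hσ]
  refine (congrArg (minpoly ℚ) (map_conjugateExpr σ.toRingHom _ ζ)).symm.trans ?_
  exact minpoly.algHom_eq σ σ.injective _

/-- For `q = 2^n` with `n > 3`, `d = 2^(n-2)` and `γ_n = ω + ω_{d-1} + 3`, if `F` is a totally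
real number field containing `K_{2^n}`, then `γ_n` is an indecomposable totally positive
integer of `F`. -/
theorem stmt13 (n : ℕ) (hn : 3 < n) (q d : ℕ) (hq : q = 2 ^ n) (hd : d = 2 ^ (n - 2))
    (F : Type*) [Field F] [NumberField F]
    (htr : ∀ (σ : F →+* ℂ) (x : F), (σ x).im = 0)
    (f : ↥(Kq q) →+* F)
    (w : ↥(Kq q)) (hw : (w : ℝ) = omegaJReal q 1 + omegaJReal q (d - 1) + 3)
    (γ : 𝓞 F) (hγ : (γ : F) = f w) :
    TotallyPositive F γ ∧ Indecomposable F γ := by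
  obtain ⟨k, rfl⟩ : ∃ k, n = k + 4 := ⟨n - 4, by omega⟩
  subst hq
  replace hd : d = 2 ^ (k + 2) := hd
  subst hd
  have : NeZero ((2 ^ (k + 4) : ℕ) : ℚ) := ⟨by positivity⟩
  have : IsCyclotomicExtension {2 ^ (k + 4)} ℚ (CyclotomicField (2 ^ (k + 4)) ℚ) :=
    CyclotomicField.isCyclotomicExtension (2 ^ (k + 4)) ℚ
  have hζ := IsCyclotomicExtension.zeta_spec (2 ^ (k + 4)) ℚ (CyclotomicField (2 ^ (k + 4)) ℚ)
  have hmin := minpoly_eq_minpoly_conjugateExpr hζ f w hw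
  rw [← hγ] at hmin
  have hirr := Polynomial.cyclotomic.irreducible_rat (n := 2 ^ (k + 4)) (by positivity)
  constructor
  · intro σ
    have hmem : ((σ (γ : F) : ℝ) : ℂ) ∈ (minpoly ℚ (γ : F)).rootSet ℂ := by
      rw [← Algebra.IsAlgebraic.range_eval_eq_rootSet_minpoly ℂ (γ : F)]
      exact ⟨(Complex.ofRealHom.comp σ).toRatAlgHom, rfl⟩
    rw [hmin, ← Algebra.IsAlgebraic.range_eval_eq_rootSet_minpoly ℂ] at hmem
    obtain ⟨τ, hτ⟩ := hmem
    have hpos := conjugateExpr_re_pos (n := k + 2) (hζ.embeddingsEquivPrimitiveRoots ℂ hirr τ).2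
    rw [hζ.embeddingsEquivPrimitiveRoots_apply_coe, ← AlgHom.coe_toRingHom,
      ← map_conjugateExpr] at hpos
    have := congrArg Complex.re hτ
    rw [Complex.ofReal_re] at this
    exact this ▸ hpos
  · rintro ⟨β, δ, hβ, hδ, rfl⟩
    have hnorm := norm_pow_finrank_eq_of_minpoly_eq hmin
    have hL : Module.finrank ℚ (CyclotomicField (2 ^ (k + 4)) ℚ) = 2 ^ (k + 3) := by
      rw [IsCyclotomicExtension.finrank (n := 2 ^ (k + 4)) _ hirr,
        Nat.totient_prime_pow Nat.prime_two (by omega)]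
      simp
    have hm : 0 < Module.finrank ℚ F := Module.finrank_pos
    rw [norm_conjugateExpr_of_isPrimitiveRoot hζ, hL, ← Algebra.coe_norm_int] at hnorm
    have hnorm' : Algebra.norm ℤ (β + δ) ^ 2 ^ (k + 3) =
        ((2 ^ 2 ^ (k + 2) + 1) ^ 2) ^ Module.finrank ℚ F := by exact_mod_cast hnorm
    by_cases hne : β = δ
    · subst hne
      have heven : Even (Algebra.norm ℤ (β + β)) := by
        rw [← two_mul, map_mul]
        refine Even.mul_right ?_ _
        have h2 : Algebra.norm ℤ (2 : 𝓞 F) = 2 ^ Module.finrank ℚ F := by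
          have h := Algebra.coe_norm_int (2 : 𝓞 F)
          rw [show ((2 : 𝓞 F) : F) = algebraMap ℚ F 2 from
            (map_ofNat (algebraMap (𝓞 F) F) 2).trans (map_ofNat _ 2).symm,
            Algebra.norm_algebraMap] at h
          exact_mod_cast h
        rw [h2]
        exact even_two.pow_of_ne_zero hm.ne'
      have hodd : Odd (((2 ^ 2 ^ (k + 2) + 1 : ℤ) ^ 2) ^ Module.finrank ℚ F) :=
        ((Even.add_one ((even_two.pow_of_ne_zero (by positivity)))).pow).pow
      rw [← hnorm'] at hodd
      exact Int.not_even_iff_odd.mpr hodd (heven.pow_of_ne_zero (by positivity))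
    · have hle := le_norm_add_pow htr hβ hδ hne
      have hle' : ((3125 : ℤ) ^ 2 ^ (k + 3)) ^ Module.finrank ℚ F ≤
          ((2 ^ 2 ^ (k + 2) + 1) ^ 20) ^ Module.finrank ℚ F := by
        calc ((3125 : ℤ) ^ 2 ^ (k + 3)) ^ Module.finrank ℚ F
            = (3125 ^ Module.finrank ℚ F) ^ 2 ^ (k + 3) := pow_right_comm _ _ _
          _ ≤ (Algebra.norm ℤ (β + δ) ^ 10) ^ 2 ^ (k + 3) := by gcongr
          _ = (Algebra.norm ℤ (β + δ) ^ 2 ^ (k + 3)) ^ 10 := pow_right_comm _ _ _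
          _ = _ := by rw [hnorm', pow_right_comm, ← pow_mul _ 2 10]
      rw [pow_le_pow_iff_left₀ (by positivity) (by positivity) hm.ne'] at hle'
      have hlt : (2 ^ 2 ^ (k + 2) + 1 : ℤ) ^ 2 < 5 ^ 2 ^ (k + 2) := by
        have hd : 2 ^ (k + 2) = 4 * 2 ^ k := by ring
        have h := sq_add_one_lt_pow (n := 2 ^ k) (by positivity)
        rw [hd, pow_mul, pow_mul]
        norm_num only
        exact h
      have : (3125 : ℤ) ^ 2 ^ (k + 3) = (5 ^ 2 ^ (k + 2)) ^ 10 := by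
        rw [show (3125 : ℤ) = 5 ^ 5 by norm_num, ← pow_mul, ← pow_mul]; congr 1; ring
      rw [this, show (20 : ℕ) = 2 * 10 by norm_num, pow_mul] at hle'
      exact absurd hle' (not_le.mpr (pow_lt_pow_left₀ hlt (by positivity) (by norm_num)))
end
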